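/- Let k ≥ 3. If D is a k-extremal digraph, then D = ↔K_{k+1}, or D is a symmetric odd wheel (this case occurring only when k = 3), or D is a directed Hajós join of two k-extremal digraphs, or D is a Hajós bijoin of two k-extremal digraphs. -/

import Mathlib

/-!
Common framework: finite digraphs on vertex set a `Finset ℕ`,
loopless and without parallel arcs (arcs are a `Finset (ℕ × ℕ)`).
-/

structure Dgraph where
  verts : Finset ℕ
  arcs : Finset (ℕ × ℕ)

namespace Dgraph

/-- Well-formedness: every arc joins two distinct vertices of the digraph
(no loops, arcs within the vertex set). -/
def WF (D : Dgraph) : Prop :=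
  ∀ a ∈ D.arcs, a.1 ∈ D.verts ∧ a.2 ∈ D.verts ∧ a.1 ≠ a.2

/-- `p` is a directed path from `u` to `v` in `D` (vertices pairwise distinct,
consecutive pairs are arcs). -/
def IsDipath (D : Dgraph) (p : List ℕ) (u v : ℕ) : Prop :=
  p.Nodup ∧ p.head? = some u ∧ p.getLast? = some v ∧
    (∀ x ∈ p, x ∈ D.verts) ∧ p.Chain' (fun a b => (a, b) ∈ D.arcs)

/-- The set of arcs used by a path (consecutive pairs). -/
def arcsOf (p : List ℕ) : Finset (ℕ × ℕ) := (p.zip p.tail).toFinset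

/-- Local arc-connectivity `λ(u,v)`: the maximum number of pairwise
arc-disjoint directed paths from `u` to `v`. -/
noncomputable def locLam (D : Dgraph) (u v : ℕ) : ℕ :=
  sSup {n | ∃ P : Fin n → List ℕ, (∀ i, D.IsDipath (P i) u v) ∧
    Pairwise fun i j => Disjoint (arcsOf (P i)) (arcsOf (P j))}

/-- Maximum local arc-connectivity `λ(D)`. -/
noncomputable def lam (D : Dgraph) : ℕ :=
  sSup {n | ∃ u ∈ D.verts, ∃ v ∈ D.verts, u ≠ v ∧ n = D.locLam u v}

/-- `p` is a directed cycle of `D` (cyclically consecutive pairs are arcs,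
vertices pairwise distinct). -/
def IsDicycle (D : Dgraph) (p : List ℕ) : Prop :=
  2 ≤ p.length ∧ p.Nodup ∧ (∀ x ∈ p, x ∈ D.verts) ∧
    p.Chain' (fun a b => (a, b) ∈ D.arcs) ∧
    ∀ x y, p.getLast? = some x → p.head? = some y → (x, y) ∈ D.arcs

/-- A colouring `φ` of the vertices with `k` colours is a `k`-dicolouring if
no directed cycle is monochromatic, i.e. every colour class induces an
acyclic subdigraph. -/
def IsDicolouring (D : Dgraph) (k : ℕ) (φ : ℕ → Fin k) : Prop :=
  ∀ p, D.IsDicycle p → ¬∃ c, ∀ x ∈ p, φ x = c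

/-- The dichromatic number: least `k` admitting a `k`-dicolouring. -/
noncomputable def dichi (D : Dgraph) : ℕ :=
  sInf {k | ∃ φ : ℕ → Fin k, D.IsDicolouring k φ}

/-- A monochromatic list of vertices. -/
def Mono {k : ℕ} (φ : ℕ → Fin k) (p : List ℕ) : Prop := ∃ c, ∀ x ∈ p, φ x = c

/-- `D` is strong: any vertex can reach any other by a directed path. -/
def Strong (D : Dgraph) : Prop :=
  ∀ u ∈ D.verts, ∀ v ∈ D.verts, u ≠ v → ∃ p, D.IsDipath p u v

/-- Induced subdigraph on `S`. -/
def induce (D : Dgraph) (S : Finset ℕ) : Dgraph where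
  verts := D.verts ∩ S
  arcs := D.arcs.filter fun a => a.1 ∈ S ∧ a.2 ∈ S

/-- Adjacency in the underlying undirected graph. -/
def adj (D : Dgraph) (x y : ℕ) : Prop := (x, y) ∈ D.arcs ∨ (y, x) ∈ D.arcs

/-- Reachability in the underlying undirected graph. -/
def UReach (D : Dgraph) (x y : ℕ) : Prop := Relation.ReflTransGen D.adj x y

/-- Connectivity of the underlying undirected graph. -/
def UConnected (D : Dgraph) : Prop :=
  D.verts.Nonempty ∧ ∀ u ∈ D.verts, ∀ v ∈ D.verts, D.UReach u v

/-- Deletion of a vertex. -/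
def delVert (D : Dgraph) (v : ℕ) : Dgraph := D.induce (D.verts.erase v)

/-- `v` is a cutvertex: its removal disconnects the underlying graph. -/
def IsCutvertex (D : Dgraph) (v : ℕ) : Prop :=
  v ∈ D.verts ∧ ¬(D.delVert v).UConnected

/-- Biconnected: the underlying graph is connected and has no cutvertex. -/
def Biconnected (D : Dgraph) : Prop :=
  D.UConnected ∧ ∀ v, ¬D.IsCutvertex v

/-- `D` is `k`-extremal: biconnected, strong and `χ⃗(D) = λ(D) + 1 = k + 1`. -/
def Extremal (k : ℕ) (D : Dgraph) : Prop :=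
  D.Biconnected ∧ D.Strong ∧ D.dichi = k + 1 ∧ D.lam = k

/-- The arcs of the dicut `(X, X̄)`: arcs from `X` to its complement. -/
def dicutArcs (D : Dgraph) (X : Finset ℕ) : Finset (ℕ × ℕ) :=
  D.arcs.filter fun a => a.1 ∈ X ∧ a.2 ∉ X

/-- `X` is the side of a dicut: `∅ ≠ X ⊊ V(D)`. -/
def IsDicutSide (D : Dgraph) (X : Finset ℕ) : Prop :=
  X ⊆ D.verts ∧ X.Nonempty ∧ X ≠ D.verts

/-- `(X, X̄)` is a minimum dicut of `D`. -/
def IsMinDicut (D : Dgraph) (X : Finset ℕ) : Prop :=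
  D.IsDicutSide X ∧ ∀ Y, D.IsDicutSide Y → (D.dicutArcs X).card ≤ (D.dicutArcs Y).card

def outdeg (D : Dgraph) (v : ℕ) : ℕ := (D.arcs.filter fun a => a.1 = v).card
def indeg (D : Dgraph) (v : ℕ) : ℕ := (D.arcs.filter fun a => a.2 = v).card

/-- Eulerian: every vertex has equal in- and out-degree. -/
def Eulerian (D : Dgraph) : Prop := ∀ v ∈ D.verts, D.outdeg v = D.indeg v

/-- Deleting a set of arcs. -/
def delArcs (D : Dgraph) (s : Finset (ℕ × ℕ)) : Dgraph := ⟨D.verts, D.arcs \ s⟩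

/-- Adding an arc. -/
def addArc (D : Dgraph) (u v : ℕ) : Dgraph :=
  ⟨insert u (insert v D.verts), insert (u, v) D.arcs⟩

/-- `D` is `m`-dicritical: `χ⃗(D) = m` and deleting any arc drops the
dichromatic number to at most `m - 1`. -/
def Dicritical (m : ℕ) (D : Dgraph) : Prop :=
  D.dichi = m ∧ ∀ a ∈ D.arcs, (D.delArcs {a}).dichi ≤ m - 1

/-- Renaming a vertex `x` to `y`. -/
def ren (x y z : ℕ) : ℕ := if z = x then y else z

def renArc (x y : ℕ) (a : ℕ × ℕ) : ℕ × ℕ := (ren x y a.1, ren x y a.2)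

/-- Cyclically consecutive pairs of a list: the arcs of the directed cycle
through `p` in this cyclic order. -/
def cycArcs (p : List ℕ) : Finset (ℕ × ℕ) := (p.zip (p.rotate 1)).toFinset

/-- `D` is a directed cycle. -/
def IsDirectedCycleGraph (D : Dgraph) : Prop :=
  ∃ p : List ℕ, 2 ≤ p.length ∧ p.Nodup ∧ D.verts = p.toFinset ∧ D.arcs = cycArcs p

/-- `D` is the bidirected complete digraph `↔K_n`. -/
def IsBiComplete (D : Dgraph) (n : ℕ) : Prop :=
  D.verts.card = n ∧ D.arcs = (D.verts ×ˢ D.verts).filter fun a => a.1 ≠ a.2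

/-- Arcs of a bidirected (symmetric) cycle through `p`. -/
def symmCyc (p : List ℕ) : Finset (ℕ × ℕ) := cycArcs p ∪ (cycArcs p).image Prod.swap

/-- `D` is a symmetric odd wheel: a bidirected odd cycle (≥ 3 vertices)
plus a hub joined by digons to all cycle vertices. -/
def IsSymOddWheel (D : Dgraph) : Prop :=
  ∃ (p : List ℕ) (x : ℕ), 3 ≤ p.length ∧ Odd p.length ∧ p.Nodup ∧ x ∉ p ∧
    D.verts = insert x p.toFinset ∧
    D.arcs = symmCyc p ∪ p.toFinset.image (fun y => (x, y)) ∪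
      p.toFinset.image (fun y => (y, x))

/-- A fresh vertex not in `D`. -/
def fresh (D : Dgraph) : ℕ := (D.verts.sup id) + 1

/-- Contraction `D/X`: `X` is contracted into a single new vertex; arcs
inside `X` are deleted and parallel arcs created by contraction are
identified. -/
def contract (D : Dgraph) (X : Finset ℕ) : Dgraph where
  verts := insert (fresh D) (D.verts \ X)
  arcs := (D.arcs.image fun a =>
      (if a.1 ∈ X then fresh D else a.1, if a.2 ∈ X then fresh D else a.2)).filter
      fun a => a.1 ≠ a.2

/-- `D` is the directed Hajós join of `D1` and `D2` with respect to the arcs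
`(u,v1) ∈ A(D1)` and `(v2,w) ∈ A(D2)`, the vertices `v1, v2` being
identified into the new vertex `v`, and the arc `(u,w)` being added. -/
def IsDirHajosJoinAt (D D1 D2 : Dgraph) (u v1 v2 w v : ℕ) : Prop :=
  D1.WF ∧ D2.WF ∧ Disjoint D1.verts D2.verts ∧
  (u, v1) ∈ D1.arcs ∧ (v2, w) ∈ D2.arcs ∧
  v ∉ (D1.verts.erase v1) ∪ (D2.verts.erase v2) ∧
  D.verts = insert v ((D1.verts.erase v1) ∪ (D2.verts.erase v2)) ∧
  D.arcs = insert (u, w)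
    (((D1.arcs.erase (u, v1)) ∪ (D2.arcs.erase (v2, w))).image
      fun a => renArc v2 v (renArc v1 v a))

def IsDirHajosJoin (D D1 D2 : Dgraph) : Prop :=
  ∃ u v1 v2 w v, IsDirHajosJoinAt D D1 D2 u v1 v2 w v

/-- Bidirected Hajós join with respect to the digons `[u,v1] ⊆ A(D1)` and
`[w,v2] ⊆ A(D2)`. -/
def IsBidirHajosJoinAt (D D1 D2 : Dgraph) (u v1 v2 w v : ℕ) : Prop :=
  D1.WF ∧ D2.WF ∧ Disjoint D1.verts D2.verts ∧
  (u, v1) ∈ D1.arcs ∧ (v1, u) ∈ D1.arcs ∧ (w, v2) ∈ D2.arcs ∧ (v2, w) ∈ D2.arcs ∧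
  v ∉ (D1.verts.erase v1) ∪ (D2.verts.erase v2) ∧
  D.verts = insert v ((D1.verts.erase v1) ∪ (D2.verts.erase v2)) ∧
  D.arcs = insert (u, w) (insert (w, u)
    (((D1.arcs \ {(u, v1), (v1, u)}) ∪ (D2.arcs \ {(w, v2), (v2, w)})).image
      fun a => renArc v2 v (renArc v1 v a)))

def IsBidirHajosJoin (D D1 D2 : Dgraph) : Prop :=
  ∃ u v1 v2 w v, IsBidirHajosJoinAt D D1 D2 u v1 v2 w v

/-- Hajós bijoin of `D1` and `D2` with respect to `((t,a1,w),(v,a2,u))`: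
`ta1, a1w ∈ A(D1)` with `t,w` in the same connected component of `D1 ∖ a1`,
`va2, a2u ∈ A(D2)` with `u,v` in the same connected component of `D2 ∖ a2`;
`a1` and `a2` are identified into the new vertex `a` and the arcs
`tu` and `vw` are added. -/
def IsHajosBijoinAt (D D1 D2 : Dgraph) (t a1 w v a2 u a : ℕ) : Prop :=
  D1.WF ∧ D2.WF ∧ Disjoint D1.verts D2.verts ∧
  (t, a1) ∈ D1.arcs ∧ (a1, w) ∈ D1.arcs ∧
  (v, a2) ∈ D2.arcs ∧ (a2, u) ∈ D2.arcs ∧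
  (D1.delVert a1).UReach t w ∧
  (D2.delVert a2).UReach u v ∧
  a ∉ (D1.verts.erase a1) ∪ (D2.verts.erase a2) ∧
  D.verts = insert a ((D1.verts.erase a1) ∪ (D2.verts.erase a2)) ∧
  D.arcs = insert (t, u) (insert (v, w)
    (((D1.arcs \ {(t, a1), (a1, w)}) ∪ (D2.arcs \ {(v, a2), (a2, u)})).image
      fun x => renArc a2 a (renArc a1 a x)))

def IsHajosBijoin (D D1 D2 : Dgraph) : Prop :=
  ∃ t a1 w v a2 u a, IsHajosBijoinAt D D1 D2 t a1 w v a2 u a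

/-! ### Trees, Euler tours and Hajós tree joins -/

/-- Vertex set of the tree given by edges `e : Fin n → ℕ × ℕ`. -/
def treeVerts (n : ℕ) (e : Fin n → ℕ × ℕ) : Finset ℕ :=
  Finset.univ.image (fun i => (e i).1) ∪ Finset.univ.image (fun i => (e i).2)

/-- The bidirected digraph `↔T` of the tree. -/
def treeDigraph (n : ℕ) (e : Fin n → ℕ × ℕ) : Dgraph where
  verts := treeVerts n e
  arcs := Finset.univ.image (fun i : Fin n => e i) ∪
    Finset.univ.image (fun i : Fin n => (e i).swap)

/-- `e` lists the edges of a tree: loopless, pairwise distinct edges,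
connected, with `n + 1` vertices for `n` edges. -/
def IsTree (n : ℕ) (e : Fin n → ℕ × ℕ) : Prop :=
  (∀ i, (e i).1 ≠ (e i).2) ∧
  (∀ i j, i ≠ j → e i ≠ e j ∧ e i ≠ (e j).swap) ∧
  (treeDigraph n e).UConnected ∧
  (treeVerts n e).card = n + 1

/-- The leaves of the tree: vertices incident to exactly one edge. -/
def leafSet (n : ℕ) (e : Fin n → ℕ × ℕ) : Finset ℕ :=
  (treeVerts n e).filter fun x =>
    (Finset.univ.filter fun i : Fin n => (e i).1 = x ∨ (e i).2 = x).card = 1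

/-- `L` is an Eulerian list of the tree: the cyclic sequence of consecutive
pairs of `L` traverses each arc of `↔T` exactly once. -/
def IsEulerTour (n : ℕ) (e : Fin n → ℕ × ℕ) (L : List ℕ) : Prop :=
  ((L.zip (L.rotate 1) : List (ℕ × ℕ)) : Multiset (ℕ × ℕ)) = (treeDigraph n e).arcs.val

/-- `C` is a partial Eulerian list: a circular sublist of an Eulerian list
containing every leaf, in which every non-leaf vertex appears at most once. -/
def IsPartialEulerList (n : ℕ) (e : Fin n → ℕ × ℕ) (C : List ℕ) : Prop :=
  ∃ L m, IsEulerTour n e L ∧ List.Sublist C (L.rotate m) ∧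
    (∀ x ∈ leafSet n e, x ∈ C) ∧
    ∀ x ∈ C, x ∉ leafSet n e → C.count x ≤ 1

/-- Compatibility of the data of a (extended) Hajós tree join:
a tree with edges `uᵢvᵢ = e i`, digraphs `Ds i` with
`V(Ds i) ∩ V(T) = {uᵢ, vᵢ}`, `[uᵢ,vᵢ] ⊆ A(Ds i)` and whose remaining
vertex sets are pairwise disjoint. -/
def JoinCompat (n : ℕ) (e : Fin n → ℕ × ℕ) (Ds : Fin n → Dgraph) : Prop :=
  IsTree n e ∧ (∀ i, (Ds i).WF) ∧
  (∀ i, (Ds i).verts ∩ treeVerts n e = {(e i).1, (e i).2}) ∧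
  (∀ i, e i ∈ (Ds i).arcs ∧ (e i).swap ∈ (Ds i).arcs) ∧
  (∀ i j, i ≠ j →
    Disjoint ((Ds i).verts \ {(e i).1, (e i).2}) ((Ds j).verts \ {(e j).1, (e j).2}))

/-- The digraph obtained from the digraphs `Ds i − [uᵢ,vᵢ]` by adding the
directed cycle through the list `C`. -/
def joinOf (n : ℕ) (e : Fin n → ℕ × ℕ) (Ds : Fin n → Dgraph) (C : List ℕ) : Dgraph where
  verts := Finset.univ.biUnion fun i => (Ds i).verts
  arcs := (Finset.univ.biUnion fun i => (Ds i).arcs \ {e i, (e i).swap}) ∪ cycArcs C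

/-- `D` is the Hajós tree join `T(D₁, …, Dₙ; C)`: the peripheral cycle runs
through the leaves of `T` in the circular order given by a plane embedding
of `T` (equivalently, the order of the leaves along an Euler tour of `↔T`). -/
def IsHajosTreeJoin (D : Dgraph) (n : ℕ) (e : Fin n → ℕ × ℕ)
    (Ds : Fin n → Dgraph) : Prop :=
  JoinCompat n e Ds ∧ ∃ L, IsEulerTour n e L ∧
    D = joinOf n e Ds (L.filter fun x => decide (x ∈ leafSet n e))

/-- `D` is an extended Hajós tree join: the peripheral cycle runs through a
partial Eulerian list of `T`. -/
def IsExtHajosTreeJoin (D : Dgraph) (n : ℕ) (e : Fin n → ℕ × ℕ)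
    (Ds : Fin n → Dgraph) : Prop :=
  JoinCompat n e Ds ∧ ∃ C, IsPartialEulerList n e C ∧ D = joinOf n e Ds C

/-- Hajós star join: a Hajós tree join whose tree is a star. -/
def IsHajosStarJoin (D : Dgraph) (n : ℕ) (e : Fin n → ℕ × ℕ)
    (Ds : Fin n → Dgraph) : Prop :=
  IsHajosTreeJoin D n e Ds ∧ ∃ c, ∀ i, (e i).1 = c ∨ (e i).2 = c

/-- The class `H⃗_k`: for `k = 3` the smallest class containing the symmetric
odd wheels and closed under directed Hajós joins and Hajós tree joins; for
`k ≥ 4` the smallest class containing `↔K_{k+1}` and closed under directed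
Hajós joins and Hajós tree joins. -/
inductive HClass (k : ℕ) : Dgraph → Prop
  | wheel (D : Dgraph) (hk : k = 3) (h : IsSymOddWheel D) : HClass k D
  | complete (D : Dgraph) (hk : 4 ≤ k) (h : IsBiComplete D (k + 1)) : HClass k D
  | dirJoin (D D1 D2 : Dgraph) (h1 : HClass k D1) (h2 : HClass k D2)
      (h : IsDirHajosJoin D D1 D2) : HClass k D
  | treeJoin (D : Dgraph) (n : ℕ) (e : Fin n → ℕ × ℕ) (Ds : Fin n → Dgraph)
      (h : ∀ i, HClass k (Ds i)) (hj : IsHajosTreeJoin D n e Ds) : HClass k D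

/-- The class `EH⃗T_k`: for `k = 3` the smallest class containing the
symmetric odd wheels and closed under extended Hajós tree joins; for `k ≥ 4`
the smallest class containing `↔K_{k+1}` and closed under extended Hajós
tree joins. -/
inductive EHTClass (k : ℕ) : Dgraph → Prop
  | wheel (D : Dgraph) (hk : k = 3) (h : IsSymOddWheel D) : EHTClass k D
  | complete (D : Dgraph) (hk : 4 ≤ k) (h : IsBiComplete D (k + 1)) : EHTClass k D
  | extJoin (D : Dgraph) (n : ℕ) (e : Fin n → ℕ × ℕ) (Ds : Fin n → Dgraph)
      (h : ∀ i, EHTClass k (Ds i)) (hj : IsExtHajosTreeJoin D n e Ds) : EHTClass k D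

/-- Parallel Hajós join of `D_AC` and `D_B` with respect to
`(t, u, v, w, [a,b])`. -/
def IsParallelHajosJoinAt (D DAC DB : Dgraph) (A C : Finset ℕ)
    (x t u v w a b : ℕ) : Prop :=
  DAC.WF ∧ DB.WF ∧
  (a, b) ∈ DB.arcs ∧ (b, a) ∈ DB.arcs ∧
  DAC.verts = A ∪ C ∧ A ∩ C = {x} ∧
  t ∈ A.erase x ∧ w ∈ A.erase x ∧ u ∈ C.erase x ∧ v ∈ C.erase x ∧
  (t, u) ∈ DAC.arcs ∧ (v, w) ∈ DAC.arcs ∧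
  (DAC.delVert x).UReach t w ∧
  ((DAC.induce C).delVert x).UReach u v ∧
  Disjoint DAC.verts DB.verts ∧
  D.verts = DB.verts ∪ (A.erase x) ∪ (C.erase x) ∧
  D.arcs = insert (t, u) (insert (v, w)
    ((DB.arcs \ {(a, b), (b, a)}) ∪
      ((DAC.induce A).arcs.image (renArc x a)) ∪
      ((DAC.induce C).arcs.image (renArc x b))))

def IsParallelHajosJoin (D DAC DB : Dgraph) : Prop :=
  ∃ A C x t u v w a b, IsParallelHajosJoinAt D DAC DB A C x t u v w a b

/-- `S` is (the vertex set of) a strong component of `D`. -/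
def IsStrongComponent (D : Dgraph) (S : Finset ℕ) : Prop :=
  S ⊆ D.verts ∧ S.Nonempty ∧ (D.induce S).Strong ∧
  ∀ S', S ⊆ S' → S' ⊆ D.verts → (D.induce S').Strong → S' = S

/-- `B` is (the vertex set of) a block of `D`: a maximal set inducing a
biconnected subdigraph. -/
def IsBlock (D : Dgraph) (B : Finset ℕ) : Prop :=
  B ⊆ D.verts ∧ (D.induce B).Biconnected ∧
  ∀ B', B ⊆ B' → B' ⊆ D.verts → (D.induce B').Biconnected → B' = B

end Dgraph

open Dgraph

open Dgraph

set_option linter.all false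
namespace Ex
open Relation

/-- arcs leaving `X` -/
def cut (A : Finset (ℕ × ℕ)) (X : Finset ℕ) : Finset (ℕ × ℕ) :=
  A.filter fun e => e.1 ∈ X ∧ e.2 ∉ X

/-- arcs inside `X` -/
def ind (A : Finset (ℕ × ℕ)) (X : Finset ℕ) : Finset (ℕ × ℕ) :=
  A.filter fun e => e.1 ∈ X ∧ e.2 ∈ X

/-- arcs avoiding `X` -/
def away (A : Finset (ℕ × ℕ)) (X : Finset ℕ) : Finset (ℕ × ℕ) :=
  A.filter fun e => e.1 ∉ X ∧ e.2 ∉ X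

def odeg (A : Finset (ℕ × ℕ)) (v : ℕ) : ℕ := (A.filter fun e => e.1 = v).card
def ideg (A : Finset (ℕ × ℕ)) (v : ℕ) : ℕ := (A.filter fun e => e.2 = v).card

/-- monochromatic arcs -/
def mono {C : Type} (A : Finset (ℕ × ℕ)) (φ : ℕ → C) (a b : ℕ) : Prop :=
  (a, b) ∈ A ∧ φ a = φ b

/-- colouring without monochromatic directed cycle -/
def Col {C : Type} (A : Finset (ℕ × ℕ)) (φ : ℕ → C) : Prop :=
  ∀ x, ¬ TransGen (mono A φ) x x

def Colb (k : ℕ) (A : Finset (ℕ × ℕ)) : Prop := ∃ φ : ℕ → Fin k, Col A φ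

theorem mem_cut {A : Finset (ℕ × ℕ)} {X : Finset ℕ} {e : ℕ × ℕ} :
    e ∈ cut A X ↔ e ∈ A ∧ e.1 ∈ X ∧ e.2 ∉ X := by simp [cut]
theorem mem_ind {A : Finset (ℕ × ℕ)} {X : Finset ℕ} {e : ℕ × ℕ} :
    e ∈ ind A X ↔ e ∈ A ∧ e.1 ∈ X ∧ e.2 ∈ X := by simp [ind]
theorem mem_away {A : Finset (ℕ × ℕ)} {X : Finset ℕ} {e : ℕ × ℕ} :
    e ∈ away A X ↔ e ∈ A ∧ e.1 ∉ X ∧ e.2 ∉ X := by simp [away]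

theorem acyc_mono {r s : ℕ → ℕ → Prop} (h : ∀ a b, r a b → s a b)
    (hs : ∀ x, ¬ TransGen s x x) : ∀ x, ¬ TransGen r x x :=
  fun x hx => hs x (TransGen.mono h _ _ hx)

theorem Col.subset {C : Type} {A B : Finset (ℕ × ℕ)} {φ : ℕ → C} (h : Col B φ) (hAB : A ⊆ B) :
    Col A φ := acyc_mono (fun _ _ hr => ⟨hAB hr.1, hr.2⟩) h

theorem Colb.subset {k : ℕ} {A B : Finset (ℕ × ℕ)} (h : Colb k B) (hAB : A ⊆ B) :
    Colb k A := by
  obtain ⟨φ, h⟩ := h; exact ⟨φ, h.subset hAB⟩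

theorem Col.comp_inj {C C' : Type} {A : Finset (ℕ × ℕ)} {φ : ℕ → C} (h : Col A φ) (f : C → C')
    (hf : Function.Injective f) : Col A (f ∘ φ) :=
  acyc_mono (fun _ _ hr => ⟨hr.1, hf hr.2⟩) h

theorem Col.congr {C : Type} {A : Finset (ℕ × ℕ)} {φ ψ : ℕ → C} (h : Col A φ)
    (hc : ∀ e ∈ A, φ e.1 = ψ e.1 ∧ φ e.2 = ψ e.2) : Col A ψ :=
  acyc_mono (fun a b hr => ⟨hr.1, by
    have := hc _ hr.1
    have h2 := hr.2
    simp only at this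
    rw [this.1, this.2]; exact h2⟩) h

/-- closed walks not crossing from `X` outwards -/
theorem acyc_of_nocross {r : ℕ → ℕ → Prop} (X : ℕ → Prop) (h : ∀ a b, r a b → X a → X b)
    (h1 : ∀ x, ¬ TransGen (fun a b => r a b ∧ X a ∧ X b) x x)
    (h2 : ∀ x, ¬ TransGen (fun a b => r a b ∧ ¬ X a ∧ ¬ X b) x x) :
    ∀ x, ¬ TransGen r x x := by
  intro x hx
  by_cases hX : X x
  · have : ∀ y, TransGen r x y → X y ∧ TransGen (fun a b => r a b ∧ X a ∧ X b) x y := by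
      intro y hy
      induction hy with
      | single hr => exact ⟨h _ _ hr hX, .single ⟨hr, hX, h _ _ hr hX⟩⟩
      | tail _ hr ih => exact ⟨h _ _ hr ih.1, ih.2.tail ⟨hr, ih.1, h _ _ hr ih.1⟩⟩
    exact h1 x (this x hx).2
  · have key : ∀ y, TransGen r y x → ¬ X y ∧ TransGen (fun a b => r a b ∧ ¬ X a ∧ ¬ X b) y x := by
      intro y hy
      induction hy using TransGen.head_induction_on with
      | single hr => exact ⟨fun hy => hX (h _ _ hr hy), .single ⟨hr, fun hy => hX (h _ _ hr hy), hX⟩⟩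
      | head hr _ ih =>
        have : ¬ X _ := fun hy => ih.1 (h _ _ hr hy)
        exact ⟨this, ih.2.head ⟨hr, this, ih.1⟩⟩
    exact h2 x (key x hx).2

/-- unique crossing arc -/
theorem unique_cross {r : ℕ → ℕ → Prop} (X : ℕ → Prop) (p q : ℕ)
    (hp : X p) (hq : ¬ X q)
    (h : ∀ a b, r a b → X a → ¬ X b → a = p ∧ b = q)
    (h1 : ∀ x, ¬ TransGen (fun a b => r a b ∧ X a ∧ X b) x x)
    (h2 : ∀ x, ¬ TransGen (fun a b => r a b ∧ ¬ X a ∧ ¬ X b) x x)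
    (hc : ¬ ∀ x, ¬ TransGen r x x) :
    ∃ b a, r b a ∧ ¬ X b ∧ X a ∧ r p q ∧
      ReflTransGen (fun a b => r a b ∧ ¬ X a ∧ ¬ X b) q b ∧
      ReflTransGen (fun a b => r a b ∧ X a ∧ X b) a p := by
  push Not at hc
  obtain ⟨x, hx⟩ := hc
  set s : ℕ → ℕ → Prop := fun a b => r a b ∧ ¬ (a = p ∧ b = q) with hs
  have hsX : ∀ a b, s a b → X a → X b := by
    intro a b hab ha
    by_contra hb
    exact hab.2 (h a b hab.1 ha hb)
  have hsac : ∀ x, ¬ TransGen s x x := by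
    apply acyc_of_nocross X hsX
    · exact acyc_mono (fun a b hab => ⟨hab.1.1, hab.2⟩) h1
    · exact acyc_mono (fun a b hab => ⟨hab.1.1, hab.2⟩) h2
  -- any r-walk is an s-walk or passes p q
  have key : ∀ y, TransGen r x y → TransGen s x y ∨ (r p q ∧ ReflTransGen s x p ∧ ReflTransGen s q y)
      ∨ (r p q ∧ ReflTransGen s q p) := by
    intro y hy
    induction hy with
    | single hr =>
      rename_i b
      by_cases hb : x = p ∧ b = q
      · obtain ⟨rfl, rfl⟩ := hb
        exact Or.inr (Or.inl ⟨hr, .refl, .refl⟩)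
      · exact Or.inl (.single ⟨hr, hb⟩)
    | tail h00 hr ih =>
      rename_i b c
      by_cases hb : b = p ∧ c = q
      · obtain ⟨rfl, rfl⟩ := hb
        rcases ih with ih | ih | ih
        · exact Or.inr (Or.inl ⟨hr, ih.to_reflTransGen, .refl⟩)
        · exact Or.inr (Or.inr ⟨hr, ih.2.2⟩)
        · exact Or.inr (Or.inr ih)
      · rcases ih with ih | ih | ih
        · exact Or.inl (ih.tail ⟨hr, hb⟩)
        · exact Or.inr (Or.inl ⟨ih.1, ih.2.1, ih.2.2.tail ⟨hr, hb⟩⟩)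
        · exact Or.inr (Or.inr ih)
  have hpq : r p q ∧ ReflTransGen s q p := by
    rcases key x hx with h | h | h
    · exact absurd h (hsac x)
    · exact ⟨h.1, h.2.2.trans h.2.1⟩
    · exact h
  have key2 : ∀ y, ReflTransGen s q y → (¬ X y ∧ ReflTransGen (fun a b => r a b ∧ ¬ X a ∧ ¬ X b) q y) ∨
      (X y ∧ ∃ b a, r b a ∧ ¬ X b ∧ X a ∧
      ReflTransGen (fun a b => r a b ∧ ¬ X a ∧ ¬ X b) q b ∧
      ReflTransGen (fun a b => r a b ∧ X a ∧ X b) a y) := by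
    intro y hy
    induction hy with
    | refl => exact Or.inl ⟨hq, .refl⟩
    | tail h00 hr ih =>
      rename_i b c
      rcases ih with ⟨h3, h4⟩ | ⟨h3, b', a', h5, h6, h7, h8, h9⟩
      · by_cases hc : X c
        · exact Or.inr ⟨hc, b, c, hr.1, h3, hc, h4, .refl⟩
        · exact Or.inl ⟨hc, h4.tail ⟨hr.1, h3, hc⟩⟩
      · have := hsX _ _ hr h3
        exact Or.inr ⟨this, b', a', h5, h6, h7, h8, h9.tail ⟨hr.1, h3, this⟩⟩
  rcases key2 p hpq.2 with h | ⟨_, b, a, h5, h6, h7, h8, h9⟩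
  · exact absurd hp h.1
  · exact ⟨b, a, h5, h6, h7, hpq.1, h8, h9⟩

/-- gluing two colourings with no monochromatic arcs leaving `X` -/
theorem glue_col {C : Type} {A : Finset (ℕ × ℕ)} {X : Finset ℕ} {α β : ℕ → C}
    (hα : Col (ind A X) α) (hβ : Col (away A X) β)
    (hcross : ∀ e ∈ cut A X, α e.1 ≠ β e.2) :
    Col A (fun v => if v ∈ X then α v else β v) := by
  apply acyc_of_nocross (fun v => v ∈ X)
  · intro a b hab ha
    by_contra hb
    have h2 := hab.2
    simp only [ha, hb, if_true, if_false] at h2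
    exact hcross (a, b) (mem_cut.2 ⟨hab.1, ha, hb⟩) h2
  · refine acyc_mono ?_ hα
    rintro a b ⟨hab, ha, hb⟩
    have h2 := hab.2
    simp only [ha, hb, if_true] at h2
    exact ⟨mem_ind.2 ⟨hab.1, ha, hb⟩, h2⟩
  · refine acyc_mono ?_ hβ
    rintro a b ⟨hab, ha, hb⟩
    have h2 := hab.2
    simp only [ha, hb, if_false] at h2
    exact ⟨mem_away.2 ⟨hab.1, ha, hb⟩, h2⟩

/-- colouring one more vertex -/
theorem extend_one {C : Type} {A : Finset (ℕ × ℕ)} {φ : ℕ → C} {w : ℕ} {c : C}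
    (hloop : (w, w) ∉ A)
    (h : Col (away A {w}) φ)
    (hc : (∀ a, (a, w) ∈ A → φ a ≠ c) ∨ (∀ b, (w, b) ∈ A → φ b ≠ c)) :
    Col A (Function.update φ w c) := by
  have e1 : ∀ a b, mono A (Function.update φ w c) a b → a ≠ w → b ≠ w →
      mono (away A {w}) φ a b := by
    intro a b hab ha hb
    have h2 := hab.2
    rw [Function.update_of_ne ha, Function.update_of_ne hb] at h2
    exact ⟨mem_away.2 ⟨hab.1, by simpa using ha, by simpa using hb⟩, h2⟩
  have e2 : ∀ x, ¬ TransGen (fun a b => mono A (Function.update φ w c) a b ∧ a = w ∧ b = w) x x := by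
    refine acyc_mono (s := fun _ _ => False) ?_ ?_
    · rintro a b ⟨hab, rfl, rfl⟩; exact hloop hab.1
    · intro x hx
      obtain ⟨z, _, hz⟩ := TransGen.tail'_iff.1 hx
      exact hz
  rcases hc with hc | hc
  · apply acyc_of_nocross (fun v => v ≠ w)
    · rintro a b hab ha rfl
      have h2 := hab.2
      rw [Function.update_of_ne ha, Function.update_self] at h2
      exact hc a hab.1 h2
    · exact acyc_mono (fun a b hab => e1 a b hab.1 hab.2.1 hab.2.2) h
    · exact acyc_mono (fun a b hab => ⟨hab.1, not_not.1 hab.2.1, not_not.1 hab.2.2⟩) e2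
  · apply acyc_of_nocross (fun v => v = w)
    · rintro a b hab rfl
      by_contra hb
      have h2 := hab.2
      rw [Function.update_of_ne hb, Function.update_self] at h2
      exact hc b hab.1 h2.symm
    · exact e2
    · exact acyc_mono (fun a b hab => e1 a b hab.1 hab.2.1 hab.2.2) h

/-- permutations and cells -/
theorem perm_surj {k : ℕ} [NeZero k] {ι : Type} (s : Finset ι) (f g : ι → Fin k)
    (hall : ∀ σ : Equiv.Perm (Fin k), ∃ e ∈ s, σ (g e) = f e) (τ : Equiv.Perm (Fin k)) :
    s.image (fun e => f e - τ (g e)) = Finset.univ := by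
  apply Finset.eq_univ_of_forall
  intro t
  obtain ⟨e, he, h⟩ := hall (τ.trans (Equiv.addRight t))
  refine Finset.mem_image.2 ⟨e, he, ?_⟩
  simp at h
  rw [← h]; simp

theorem perm_card {k : ℕ} [NeZero k] {ι : Type} (s : Finset ι) (f g : ι → Fin k)
    (hall : ∀ σ : Equiv.Perm (Fin k), ∃ e ∈ s, σ (g e) = f e) : k ≤ s.card := by
  have h := perm_surj s f g hall 1
  have h2 : (s.image (fun e => f e - (1 : Equiv.Perm (Fin k)) (g e))).card ≤ s.card := Finset.card_image_le
  rw [h] at h2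
  simpa using h2

theorem exists_perm_two {k : ℕ} (i i' j j' : Fin k) (h : i = i' ↔ j = j') :
    ∃ τ : Equiv.Perm (Fin k), τ j = i ∧ τ j' = i' := by
  by_cases hj : j = j'
  · have hi := h.2 hj
    subst hj; subst hi
    exact ⟨Equiv.swap j i, by simp, by simp⟩
  · have hi : i ≠ i' := fun hi => hj (h.1 hi)
    refine ⟨(Equiv.swap j i).trans (Equiv.swap (Equiv.swap j i j') i'), ?_, ?_⟩
    · simp only [Equiv.trans_apply, Equiv.swap_apply_left]
      rw [Equiv.swap_apply_of_ne_of_ne _ hi]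
      intro h1
      have : Equiv.swap j i j = Equiv.swap j i j' := by rw [← h1]; simp
      exact hj ((Equiv.swap j i).injective this)
    · simp

theorem perm_eq {k : ℕ} [NeZero k] {ι : Type} (s : Finset ι) (f g : ι → Fin k)
    (hall : ∀ σ : Equiv.Perm (Fin k), ∃ e ∈ s, σ (g e) = f e) (hs : s.card = k) :
    ((∀ e ∈ s, ∀ e' ∈ s, f e = f e') ∧ Set.InjOn g s) ∨
    ((∀ e ∈ s, ∀ e' ∈ s, g e = g e') ∧ Set.InjOn f s) := by
  have h1 : ∀ τ : Equiv.Perm (Fin k), Set.InjOn (fun e => f e - τ (g e)) s := by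
    intro τ
    rw [← Finset.card_image_iff, perm_surj s f g hall τ]
    simp [hs]
  have h2 : ∀ e ∈ s, ∀ e' ∈ s, e ≠ e' → ¬ (f e = f e' ↔ g e = g e') := by
    intro e he e' he' hne h
    obtain ⟨τ, ht1, ht2⟩ := exists_perm_two _ _ _ _ h
    apply hne
    apply h1 τ he he'
    simp [ht1, ht2]
  by_cases hf : ∀ e ∈ s, ∀ e' ∈ s, f e = f e'
  · left
    refine ⟨hf, ?_⟩
    intro e he e' he' hg
    by_contra hne
    exact h2 e he e' he' hne ⟨fun _ => hg, fun _ => hf e he e' he'⟩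
  · right
    push Not at hf
    obtain ⟨a, ha, b, hb, hab⟩ := hf
    have hgab : g a = g b := by
      by_contra hg
      exact h2 a ha b hb (fun h => hab (by rw [h])) ⟨fun h => absurd h hab, fun h => absurd h hg⟩
    have hga : ∀ e ∈ s, g e = g a := by
      intro e he
      by_contra hg
      have ea : f e = f a := by
        by_contra hf'
        exact h2 e he a ha (fun h => hg (by rw [h])) ⟨fun h => absurd h hf', fun h => absurd h hg⟩
      have eb : f e = f b := by
        by_contra hf'
        have hg' : g e ≠ g b := by rw [← hgab]; exact hg
        exact h2 e he b hb (fun h => hg' (by rw [h])) ⟨fun h => absurd h hf', fun h => absurd h hg'⟩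
      exact hab (ea.symm.trans eb)
    have hg : ∀ e ∈ s, ∀ e' ∈ s, g e = g e' := fun e he e' he' => (hga e he).trans (hga e' he').symm
    refine ⟨hg, ?_⟩
    intro e he e' he' hfe
    by_contra hne
    exact h2 e he e' he' hne ⟨fun _ => hg e he e' he', fun _ => hfe⟩

/-- sets grown one vertex at a time -/
inductive Built (R : ℕ → ℕ → Prop) (u : ℕ) : Finset ℕ → Prop
  | base : Built R u {u}
  | step (T : Finset ℕ) (w w' : ℕ) : Built R u T → w ∉ T → w' ∈ T → R w' w → Built R u (insert w T)

theorem Built.mem {R : ℕ → ℕ → Prop} {u : ℕ} {T : Finset ℕ} (h : Built R u T) : u ∈ T := by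
  induction h with
  | base => simp
  | step T w w' _ _ _ _ ih => simp [ih]

theorem built_of_conn {R : ℕ → ℕ → Prop} {u : ℕ} {U : Finset ℕ} (hu : u ∈ U)
    (h : ∀ X ⊆ U, u ∈ X → X ≠ U → ∃ w' ∈ X, ∃ w ∈ U, w ∉ X ∧ R w' w) : Built R u U := by
  classical
  have hne : (U.powerset.filter (fun T => Built R u T)).Nonempty :=
    ⟨{u}, by simp [hu, Built.base]⟩
  obtain ⟨T, hT, hmax⟩ := Finset.exists_max_image _ Finset.card hne
  simp only [Finset.mem_filter, Finset.mem_powerset] at hT hmax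
  by_cases hTU : T = U
  · rw [← hTU]; exact hT.2
  · obtain ⟨w', hw', w, hw, hwT, hR⟩ := h T hT.1 hT.2.mem hTU
    have := hmax (insert w T) ⟨Finset.insert_subset hw hT.1, Built.step T w w' hT.2 hwT hw' hR⟩
    rw [Finset.card_insert_of_notMem hwT] at this
    omega

theorem exists_color {k : ℕ} (L : Finset (Fin k)) (N : Finset (ℕ × ℕ)) (f : ℕ × ℕ → Fin k)
    (h : N.card < L.card) : ∃ c ∈ L, ∀ e ∈ N, f e ≠ c := by
  have : ¬ L ⊆ N.image f := fun hs => by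
    have := (Finset.card_le_card hs).trans Finset.card_image_le
    omega
  obtain ⟨c, hc, hn⟩ := Finset.not_subset.1 this
  exact ⟨c, hc, fun e he h => hn (Finset.mem_image.2 ⟨e, he, h⟩)⟩

theorem greedy {k : ℕ} {A : Finset (ℕ × ℕ)} (hloop : ∀ e ∈ A, e.1 ≠ e.2)
    {R : ℕ → ℕ → Prop} {u : ℕ} {L : ℕ → Finset (Fin k)} {T : Finset ℕ} (hT : Built R u T)
    (hR : ∀ w ∈ T, w ≠ u → ∀ w' ∈ T, R w' w →
      ((w', w) ∈ A ∧ ideg A w ≤ (L w).card) ∨ ((w, w') ∈ A ∧ odeg A w ≤ (L w).card))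
    (φ : ℕ → Fin k) (hφ : Col (away A T) φ) :
    ∃ φ' : ℕ → Fin k, (∀ v, v ∉ T → φ' v = φ v) ∧ (∀ w ∈ T, w ≠ u → φ' w ∈ L w) ∧
      Col (away A {u}) φ' := by
  induction hT generalizing φ with
  | base => exact ⟨φ, fun _ _ => rfl, fun w hw hne => absurd (Finset.mem_singleton.1 hw) hne, hφ⟩
  | step T w w' hB hw hw' hr ih =>
    have hwu : w ≠ u := fun h => hw (h ▸ hB.mem)
    have hcol : ∃ c ∈ L w, (∀ a, (a, w) ∈ away A T → φ a ≠ c) ∨ (∀ b, (w, b) ∈ away A T → φ b ≠ c) := by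
      rcases hR w (Finset.mem_insert_self _ _) hwu w' (Finset.mem_insert_of_mem hw') hr with ⟨h1, h2⟩ | ⟨h1, h2⟩
      · have hlt : ((away A T).filter fun e => e.2 = w).card < (L w).card := by
          refine lt_of_lt_of_le (Finset.card_lt_card ?_) h2
          refine ⟨fun e he => ?_, fun hs => ?_⟩
          · simp only [Finset.mem_filter, mem_away] at he ⊢; exact ⟨he.1.1, he.2⟩
          · have := hs (show (w', w) ∈ _ by simp [h1])
            simp only [Finset.mem_filter, mem_away] at this
            exact this.1.2.1 hw'
        obtain ⟨c, hc, hc2⟩ := exists_color (L w) _ (fun e => φ e.1) hlt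
        exact ⟨c, hc, Or.inl fun a ha => hc2 (a, w) (by simp [ha])⟩
      · have hlt : ((away A T).filter fun e => e.1 = w).card < (L w).card := by
          refine lt_of_lt_of_le (Finset.card_lt_card ?_) h2
          refine ⟨fun e he => ?_, fun hs => ?_⟩
          · simp only [Finset.mem_filter, mem_away] at he ⊢; exact ⟨he.1.1, he.2⟩
          · have := hs (show (w, w') ∈ _ by simp [h1])
            simp only [Finset.mem_filter, mem_away] at this
            exact this.1.2.2 hw'
        obtain ⟨c, hc, hc2⟩ := exists_color (L w) _ (fun e => φ e.2) hlt
        exact ⟨c, hc, Or.inr fun a ha => hc2 (w, a) (by simp [ha])⟩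
    obtain ⟨c, hcL, hc⟩ := hcol
    have hnew : Col (away A T) (Function.update φ w c) := by
      refine extend_one ?_ (hφ.subset ?_) hc
      · intro h; exact hloop _ (mem_away.1 h).1 rfl
      · intro e he
        simp only [mem_away, Finset.mem_singleton, Finset.mem_insert] at he ⊢
        tauto
    obtain ⟨φ', h1, h2, h3⟩ := ih (fun w hw hne w' hw' => hR w (Finset.mem_insert_of_mem hw) hne w' (Finset.mem_insert_of_mem hw')) _ hnew
    refine ⟨φ', ?_, ?_, h3⟩
    · intro v hv
      simp only [Finset.mem_insert, not_or] at hv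
      rw [h1 v hv.2, Function.update_of_ne hv.1]
    · intro v hv hne
      rcases Finset.mem_insert.1 hv with rfl | hv
      · rw [h1 v hw, Function.update_self]; exact hcL
      · exact h2 v hv hne

end Ex

set_option linter.all false
namespace Ex
open Relation

structure Ext (k : ℕ) (V : Finset ℕ) (A : Finset (ℕ × ℕ)) : Prop where
  wf : ∀ e ∈ A, e.1 ∈ V ∧ e.2 ∈ V ∧ e.1 ≠ e.2
  strong : ∀ X ⊆ V, X.Nonempty → X ≠ V → (cut A X).Nonempty
  bic : ∀ s ∈ V, ∀ C ⊆ V.erase s, C.Nonempty → C ≠ V.erase s →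
    ∃ e ∈ A, (e.1 ∈ C ∧ e.2 ∈ V.erase s \ C) ∨ (e.2 ∈ C ∧ e.1 ∈ V.erase s \ C)
  ncol : ¬ Colb k A
  sep : ∀ u ∈ V, ∀ v ∈ V, u ≠ v → ∃ Y ⊆ V, u ∈ Y ∧ v ∉ Y ∧ (cut A Y).card ≤ k

def vs (Q : Finset (ℕ × ℕ)) : Finset ℕ := Q.image Prod.fst ∪ Q.image Prod.snd

theorem mem_vs {Q : Finset (ℕ × ℕ)} {v : ℕ} : v ∈ vs Q ↔ ∃ e ∈ Q, e.1 = v ∨ e.2 = v := by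
  simp only [vs, Finset.mem_union, Finset.mem_image]
  constructor
  · rintro (⟨e, h, h'⟩ | ⟨e, h, h'⟩)
    exacts [⟨e, h, Or.inl h'⟩, ⟨e, h, Or.inr h'⟩]
  · rintro ⟨e, h, h' | h'⟩
    exacts [Or.inl ⟨e, h, h'⟩, Or.inr ⟨e, h, h'⟩]

def Crit (k : ℕ) (Q : Finset (ℕ × ℕ)) : Prop := ¬ Colb k Q ∧ ∀ Q' ⊂ Q, Colb k Q'

theorem exists_crit {k : ℕ} {A : Finset (ℕ × ℕ)} (h : ¬ Colb k A) : ∃ Q ⊆ A, Crit k Q := by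
  classical
  have hne : (A.powerset.filter (fun T => ¬ Colb k T)).Nonempty := ⟨A, by simp [h]⟩
  obtain ⟨T, hT, hmin⟩ := Finset.exists_min_image _ Finset.card hne
  simp only [Finset.mem_filter, Finset.mem_powerset] at hT hmin
  refine ⟨T, hT.1, hT.2, fun Q' hQ' => ?_⟩
  by_contra hc
  have := hmin Q' ⟨hQ'.1.trans hT.1, hc⟩
  have := Finset.card_lt_card hQ'
  omega

theorem crit_cut {k : ℕ} (hk : 0 < k) {Q : Finset (ℕ × ℕ)} (hQ : Crit k Q) {X : Finset ℕ}
    (h1 : ∃ v ∈ vs Q, v ∈ X) (h2 : ∃ v ∈ vs Q, v ∉ X) : k ≤ (cut Q X).card := by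
  haveI : NeZero k := ⟨by omega⟩
  obtain ⟨v, hv, hvX⟩ := h1
  obtain ⟨u, hu, huX⟩ := h2
  have hi : ind Q X ⊂ Q := by
    refine Finset.filter_ssubset.2 ?_
    obtain ⟨e, he, h⟩ := mem_vs.1 hu
    exact ⟨e, he, by rcases h with rfl | rfl <;> tauto⟩
  have ha : away Q X ⊂ Q := by
    refine Finset.filter_ssubset.2 ?_
    obtain ⟨e, he, h⟩ := mem_vs.1 hv
    exact ⟨e, he, by rcases h with rfl | rfl <;> tauto⟩
  obtain ⟨α, hα⟩ := hQ.2 _ hi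
  obtain ⟨β, hβ⟩ := hQ.2 _ ha
  apply perm_card (cut Q X) (fun e => α e.1) (fun e => β e.2)
  intro σ
  by_contra hc
  push Not at hc
  exact hQ.1 ⟨_, glue_col hα (hβ.comp_inj σ σ.injective) (fun e he h => hc e he h.symm)⟩

/-- the ear lemma -/
theorem ear {k : ℕ} {V : Finset ℕ} {A Q : Finset (ℕ × ℕ)}
    (wf : ∀ e ∈ A, e.1 ∈ V ∧ e.2 ∈ V ∧ e.1 ≠ e.2)
    (strong : ∀ X ⊆ V, X.Nonempty → X ≠ V → (cut A X).Nonempty)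
    (sep : ∀ u ∈ V, ∀ v ∈ V, u ≠ v → ∃ Y ⊆ V, u ∈ Y ∧ v ∉ Y ∧ (cut A Y).card ≤ k)
    (hQA : Q ⊆ A) (hne : Q.Nonempty)
    (hcut : ∀ X : Finset ℕ, (∃ v ∈ vs Q, v ∈ X) → (∃ v ∈ vs Q, v ∉ X) → k ≤ (cut Q X).card) :
    (∀ e ∈ A, e.1 ∈ vs Q → e.2 ∈ vs Q → e ∈ Q) ∧
    ∃ q : ℕ → ℕ, ∀ w ∈ V, w ∉ vs Q → q w ∈ vs Q ∧
      (∀ v ∈ vs Q, ((v, w) ∈ A ∨ (w, v) ∈ A) → v = q w) ∧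
      (∀ w' ∈ V, w' ∉ vs Q → (w, w') ∈ A → q w' = q w) := by
  classical
  have hUV : vs Q ⊆ V := by
    intro v hv
    obtain ⟨e, he, h⟩ := mem_vs.1 hv
    have := wf e (hQA he)
    rcases h with rfl | rfl <;> tauto
  -- key cut
  have key : ∀ u ∈ vs Q, ∀ v ∈ vs Q, u ≠ v → ∃ Y ⊆ V, u ∈ Y ∧ v ∉ Y ∧ cut A Y ⊆ Q := by
    intro u hu v hv huv
    obtain ⟨Y, hY, h1, h2, h3⟩ := sep u (hUV hu) v (hUV hv) huv
    refine ⟨Y, hY, h1, h2, ?_⟩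
    have hs : cut Q Y ⊆ cut A Y := fun e he => by
      rw [mem_cut] at he ⊢; exact ⟨hQA he.1, he.2⟩
    have := Finset.eq_of_subset_of_card_le hs (h3.trans (hcut Y ⟨u, hu, h1⟩ ⟨v, hv, h2⟩))
    rw [← this]
    exact fun e he => (mem_cut.1 he).1
  have hQU : ∀ e ∈ Q, e.1 ∈ vs Q ∧ e.2 ∈ vs Q := fun e he =>
    ⟨mem_vs.2 ⟨e, he, Or.inl rfl⟩, mem_vs.2 ⟨e, he, Or.inr rfl⟩⟩
  refine ⟨?_, ?_⟩
  · intro e he h1 h2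
    obtain ⟨Y, hY, h3, h4, h5⟩ := key _ h1 _ h2 (wf e he).2.2
    exact h5 (mem_cut.2 ⟨he, h3, h4⟩)
  set U := vs Q with hU
  set R : ℕ → ℕ → Prop := fun a b => (a, b) ∈ A ∧ a ∉ U ∧ b ∉ U with hR
  have path : ∀ v ∈ U, ∀ v' ∈ U, ∀ w w', w ∉ U → w' ∉ U → (v, w) ∈ A → ReflTransGen R w w' →
      (w', v') ∈ A → v = v' := by
    intro v hv v' hv' w w' hw hw' h1 h2 h3
    by_contra hvv
    obtain ⟨Y, hY, h4, h5, h6⟩ := key v hv v' hv' hvv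
    have hwY : w ∈ Y := by
      by_contra h
      exact hw (hQU _ (h6 (mem_cut.2 ⟨h1, h4, h⟩))).2
    have hw'Y : w' ∈ Y := by
      clear h3
      induction h2 with
      | refl => exact hwY
      | tail h7 h8 ih =>
        by_contra h
        exact h8.2.2 (hQU _ (h6 (mem_cut.2 ⟨h8.1, ih h8.2.1, h⟩))).2
    exact hw' (hQU _ (h6 (mem_cut.2 ⟨h3, hw'Y, h5⟩))).1
  obtain ⟨e0, he0⟩ := hne
  have hin : ∀ w ∈ V, w ∉ U → ∃ v ∈ U, ∃ w0, w0 ∉ U ∧ (v, w0) ∈ A ∧ ReflTransGen R w0 w := by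
    intro w hw hwU
    set X := V.filter (fun x => ¬ (x ∉ U ∧ ReflTransGen R x w)) with hX
    obtain ⟨e, he⟩ := strong X (Finset.filter_subset _ _)
      ⟨e0.1, by simp only [hX, Finset.mem_filter]; exact ⟨hUV (hQU _ he0).1, fun h => h.1 (hQU _ he0).1⟩⟩
      (fun h => by
        have : w ∈ X := by rw [h]; exact hw
        simp only [hX, Finset.mem_filter] at this
        exact this.2 ⟨hwU, .refl⟩)
    rw [mem_cut] at he
    simp only [hX, Finset.mem_filter] at he
    have h2 : e.2 ∉ U ∧ ReflTransGen R e.2 w := by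
      by_contra h; exact he.2.2 ⟨(wf e he.1).2.1, h⟩
    have h1 : e.1 ∈ U := by
      by_contra h
      exact he.2.1.2 ⟨h, h2.2.head ⟨he.1, h, h2.1⟩⟩
    exact ⟨e.1, h1, e.2, h2.1, he.1, h2.2⟩
  have hout : ∀ w ∈ V, w ∉ U → ∃ v ∈ U, ∃ w0, w0 ∉ U ∧ (w0, v) ∈ A ∧ ReflTransGen R w w0 := by
    intro w hw hwU
    set X := V.filter (fun x => (x ∉ U ∧ ReflTransGen R w x)) with hX
    obtain ⟨e, he⟩ := strong X (Finset.filter_subset _ _)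
      ⟨w, by simp only [hX, Finset.mem_filter]; exact ⟨hw, hwU, .refl⟩⟩
      (fun h => by
        have : e0.1 ∈ X := by rw [h]; exact hUV (hQU _ he0).1
        simp only [hX, Finset.mem_filter] at this
        exact this.2.1 (hQU _ he0).1)
    rw [mem_cut] at he
    simp only [hX, Finset.mem_filter] at he
    have h1 : e.2 ∈ U := by
      by_contra h
      exact he.2.2 ⟨(wf e he.1).2.1, h, he.2.1.2.2.tail ⟨he.1, he.2.1.2.1, h⟩⟩
    exact ⟨e.2, h1, e.1, he.2.1.2.1, he.1, he.2.1.2.2⟩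
  have hin' : ∀ w, ∃ v, w ∈ V → w ∉ U → v ∈ U ∧ ∃ w0, w0 ∉ U ∧ (v, w0) ∈ A ∧ ReflTransGen R w0 w := by
    intro w
    by_cases h : w ∈ V ∧ w ∉ U
    · obtain ⟨v, h1, h2⟩ := hin w h.1 h.2
      exact ⟨v, fun _ _ => ⟨h1, h2⟩⟩
    · exact ⟨0, fun h1 h2 => absurd ⟨h1, h2⟩ h⟩
  choose q hq using hin'
  have hqin : ∀ w ∈ V, w ∉ U → ∀ v ∈ U, ∀ w0, w0 ∉ U → (v, w0) ∈ A → ReflTransGen R w0 w → v = q w := by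
    intro w hw hwU v hv w0 hw0 h1 h2
    obtain ⟨v', hv', w1, hw1, h3, h4⟩ := hout w hw hwU
    obtain ⟨h5, w2, h6, h7, h8⟩ := hq w hw hwU
    rw [path v hv v' hv' w0 w1 hw0 hw1 h1 (h2.trans h4) h3,
      path (q w) h5 v' hv' w2 w1 h6 hw1 h7 (h8.trans h4) h3]
  refine ⟨q, fun w hw hwU => ⟨(hq w hw hwU).1, ?_, ?_⟩⟩
  · rintro v hv (h | h)
    · exact hqin w hw hwU v hv w hwU h .refl
    · obtain ⟨h5, w2, h6, h7, h8⟩ := hq w hw hwU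
      exact (path _ h5 v hv w2 w h6 hwU h7 h8 h).symm
  · intro w' hw' hwU' h
    obtain ⟨h5, w2, h6, h7, h8⟩ := hq w hw hwU
    exact (hqin w' hw' hwU' _ h5 w2 h6 h7 (h8.tail ⟨h, hwU, hwU'⟩)).symm

theorem colb_empty {k : ℕ} (hk : 0 < k) : Colb k ∅ := by
  refine ⟨fun _ => ⟨0, hk⟩, fun x hx => ?_⟩
  obtain ⟨z, _, hz⟩ := TransGen.tail'_iff.1 hx
  exact absurd hz.1 (by simp)

theorem Crit.nonempty {k : ℕ} (hk : 0 < k) {Q : Finset (ℕ × ℕ)} (h : Crit k Q) : Q.Nonempty := by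
  rw [Finset.nonempty_iff_ne_empty]
  rintro rfl
  exact h.1 (colb_empty hk)

theorem Ext.crit {k : ℕ} (hk : 0 < k) {V A} (h : Ext k V A) : Crit k A ∧ vs A = V := by
  obtain ⟨Q, hQA, hQ⟩ := exists_crit h.ncol
  obtain ⟨e0, he0⟩ := hQ.nonempty hk
  obtain ⟨h1, q, hq⟩ := ear h.wf h.strong h.sep hQA (hQ.nonempty hk)
    (fun X h1 h2 => crit_cut hk hQ h1 h2)
  have hUV : vs Q ⊆ V := by
    intro v hv
    obtain ⟨e, he, h'⟩ := mem_vs.1 hv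
    have := h.wf e (hQA he)
    rcases h' with rfl | rfl <;> tauto
  have hVU : vs Q = V := by
    apply Finset.Subset.antisymm hUV
    by_contra hc
    obtain ⟨w, hw, hwU⟩ := Finset.not_subset.1 hc
    set s := q w
    have hs := (hq w hw hwU).1
    have hm1 : e0.1 ∈ vs Q := mem_vs.2 ⟨e0, he0, Or.inl rfl⟩
    have hm2 : e0.2 ∈ vs Q := mem_vs.2 ⟨e0, he0, Or.inr rfl⟩
    have hex : ∃ u ∈ vs Q, u ≠ s := by
      by_cases h1 : e0.1 = s
      · exact ⟨e0.2, hm2, fun h2 => (h.wf e0 (hQA he0)).2.2 (h1.trans h2.symm)⟩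
      · exact ⟨e0.1, hm1, h1⟩
    obtain ⟨u, hu, hus⟩ := hex
    obtain ⟨e, he, hcase⟩ := h.bic s (hUV hs) (V.filter (fun x => x ∉ vs Q ∧ q x = s))
      (fun x hx => by
        simp only [Finset.mem_filter] at hx
        exact Finset.mem_erase.2 ⟨fun h => hx.2.1 (h ▸ hs), hx.1⟩)
      ⟨w, by simp [hw, hwU, s]⟩
      (fun hh => by
        have : u ∈ V.erase s := Finset.mem_erase.2 ⟨hus, hUV hu⟩
        rw [← hh] at this
        simp only [Finset.mem_filter] at this
        exact this.2.1 hu)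
    simp only [Finset.mem_filter, Finset.mem_sdiff, Finset.mem_erase] at hcase
    rcases hcase with ⟨⟨a1, a2, a3⟩, ⟨b1, b2⟩, b3⟩ | ⟨⟨a1, a2, a3⟩, ⟨b1, b2⟩, b3⟩
    · by_cases hb : e.2 ∈ vs Q
      · exact b1 (((hq _ a1 a2).2.1 _ hb (Or.inr he)).trans a3)
      · exact b3 ⟨b2, hb, ((hq _ a1 a2).2.2 _ b2 hb he).trans a3⟩
    · by_cases hb : e.1 ∈ vs Q
      · exact b1 (((hq _ a1 a2).2.1 _ hb (Or.inl he)).trans a3)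
      · exact b3 ⟨b2, hb, ((hq _ b2 hb).2.2 _ a1 a2 he).symm.trans a3⟩
  have : Q = A := by
    apply Finset.Subset.antisymm hQA
    intro e he
    have := h.wf e he
    exact h1 e he (hVU ▸ this.1) (hVU ▸ this.2.1)
  subst this
  exact ⟨hQ, hVU⟩

theorem Ext.cut_ge {k : ℕ} (hk : 0 < k) {V A} (h : Ext k V A) {X : Finset ℕ} (hX : X ⊆ V)
    (h1 : X.Nonempty) (h2 : X ≠ V) : k ≤ (cut A X).card := by
  obtain ⟨hc, hv⟩ := h.crit hk
  obtain ⟨x, hx⟩ := h1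
  have : ∃ y ∈ V, y ∉ X := by
    by_contra hcon
    push Not at hcon
    exact h2 (Finset.Subset.antisymm hX hcon)
  obtain ⟨y, hy, hyX⟩ := this
  exact crit_cut hk hc ⟨x, hv ▸ hX hx, hx⟩ ⟨y, hv ▸ hy, hyX⟩

theorem submod (A : Finset (ℕ × ℕ)) (X Y : Finset ℕ) :
    (cut A (X ∪ Y)).card + (cut A (X ∩ Y)).card ≤ (cut A X).card + (cut A Y).card := by
  simp only [cut, Finset.card_filter, ← Finset.sum_add_distrib]
  apply Finset.sum_le_sum
  intro e _
  by_cases a : e.1 ∈ X <;> by_cases b : e.1 ∈ Y <;> by_cases c : e.2 ∈ X <;> by_cases d : e.2 ∈ Y <;>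
    simp [a, b, c, d]

theorem sum_odeg (A : Finset (ℕ × ℕ)) (X : Finset ℕ) :
    ∑ x ∈ X, odeg A x = (ind A X).card + (cut A X).card := by
  have h1 : (A.filter fun e => e.1 ∈ X).card = ∑ x ∈ X, odeg A x := by
    rw [Finset.card_eq_sum_card_fiberwise (f := Prod.fst) (t := X)]
    · apply Finset.sum_congr rfl
      intro x hx
      unfold odeg
      congr 1
      ext e
      simp only [Finset.mem_filter]
      constructor
      · rintro ⟨⟨a, b⟩, c⟩; exact ⟨a, c⟩
      · rintro ⟨a, c⟩; exact ⟨⟨a, c ▸ hx⟩, c⟩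
    · intro e he; simp at he; exact he.2
  rw [← h1, ← Finset.card_union_of_disjoint]
  · congr 1; ext e
    simp only [Finset.mem_filter, Finset.mem_union, mem_ind, mem_cut]
    tauto
  · rw [Finset.disjoint_left]; intro e h1 h2
    rw [mem_ind] at h1; rw [mem_cut] at h2; tauto

theorem sum_ideg {A : Finset (ℕ × ℕ)} {V : Finset ℕ} (wf : ∀ e ∈ A, e.1 ∈ V ∧ e.2 ∈ V) (X : Finset ℕ) :
    ∑ x ∈ X, ideg A x = (ind A X).card + (cut A (V \ X)).card := by
  have h1 : (A.filter fun e => e.2 ∈ X).card = ∑ x ∈ X, ideg A x := by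
    rw [Finset.card_eq_sum_card_fiberwise (f := Prod.snd) (t := X)]
    · apply Finset.sum_congr rfl
      intro x hx
      unfold ideg
      congr 1
      ext e
      simp only [Finset.mem_filter]
      constructor
      · rintro ⟨⟨a, b⟩, c⟩; exact ⟨a, c⟩
      · rintro ⟨a, c⟩; exact ⟨⟨a, c ▸ hx⟩, c⟩
    · intro e he; simp at he; exact he.2
  rw [← h1, ← Finset.card_union_of_disjoint]
  · congr 1; ext e
    simp only [Finset.mem_filter, Finset.mem_union, mem_ind, mem_cut, Finset.mem_sdiff]
    have := wf e
    tauto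
  · rw [Finset.disjoint_left]; intro e h1 h2
    rw [mem_ind] at h1; rw [mem_cut, Finset.mem_sdiff] at h2; tauto

theorem cut_single {A : Finset (ℕ × ℕ)} (hl : ∀ e ∈ A, e.1 ≠ e.2) (v : ℕ) :
    (cut A {v}).card = odeg A v := by
  unfold cut odeg
  congr 1; ext e
  simp only [Finset.mem_filter, Finset.mem_singleton]
  constructor
  · rintro ⟨a, b, c⟩; exact ⟨a, b⟩
  · rintro ⟨a, b⟩; exact ⟨a, b, fun h => hl e a (b.trans h.symm)⟩

/-- Eulerian -/
theorem Ext.euler {k : ℕ} (hk : 0 < k) {V A} (h : Ext k V A) : ∀ v, odeg A v = ideg A v := by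
  classical
  have hwf : ∀ e ∈ A, e.1 ∈ V ∧ e.2 ∈ V := fun e he => ⟨(h.wf e he).1, (h.wf e he).2.1⟩
  set b : ℕ → ℤ := fun v => (odeg A v : ℤ) - ideg A v with hb
  have hbal : ∀ X : Finset ℕ, ∑ x ∈ X, b x = ((cut A X).card : ℤ) - (cut A (V \ X)).card := by
    intro X
    have h1 := sum_odeg A X
    have h2 := sum_ideg hwf X
    simp only [hb, Finset.sum_sub_distrib]
    have h1' : (∑ x ∈ X, (odeg A x : ℤ)) = (ind A X).card + (cut A X).card := by exact_mod_cast h1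
    have h2' : (∑ x ∈ X, (ideg A x : ℤ)) = (ind A X).card + (cut A (V \ X)).card := by exact_mod_cast h2
    rw [h1', h2']; ring
  have htot : ∑ x ∈ V, b x = 0 := by
    rw [hbal V]
    have : cut A V = ∅ := by
      ext e; simp only [mem_cut, Finset.notMem_empty, iff_false]
      rintro ⟨a, _, c⟩; exact c (hwf e a).2
    rw [this, Finset.sdiff_self]
    simp [cut]
  have hnn : ∀ v ∈ V, 0 ≤ b v := by
    intro v hv
    by_contra hneg
    push Not at hneg
    set F := V.powerset.filter (fun Y => Y.Nonempty ∧ v ∉ Y ∧ (cut A Y).card ≤ k) with hF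
    have hFm : ∀ Y, Y ∈ F ↔ Y ⊆ V ∧ Y.Nonempty ∧ v ∉ Y ∧ (cut A Y).card ≤ k := by
      intro Y; simp [hF]
    have hprop : ∀ Y ⊆ V, v ∉ Y → Y ≠ V := fun Y _ h1 h2 => h1 (h2 ▸ hv)
    have hun : ∀ Y ∈ F, ∀ Y' ∈ F, (Y ∩ Y').Nonempty → Y ∪ Y' ∈ F := by
      intro Y hY Y' hY' hne
      rw [hFm] at *
      refine ⟨Finset.union_subset hY.1 hY'.1, hY.2.1.mono Finset.subset_union_left, ?_, ?_⟩
      · simp only [Finset.mem_union]; tauto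
      · have h1 := submod A Y Y'
        have h2 : k ≤ (cut A (Y ∩ Y')).card := by
          have hs : Y ∩ Y' ⊆ V := Finset.inter_subset_left.trans hY.1
          refine h.cut_ge hk hs hne (hprop _ hs ?_)
          simp only [Finset.mem_inter]; tauto
        omega
    set M := F.filter (fun Y => ∀ Y' ∈ F, Y ⊆ Y' → Y = Y') with hM
    have hdisj : (M : Set (Finset ℕ)).PairwiseDisjoint id := by
      intro Y hY Y' hY' hne
      simp only [hM, Finset.coe_filter, Set.mem_setOf_eq] at hY hY'
      by_contra hnd
      have hne' : (Y ∩ Y').Nonempty := by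
        rw [Finset.nonempty_iff_ne_empty]
        exact fun h0 => hnd (Finset.disjoint_iff_inter_eq_empty.2 h0)
      have := hun Y hY.1 Y' hY'.1 hne'
      exact hne ((hY.2 _ this Finset.subset_union_left).trans
        (hY'.2 _ this Finset.subset_union_right).symm)
    have hcov : M.biUnion id = V.erase v := by
      ext u
      simp only [Finset.mem_biUnion, id, Finset.mem_erase]
      constructor
      · rintro ⟨Y, hY, hu⟩
        simp only [hM, Finset.mem_filter, hFm] at hY
        exact ⟨fun h0 => hY.1.2.2.1 (h0 ▸ hu), hY.1.1 hu⟩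
      · rintro ⟨huv, hu⟩
        obtain ⟨Y, hY, h1, h2, h3⟩ := h.sep u hu v hv huv
        have hYF : Y ∈ F.filter (fun Z => Y ⊆ Z) := by
          simp only [Finset.mem_filter, hFm]
          exact ⟨⟨hY, ⟨u, h1⟩, h2, h3⟩, Finset.Subset.refl _⟩
        obtain ⟨Z, hZ, hmax⟩ := Finset.exists_max_image _ Finset.card ⟨Y, hYF⟩
        simp only [Finset.mem_filter] at hZ hmax
        refine ⟨Z, ?_, hZ.2 h1⟩
        simp only [hM, Finset.mem_filter]
        refine ⟨hZ.1, fun Y' hY' hsub => ?_⟩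
        exact Finset.eq_of_subset_of_card_le hsub (hmax Y' ⟨hY', hZ.2.trans hsub⟩)
    have h1 : ∑ x ∈ V.erase v, b x = ∑ Y ∈ M, ∑ x ∈ Y, b x := by
      rw [← hcov, Finset.sum_biUnion hdisj]; rfl
    have h2 : ∑ Y ∈ M, ∑ x ∈ Y, b x ≤ 0 := by
      apply Finset.sum_nonpos
      intro Y hY
      simp only [hM, Finset.mem_filter, hFm] at hY
      rw [hbal Y]
      have h3 : k ≤ (cut A (V \ Y)).card := by
        refine h.cut_ge hk Finset.sdiff_subset ⟨v, Finset.mem_sdiff.2 ⟨hv, hY.1.2.2.1⟩⟩ ?_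
        intro h0
        obtain ⟨y, hy⟩ := hY.1.2.1
        have : y ∈ V \ Y := by rw [h0]; exact hY.1.1 hy
        exact (Finset.mem_sdiff.1 this).2 hy
      have := hY.1.2.2.2
      omega
    have h3 := Finset.add_sum_erase V b hv
    omega
  have hzero : ∀ v ∈ V, b v = 0 := (Finset.sum_eq_zero_iff_of_nonneg hnn).1 htot
  intro v
  by_cases hv : v ∈ V
  · have := hzero v hv; simp only [hb] at this; omega
  · have h1 : odeg A v = 0 := by
      simp only [odeg, Finset.card_eq_zero, Finset.filter_eq_empty_iff]
      rintro e he rfl; exact hv (hwf e he).1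
    have h2 : ideg A v = 0 := by
      simp only [ideg, Finset.card_eq_zero, Finset.filter_eq_empty_iff]
      rintro e he rfl; exact hv (hwf e he).2
    rw [h1, h2]

theorem cut_compl_eq {V : Finset ℕ} {A : Finset (ℕ × ℕ)} (hwf : ∀ e ∈ A, e.1 ∈ V ∧ e.2 ∈ V)
    (he : ∀ v, odeg A v = ideg A v) (X : Finset ℕ) : (cut A (V \ X)).card = (cut A X).card := by
  have h1 := sum_odeg A X
  have h2 := sum_ideg hwf X
  have h3 : ∑ x ∈ X, odeg A x = ∑ x ∈ X, ideg A x := Finset.sum_congr rfl (fun x _ => he x)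
  omega

theorem Ext.hwf {k : ℕ} {V A} (h : Ext k V A) : ∀ e ∈ A, e.1 ∈ V ∧ e.2 ∈ V :=
  fun e he => ⟨(h.wf e he).1, (h.wf e he).2.1⟩

theorem Ext.cut_compl {k : ℕ} (hk : 0 < k) {V A} (h : Ext k V A) (X : Finset ℕ) :
    (cut A (V \ X)).card = (cut A X).card :=
  cut_compl_eq h.hwf (h.euler hk) X

/-- partition hypothesis -/
structure Part (A : Finset (ℕ × ℕ)) (X Z : Finset ℕ) : Prop where
  dj : Disjoint X Z
  cov : ∀ e ∈ A, (e.1 ∈ X ∨ e.1 ∈ Z) ∧ (e.2 ∈ X ∨ e.2 ∈ Z)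

theorem Part.symm {A X Z} (h : Part A X Z) : Part A Z X :=
  ⟨h.dj.symm, fun e he => ⟨(h.cov e he).1.symm, (h.cov e he).2.symm⟩⟩

theorem Part.away {A X Z} (h : Part A X Z) : away A X = ind A Z := by
  ext e
  rw [mem_away, mem_ind]
  constructor
  · rintro ⟨a, b, c⟩; have := h.cov e a; tauto
  · rintro ⟨a, b, c⟩
    exact ⟨a, fun h' => Finset.disjoint_left.1 h.dj h' b, fun h' => Finset.disjoint_left.1 h.dj h' c⟩

theorem Part.mem_cut {A X Z} (h : Part A X Z) {e} : e ∈ cut A X ↔ e ∈ A ∧ e.1 ∈ X ∧ e.2 ∈ Z := by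
  rw [Ex.mem_cut]
  constructor
  · rintro ⟨a, b, c⟩; have := h.cov e a; tauto
  · rintro ⟨a, b, c⟩; exact ⟨a, b, fun h' => Finset.disjoint_left.1 h.dj h' c⟩

theorem part_of {V : Finset ℕ} {A : Finset (ℕ × ℕ)} (hwf : ∀ e ∈ A, e.1 ∈ V ∧ e.2 ∈ V) (X : Finset ℕ) :
    Part A X (V \ X) := by
  refine ⟨Finset.disjoint_sdiff, fun e he => ?_⟩
  have := hwf e he
  simp only [Finset.mem_sdiff]; tauto

theorem rtg_color {C : Type} {B : Finset (ℕ × ℕ)} {φ : ℕ → C} {a b : ℕ}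
    (h : ReflTransGen (mono B φ) a b) : φ a = φ b := by
  induction h with
  | refl => rfl
  | tail _ hr ih => exact ih.trans hr.2

theorem cross {C : Type} {A : Finset (ℕ × ℕ)} {X Z : Finset ℕ} (hP : Part A X Z) {α β : ℕ → C}
    (hα : Col (ind A X) α) (hβ : Col (ind A Z) β)
    (hn : ∀ φ : ℕ → C, ¬ Col A φ) (e0 : ℕ × ℕ) (he0 : e0 ∈ cut A X)
    (hu : ∀ e ∈ cut A X, α e.1 = β e.2 → e = e0) :
    ∃ e ∈ cut A Z, β e.1 = α e.2 ∧ α e0.1 = β e0.2 ∧ β e0.2 = β e.1 ∧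
      ReflTransGen (mono (ind A X) α) e.2 e0.1 ∧ ReflTransGen (mono (ind A Z) β) e0.2 e.1 := by
  have hnx := hn (fun v => if v ∈ X then α v else β v)
  rw [mem_cut] at he0
  have e1 : ∀ a b, mono A (fun v => if v ∈ X then α v else β v) a b ∧ a ∈ X ∧ b ∈ X →
      mono (ind A X) α a b := by
    rintro a b ⟨hab, ha, hb⟩
    have h2 := hab.2
    simp only [ha, hb, if_true] at h2
    exact ⟨mem_ind.2 ⟨hab.1, ha, hb⟩, h2⟩
  have e2 : ∀ a b, mono A (fun v => if v ∈ X then α v else β v) a b ∧ a ∉ X ∧ b ∉ X →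
      mono (ind A Z) β a b := by
    rintro a b ⟨hab, ha, hb⟩
    have h2 := hab.2
    simp only [ha, hb, if_false] at h2
    refine ⟨?_, h2⟩
    rw [← hP.away]
    exact mem_away.2 ⟨hab.1, ha, hb⟩
  obtain ⟨b, a, h1, h2, h3, h4, h5, h6⟩ := unique_cross (fun v => v ∈ X) e0.1 e0.2 he0.2.1 he0.2.2
    (r := mono A (fun v => if v ∈ X then α v else β v))
    (by
      intro a b hab ha hb
      have h2 := hab.2
      simp only [ha, hb, if_true, if_false] at h2
      have := hu (a, b) (mem_cut.2 ⟨hab.1, ha, hb⟩) h2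
      rw [← this]; exact ⟨rfl, rfl⟩)
    (acyc_mono e1 hα) (acyc_mono e2 hβ) hnx
  have h7 := h4.2
  simp only [he0.2.1, he0.2.2, if_true, if_false] at h7
  have h8 := h1.2
  simp only [h2, h3, if_true, if_false] at h8
  have h6' := ReflTransGen.mono e1 _ _ h6
  have h5' := ReflTransGen.mono e2 _ _ h5
  refine ⟨(b, a), ?_, h8, h7, rtg_color h5', h6', h5'⟩
  rw [hP.symm.mem_cut]
  exact ⟨h1.1, ((hP.cov _ h1.1).1.resolve_left h2), h3⟩

end Ex

set_option linter.all false
namespace Ex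
open Relation

/-- `X` monochromatic side, `Z` rainbow side, for a pair of colourings -/
structure T1 {k : ℕ} (A : Finset (ℕ × ℕ)) (X Z : Finset ℕ) (α β : ℕ → Fin k) : Prop where
  mc : ∃ c, (∀ e ∈ cut A X, α e.1 = c) ∧ (∀ e ∈ cut A Z, α e.2 = c)
  ih : Set.InjOn (fun e : ℕ × ℕ => β e.2) (cut A X)
  it : Set.InjOn (fun e : ℕ × ℕ => β e.1) (cut A Z)
  pa : ∀ e ∈ cut A X, ∀ e' ∈ cut A Z, β e.2 = β e'.1 → ReflTransGen (mono (ind A X) α) e'.2 e.1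

def MR (k : ℕ) (A : Finset (ℕ × ℕ)) (X Z : Finset ℕ) : Prop :=
  ∀ α β : ℕ → Fin k, Col (ind A X) α → Col (ind A Z) β → T1 A X Z α β

theorem hall {k : ℕ} {A X Z} (hP : Part A X Z) (hn : ∀ φ : ℕ → Fin k, ¬ Col A φ) {α β : ℕ → Fin k}
    (hα : Col (ind A X) α) (hβ : Col (ind A Z) β) (σ : Equiv.Perm (Fin k)) :
    ∃ e ∈ cut A X, σ (β e.2) = α e.1 := by
  by_contra hc
  push Not at hc
  exact hn _ (glue_col hα (by rw [hP.away]; exact hβ.comp_inj σ σ.injective)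
    (fun e he h => hc e he h.symm))

theorem hall' {k : ℕ} {A X Z} (hP : Part A X Z) (hn : ∀ φ : ℕ → Fin k, ¬ Col A φ) {α β : ℕ → Fin k}
    (hα : Col (ind A X) α) (hβ : Col (ind A Z) β) (σ : Equiv.Perm (Fin k)) :
    ∃ e ∈ cut A Z, σ (β e.1) = α e.2 := by
  obtain ⟨e, he, h⟩ := hall hP.symm hn hβ hα σ.symm
  exact ⟨e, he, by rw [← h]; simp⟩

theorem T1_core {k : ℕ} {A X Z} (hP : Part A X Z) (hn : ∀ φ : ℕ → Fin k, ¬ Col A φ) {α β : ℕ → Fin k}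
    (hα : Col (ind A X) α) (hβ : Col (ind A Z) β)
    (h1 : ∀ e ∈ cut A X, ∀ e' ∈ cut A X, α e.1 = α e'.1)
    (h2 : Set.InjOn (fun e : ℕ × ℕ => β e.2) (cut A X))
    (h3 : ∀ e ∈ cut A Z, ∀ e' ∈ cut A Z, α e.2 = α e'.2)
    (h4 : Set.InjOn (fun e : ℕ × ℕ => β e.1) (cut A Z)) : T1 A X Z α β := by
  have key : ∀ e0 ∈ cut A X, ∀ σ : Equiv.Perm (Fin k), σ (β e0.2) = α e0.1 →
      ∃ e ∈ cut A Z, σ (β e.1) = α e.2 ∧ σ (β e0.2) = σ (β e.1) ∧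
        ReflTransGen (mono (ind A X) α) e.2 e0.1 := by
    intro e0 he0 σ hσ
    obtain ⟨e, a1, a2, a3, a4, a5, a6⟩ := cross hP hα (hβ.comp_inj σ σ.injective) hn e0 he0 (by
      intro e he hm
      apply h2 he he0
      apply σ.injective
      simp only [Function.comp] at hm
      rw [← hm, h1 e he e0 he0, hσ])
    exact ⟨e, a1, a2, a4, a5⟩
  refine ⟨?_, h2, h4, ?_⟩
  · obtain ⟨e0, he0, hs⟩ := hall hP hn hα hβ 1
    obtain ⟨e, a1, a2, a3, a4⟩ := key e0 he0 1 hs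
    refine ⟨α e0.1, fun e he => h1 e he e0 he0, fun e' he' => ?_⟩
    rw [h3 e' he' e a1]
    exact rtg_color a4
  · intro e he e' he' hb
    obtain ⟨σ, hσ, -⟩ := exists_perm_two (α e.1) (α e.1) (β e.2) (β e.2) (by simp)
    obtain ⟨e'', a1, a2, a3, a4⟩ := key e he σ hσ
    have : e'' = e' := h4 a1 he' ((σ.injective a3).symm.trans hb)
    rw [← this]; exact a4

theorem pairT {k : ℕ} (hk : 2 ≤ k) {A X Z} (hP : Part A X Z) (hn : ∀ φ : ℕ → Fin k, ¬ Col A φ)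
    (hX : (cut A X).card = k) (hZ : (cut A Z).card = k) {α β : ℕ → Fin k}
    (hα : Col (ind A X) α) (hβ : Col (ind A Z) β) : T1 A X Z α β ∨ T1 A Z X β α := by
  haveI : NeZero k := ⟨by omega⟩
  have two : ∀ c d : Fin k, ∃ σ : Equiv.Perm (Fin k), σ d ≠ c := by
    intro c d
    haveI : Nontrivial (Fin k) := Fin.nontrivial_iff_two_le.2 hk
    obtain ⟨c', hc'⟩ := exists_ne c
    exact ⟨Equiv.swap d c', by simpa using hc'⟩
  rcases perm_eq (cut A X) (fun e => α e.1) (fun e => β e.2) (hall hP hn hα hβ) hX with ⟨f1, f2⟩ | ⟨f1, f2⟩ <;>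
  rcases perm_eq (cut A Z) (fun e => α e.2) (fun e => β e.1) (hall' hP hn hα hβ) hZ with ⟨g1, g2⟩ | ⟨g1, g2⟩
  · exact Or.inl (T1_core hP hn hα hβ f1 f2 g1 g2)
  · exfalso
    obtain ⟨e1, he1⟩ : (cut A X).Nonempty := by rw [← Finset.card_pos]; omega
    obtain ⟨e2, he2⟩ : (cut A Z).Nonempty := by rw [← Finset.card_pos]; omega
    obtain ⟨σ, hσ⟩ := two (α e1.1) (β e2.1)
    obtain ⟨e0, he0, hs⟩ := hall hP hn hα hβ σ
    obtain ⟨e, a1, a2, a3, a4, a5, a6⟩ := cross hP hα (hβ.comp_inj σ σ.injective) hn e0 he0 (by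
      intro e he hm
      apply f2 he he0
      apply σ.injective
      simp only [Function.comp] at hm
      have := f1 e he e0 he0
      rw [← hm, this, hs])
    simp only [Function.comp] at *
    apply hσ
    rw [g1 e2 he2 e a1, ← a4, hs]
    exact f1 e0 he0 e1 he1
  · exfalso
    obtain ⟨e1, he1⟩ : (cut A X).Nonempty := by rw [← Finset.card_pos]; omega
    obtain ⟨e2, he2⟩ : (cut A Z).Nonempty := by rw [← Finset.card_pos]; omega
    obtain ⟨σ, hσ⟩ := two (α e2.2) (β e1.2)
    obtain ⟨e0, he0, hs⟩ := hall hP hn hα hβ σ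
    obtain ⟨e, a1, a2, a3, a4, a5, a6⟩ := cross hP hα (hβ.comp_inj σ σ.injective) hn e0 he0 (by
      intro e he hm
      apply f2 he he0
      simp only [Function.comp] at hm ⊢
      have := f1 e he e0 he0
      rw [hm, this, hs])
    simp only [Function.comp] at *
    apply hσ
    rw [f1 e1 he1 e0 he0, hs, ← rtg_color a5]
    exact g1 e a1 e2 he2
  · exact Or.inr (T1_core hP.symm hn hβ hα g1 g2 f1 f2)

theorem tight_part {k : ℕ} (hk : 2 ≤ k) {A X Z} (hP : Part A X Z) (hn : ∀ φ : ℕ → Fin k, ¬ Col A φ)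
    (hX : (cut A X).card = k) (hZ : (cut A Z).card = k)
    (hcX : Colb k (ind A X)) (hcZ : Colb k (ind A Z)) : MR k A X Z ∨ MR k A Z X := by
  obtain ⟨α0, hα0⟩ := hcX
  obtain ⟨β0, hβ0⟩ := hcZ
  have ex2 : ∃ e ∈ cut A X, ∃ e' ∈ cut A X, e ≠ e' := by
    have := Finset.one_lt_card.1 (show 1 < (cut A X).card by omega)
    obtain ⟨a, ha, b, hb, h⟩ := this
    exact ⟨a, ha, b, hb, h⟩
  obtain ⟨e1, he1, e2, he2, hne⟩ := ex2
  have clash1 : ∀ α β β' : ℕ → Fin k, T1 A X Z α β → T1 A Z X β' α → False := by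
    intro α β β' h h'
    obtain ⟨c, hc, -⟩ := h.mc
    exact hne (h'.it he1 he2 ((hc e1 he1).trans (hc e2 he2).symm))
  have clash2 : ∀ α α' β : ℕ → Fin k, T1 A X Z α β → T1 A Z X β α' → False := by
    intro α α' β h h'
    obtain ⟨c, -, hc⟩ := h'.mc
    exact hne (h.ih he1 he2 ((hc e1 he1).trans (hc e2 he2).symm))
  rcases pairT hk hP hn hX hZ hα0 hβ0 with h | h
  · left
    intro α β hα hβ
    have h1 : T1 A X Z α0 β := (pairT hk hP hn hX hZ hα0 hβ).resolve_right (clash1 _ _ _ h)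
    exact (pairT hk hP hn hX hZ hα hβ).resolve_right (clash2 _ _ _ h1)
  · right
    intro β α hβ hα
    have h1 : T1 A Z X β α0 := (pairT hk hP hn hX hZ hα0 hβ).resolve_left (fun h' => clash1 _ _ _ h' h)
    exact (pairT hk hP hn hX hZ hα hβ).resolve_left (fun h' => clash2 _ _ _ h' h1)

theorem Ext.ncol' {k V A} (h : Ext k V A) : ∀ φ : ℕ → Fin k, ¬ Col A φ := fun φ hφ => h.ncol ⟨φ, hφ⟩

theorem Ext.ind_colb {k : ℕ} (hk : 0 < k) {V A} (h : Ext k V A) {X : Finset ℕ} (hX : ¬ V ⊆ X) :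
    Colb k (ind A X) := by
  obtain ⟨hc, hv⟩ := h.crit hk
  apply hc.2
  refine Finset.filter_ssubset.2 ?_
  obtain ⟨v, hv', hvX⟩ := Finset.not_subset.1 hX
  rw [← hv] at hv'
  obtain ⟨e, he, h⟩ := mem_vs.1 hv'
  exact ⟨e, he, by rcases h with rfl | rfl <;> tauto⟩

theorem not_sub_sdiff {V X : Finset ℕ} (hX : X ⊆ V) (h1 : X.Nonempty) : ¬ V ⊆ V \ X := by
  intro h
  obtain ⟨x, hx⟩ := h1
  exact (Finset.mem_sdiff.1 (h (hX hx))).2 hx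

theorem Ext.tight {k : ℕ} (hk : 2 ≤ k) {V A} (h : Ext k V A) {X : Finset ℕ} (hX : X ⊆ V)
    (h1 : X.Nonempty) (h2 : X ≠ V) (hc : (cut A X).card = k) :
    MR k A X (V \ X) ∨ MR k A (V \ X) X := by
  have hk0 : 0 < k := by omega
  refine tight_part hk (part_of h.hwf X) h.ncol' hc ?_ ?_ ?_
  · rw [h.cut_compl hk0, hc]
  · exact h.ind_colb hk0 (fun h' => h2 (Finset.Subset.antisymm hX h'))
  · exact h.ind_colb hk0 (not_sub_sdiff hX h1)

/-- connectedness inside `X` -/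
def Conn (A : Finset (ℕ × ℕ)) (X : Finset ℕ) : Prop :=
  ∀ C ⊆ X, C.Nonempty → C ≠ X → ∃ e ∈ A, (e.1 ∈ C ∧ e.2 ∈ X \ C) ∨ (e.2 ∈ C ∧ e.1 ∈ X \ C)

theorem MR.conn {k : ℕ} (hk : 2 ≤ k) {V A X} (h : Ext k V A) (hX : X ⊆ V) (h1 : X.Nonempty) (h2 : X ≠ V)
    (hM : MR k A X (V \ X)) : Conn A X := by
  have hk0 : 0 < k := by omega
  intro C hC hne hCX
  by_contra hno
  push Not at hno
  have nsub : ¬ X ⊆ C := fun h' => hCX (Finset.Subset.antisymm hC h')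
  obtain ⟨y, hy, hyC⟩ := Finset.not_subset.1 nsub
  have hCV : C ≠ V := fun h' => h2 (Finset.Subset.antisymm hX (h' ▸ hC))
  have hXCV : X \ C ≠ V := fun h' => h2 (Finset.Subset.antisymm hX (by rw [← h']; exact Finset.sdiff_subset))
  obtain ⟨e, he⟩ := h.strong C (hC.trans hX) hne hCV
  obtain ⟨e', he'⟩ := h.strong (X \ C) (Finset.sdiff_subset.trans hX) ⟨y, Finset.mem_sdiff.2 ⟨hy, hyC⟩⟩ hXCV
  rw [mem_cut] at he he'
  have h3 : e.2 ∉ X := fun h' => (hno e he.1).1 he.2.1 (Finset.mem_sdiff.2 ⟨h', he.2.2⟩)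
  have h4 : e'.2 ∉ X := by
    intro h'
    by_cases hc : e'.2 ∈ C
    · exact (hno e' he'.1).2 hc he'.2.1
    · exact he'.2.2 (Finset.mem_sdiff.2 ⟨h', hc⟩)
  have heX : e ∈ cut A X := mem_cut.2 ⟨he.1, hC he.2.1, h3⟩
  have heX' : e' ∈ cut A X := mem_cut.2 ⟨he'.1, (Finset.mem_sdiff.1 he'.2.1).1, h4⟩
  obtain ⟨α, hα⟩ := h.ind_colb hk0 (fun h' => h2 (Finset.Subset.antisymm hX h'))
  obtain ⟨β, hβ⟩ := h.ind_colb hk0 (not_sub_sdiff hX h1)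
  haveI : Nontrivial (Fin k) := Fin.nontrivial_iff_two_le.2 hk
  obtain ⟨c', hc'⟩ := exists_ne (α e.1)
  set σ := Equiv.swap (α e.1) c'
  have hα' : Col (ind A X) (fun v => if v ∈ C then σ (α v) else α v) := by
    refine glue_col (X := C) (α := fun v => σ (α v)) ?_ ?_ ?_
    · exact (hα.comp_inj σ σ.injective).subset (fun e he => (mem_ind.1 he).1)
    · exact hα.subset (fun e he => (mem_away.1 he).1)
    · intro f hf
      rw [mem_cut, mem_ind] at hf
      exact absurd (Finset.mem_sdiff.2 ⟨hf.1.2.2, hf.2.2⟩) ((hno f hf.1.1).1 hf.2.1)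
  obtain ⟨c, hc, -⟩ := (hM α β hα hβ).mc
  obtain ⟨d, hd, -⟩ := (hM _ β hα' hβ).mc
  have a1 := hd e heX
  have a2 := hd e' heX'
  simp only [he.2.1, (Finset.mem_sdiff.1 he'.2.1).2, if_true, if_false] at a1 a2
  rw [← a2, hc e' heX', ← hc e heX] at a1
  simp only [σ, Equiv.swap_apply_left] at a1
  exact hc' a1

end Ex

set_option linter.all false
namespace Ex
open Relation

structure SepAt (V : Finset ℕ) (A : Finset (ℕ × ℕ)) (a : ℕ) (V1 V2 : Finset ℕ) : Prop where
  ha : a ∈ V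
  n1 : V1.Nonempty
  n2 : V2.Nonempty
  dj : Disjoint V1 V2
  un : V1 ∪ V2 = V.erase a
  u12 : ∀ e ∈ A, ∀ e' ∈ A, e.1 ∈ V1 → e.2 ∈ V2 → e'.1 ∈ V1 → e'.2 ∈ V2 → e = e'
  u21 : ∀ e ∈ A, ∀ e' ∈ A, e.1 ∈ V2 → e.2 ∈ V1 → e'.1 ∈ V2 → e'.2 ∈ V1 → e = e'

theorem SepAt.symm {V A a V1 V2} (h : SepAt V A a V1 V2) : SepAt V A a V2 V1 :=
  ⟨h.ha, h.n2, h.n1, h.dj.symm, by rw [Finset.union_comm]; exact h.un, h.u21, h.u12⟩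

def Sep (V : Finset ℕ) (A : Finset (ℕ × ℕ)) : Prop := ∃ a V1 V2, SepAt V A a V1 V2

def Compl (V : Finset ℕ) (A : Finset (ℕ × ℕ)) : Prop := ∀ u ∈ V, ∀ v ∈ V, u ≠ v → (u, v) ∈ A

def AWheel (V : Finset ℕ) (A : Finset (ℕ × ℕ)) : Prop :=
  ∃ x ∈ V, (∀ y ∈ V, y ≠ x → (x, y) ∈ A ∧ (y, x) ∈ A) ∧ (∀ a b, (a, b) ∈ A → (b, a) ∈ A) ∧
    ∀ y ∈ V, y ≠ x → odeg A y = 3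

structure Gad (k : ℕ) (V : Finset ℕ) (A : Finset (ℕ × ℕ)) (X Z B : Finset ℕ) (β : ℕ → Fin k) (r : ℕ → ℕ) :
    Prop where
  k3 : 3 ≤ k
  ext : Ext k V A
  hX : X ⊆ V
  hZ : Z = V \ X
  cX : (cut A X).card = k
  cZ : (cut A Z).card = k
  mr : MR k A X Z
  hβ : Col (ind A Z) β
  hB : B = (cut A X).image Prod.snd
  hr : ∀ z, r z ∈ B
  hβr : ∀ z, β (r z) = β z
  X2 : 2 ≤ X.card
  Zk : k < Z.card

def gad (A : Finset (ℕ × ℕ)) (X Z B : Finset ℕ) (r : ℕ → ℕ) : Finset (ℕ × ℕ) :=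
  ind A X ∪ cut A X ∪ (B ×ˢ B).filter (fun e => e.1 ≠ e.2) ∪ (cut A Z).image (fun e => (r e.1, e.2))

namespace Gad
variable {k : ℕ} {V : Finset ℕ} {A : Finset (ℕ × ℕ)} {X Z B : Finset ℕ} {β : ℕ → Fin k} {r : ℕ → ℕ}

theorem part (g : Gad k V A X Z B β r) : Part A X Z := g.hZ ▸ part_of g.ext.hwf X

theorem mem (g : Gad k V A X Z B β r) {e : ℕ × ℕ} : e ∈ gad A X Z B r ↔
    (e ∈ A ∧ e.1 ∈ X ∧ e.2 ∈ X) ∨ (e ∈ A ∧ e.1 ∈ X ∧ e.2 ∈ Z) ∨ (e.1 ∈ B ∧ e.2 ∈ B ∧ e.1 ≠ e.2) ∨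
    ∃ f ∈ A, f.1 ∈ Z ∧ f.2 ∈ X ∧ e = (r f.1, f.2) := by
  simp only [gad, Finset.mem_union, mem_ind, g.part.mem_cut, g.part.symm.mem_cut, Finset.mem_filter,
    Finset.mem_product, Finset.mem_image]
  constructor
  · rintro (((h | h) | h) | ⟨f, h, rfl⟩)
    · exact Or.inl h
    · exact Or.inr (Or.inl h)
    · exact Or.inr (Or.inr (Or.inl ⟨h.1.1, h.1.2, h.2⟩))
    · exact Or.inr (Or.inr (Or.inr ⟨f, h.1, h.2.1, h.2.2, rfl⟩))
  · rintro (h | h | h | ⟨f, h1, h2, h3, rfl⟩)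
    · exact Or.inl (Or.inl (Or.inl h))
    · exact Or.inl (Or.inl (Or.inr h))
    · exact Or.inl (Or.inr ⟨⟨h.1, h.2.1⟩, h.2.2⟩)
    · exact Or.inr ⟨f, ⟨h1, h2, h3⟩, rfl⟩

theorem nXZ (g : Gad k V A X Z B β r) {v} (h1 : v ∈ X) (h2 : v ∈ Z) : False :=
  Finset.disjoint_left.1 g.part.dj h1 h2

theorem memV (g : Gad k V A X Z B β r) {v} : v ∈ V ↔ v ∈ X ∨ v ∈ Z := by
  have := g.hX
  rw [g.hZ, Finset.mem_sdiff]
  constructor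
  · intro h; tauto
  · rintro (h | h); exacts [this h, h.1]

theorem BZ (g : Gad k V A X Z B β r) : B ⊆ Z := by
  intro b hb
  rw [g.hB] at hb
  obtain ⟨e, he, rfl⟩ := Finset.mem_image.1 hb
  exact (g.part.mem_cut.1 he).2.2

theorem ex_in (g : Gad k V A X Z B β r) {b} (hb : b ∈ B) : ∃ p ∈ X, (p, b) ∈ A := by
  rw [g.hB] at hb
  obtain ⟨e, he, rfl⟩ := Finset.mem_image.1 hb
  exact ⟨e.1, (g.part.mem_cut.1 he).2.1, (g.part.mem_cut.1 he).1⟩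

theorem head_B (g : Gad k V A X Z B β r) {e : ℕ × ℕ} (he : e ∈ A) (h1 : e.1 ∈ X) (h2 : e.2 ∈ Z) : e.2 ∈ B := by
  rw [g.hB]
  exact Finset.mem_image.2 ⟨e, g.part.mem_cut.2 ⟨he, h1, h2⟩, rfl⟩

theorem Xne (g : Gad k V A X Z B β r) : X.Nonempty := by
  rw [← Finset.card_pos]; have := g.X2; omega

theorem XV (g : Gad k V A X Z B β r) : X ≠ V := by
  intro h
  have := g.Zk
  rw [g.hZ, h, Finset.sdiff_self] at this
  simp at this

theorem ex_col (g : Gad k V A X Z B β r) : ∃ α : ℕ → Fin k, Col (ind A X) α :=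
  g.ext.ind_colb (by have := g.k3; omega) (fun h' => g.XV (Finset.Subset.antisymm g.hX h'))

theorem injh (g : Gad k V A X Z B β r) : Set.InjOn (fun e : ℕ × ℕ => β e.2) (cut A X) := by
  obtain ⟨α, hα⟩ := g.ex_col
  exact (g.mr α β hα g.hβ).ih

theorem injt (g : Gad k V A X Z B β r) : Set.InjOn (fun e : ℕ × ℕ => β e.1) (cut A Z) := by
  obtain ⟨α, hα⟩ := g.ex_col
  exact (g.mr α β hα g.hβ).it

theorem Bcard (g : Gad k V A X Z B β r) : B.card = k := by
  rw [g.hB, Finset.card_image_of_injOn, g.cX]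
  intro e he e' he' h
  exact g.injh he he' (by simp only; rw [h])

theorem injB (g : Gad k V A X Z B β r) : Set.InjOn β B := by
  intro b hb b' hb' h
  rw [Finset.mem_coe, g.hB] at hb hb'
  obtain ⟨e, he, rfl⟩ := Finset.mem_image.1 hb
  obtain ⟨e', he', rfl⟩ := Finset.mem_image.1 hb'
  rw [g.injh he he' h]

theorem rB (g : Gad k V A X Z B β r) {b} (hb : b ∈ B) : r b = b := g.injB (g.hr b) hb (g.hβr b)

theorem ex_out (g : Gad k V A X Z B β r) {b} (hb : b ∈ B) : ∃ f ∈ A, f.1 ∈ Z ∧ f.2 ∈ X ∧ r f.1 = b := by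
  have hs : (cut A Z).image (fun e => β e.1) = Finset.univ := by
    rw [← Finset.card_eq_iff_eq_univ, Finset.card_image_of_injOn g.injt, g.cZ]; simp
  have := Finset.mem_univ (β b)
  rw [← hs] at this
  obtain ⟨f, hf, h⟩ := Finset.mem_image.1 this
  have hf' := g.part.symm.mem_cut.1 hf
  exact ⟨f, hf'.1, hf'.2.1, hf'.2.2, g.injB (g.hr _) hb ((g.hβr _).trans h)⟩

theorem rinj (g : Gad k V A X Z B β r) {f f' : ℕ × ℕ} (hf : f ∈ A) (h1 : f.1 ∈ Z) (h2 : f.2 ∈ X)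
    (hf' : f' ∈ A) (h1' : f'.1 ∈ Z) (h2' : f'.2 ∈ X) (h : r f.1 = r f'.1) : f = f' := by
  apply g.injt (g.part.symm.mem_cut.2 ⟨hf, h1, h2⟩) (g.part.symm.mem_cut.2 ⟨hf', h1', h2'⟩)
  simp only
  rw [← g.hβr f.1, h, g.hβr]

/-- arcs of the gadget from `X` -/
theorem fromX (g : Gad k V A X Z B β r) {e : ℕ × ℕ} (he : e ∈ gad A X Z B r) (h : e.1 ∈ X) : e ∈ A := by
  rcases g.mem.1 he with h' | h' | h' | ⟨f, h1, h2, h3, rfl⟩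
  · exact h'.1
  · exact h'.1
  · exact (g.nXZ h (g.BZ h'.1)).elim
  · exact (g.nXZ h (g.BZ (g.hr _))).elim

theorem toX (g : Gad k V A X Z B β r) {e : ℕ × ℕ} (he : e ∈ gad A X Z B r) (h1 : e.1 ∈ B) (h : e.2 ∈ X) :
    ∃ f ∈ A, f.1 ∈ Z ∧ f.2 ∈ X ∧ e = (r f.1, f.2) := by
  rcases g.mem.1 he with h' | h' | h' | h'
  · exact (g.nXZ h'.2.1 (g.BZ h1)).elim
  · exact (g.nXZ h'.2.1 (g.BZ h1)).elim
  · exact (g.nXZ h (g.BZ h'.2.1)).elim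
  · exact h'

theorem uniq_out (g : Gad k V A X Z B β r) {b x y} (hb : b ∈ B) (hx : x ∈ X) (hy : y ∈ X)
    (h1 : (b, x) ∈ gad A X Z B r) (h2 : (b, y) ∈ gad A X Z B r) : x = y := by
  obtain ⟨f, a1, a2, a3, a4⟩ := g.toX h1 hb hx
  obtain ⟨f', b1, b2, b3, b4⟩ := g.toX h2 hb hy
  simp only [Prod.mk.injEq] at a4 b4
  rw [a4.2, b4.2, g.rinj a1 a2 a3 b1 b2 b3 (a4.1.symm.trans b4.1)]

theorem uniq_in (g : Gad k V A X Z B β r) {b x y} (hb : b ∈ B) (hx : x ∈ X) (hy : y ∈ X)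
    (h1 : (x, b) ∈ gad A X Z B r) (h2 : (y, b) ∈ gad A X Z B r) : x = y := by
  have a1 := g.fromX h1 hx
  have a2 := g.fromX h2 hy
  have := g.injh (g.part.mem_cut.2 ⟨a1, hx, g.BZ hb⟩) (g.part.mem_cut.2 ⟨a2, hy, g.BZ hb⟩) rfl
  simpa using this

theorem inX (g : Gad k V A X Z B β r) {e : ℕ × ℕ} (he : e ∈ A) (h : e.1 ∈ X) : e ∈ gad A X Z B r := by
  rcases g.memV.1 (g.ext.hwf e he).2 with h' | h'
  · exact g.mem.2 (Or.inl ⟨he, h, h'⟩)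
  · exact g.mem.2 (Or.inr (Or.inl ⟨he, h, h'⟩))

theorem inImg (g : Gad k V A X Z B β r) {e : ℕ × ℕ} (he : e ∈ A) (h : e.1 ∈ Z) (h2 : e.2 ∈ X) :
    (r e.1, e.2) ∈ gad A X Z B r := g.mem.2 (Or.inr (Or.inr (Or.inr ⟨e, he, h, h2, rfl⟩)))

theorem inB (g : Gad k V A X Z B β r) {b b'} (h : b ∈ B) (h' : b' ∈ B) (hne : b ≠ b') :
    (b, b') ∈ gad A X Z B r := g.mem.2 (Or.inr (Or.inr (Or.inl ⟨h, h', hne⟩)))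

theorem Bne (g : Gad k V A X Z B β r) : B.Nonempty := by
  rw [← Finset.card_pos, g.Bcard]; have := g.k3; omega

theorem wf' (g : Gad k V A X Z B β r) : ∀ e ∈ gad A X Z B r, e.1 ∈ X ∪ B ∧ e.2 ∈ X ∪ B ∧ e.1 ≠ e.2 := by
  intro e he
  simp only [Finset.mem_union]
  rcases g.mem.1 he with h' | h' | h' | ⟨f, h1, h2, h3, rfl⟩
  · exact ⟨Or.inl h'.2.1, Or.inl h'.2.2, (g.ext.wf e h'.1).2.2⟩
  · exact ⟨Or.inl h'.2.1, Or.inr (g.head_B h'.1 h'.2.1 h'.2.2), (g.ext.wf e h'.1).2.2⟩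
  · exact ⟨Or.inr h'.1, Or.inr h'.2.1, h'.2.2⟩
  · exact ⟨Or.inr (g.hr _), Or.inl h3, fun h => g.nXZ h3 (g.BZ (h ▸ g.hr f.1))⟩

theorem strong' (g : Gad k V A X Z B β r) : ∀ S ⊆ X ∪ B, S.Nonempty → S ≠ X ∪ B → (cut (gad A X Z B r) S).Nonempty := by
  intro S hS hne hneq
  by_cases hB1 : ∃ b ∈ B, b ∈ S
  · obtain ⟨b, hb, hbS⟩ := hB1
    by_cases hB2 : B ⊆ S
    · obtain ⟨e, he⟩ := g.ext.strong ((S ∩ X) ∪ Z) (by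
        intro v hv
        rw [g.memV]
        simp only [Finset.mem_union, Finset.mem_inter] at hv
        tauto) ⟨b, by simp [g.BZ hb]⟩ (by
        intro h
        apply hneq
        apply Finset.Subset.antisymm hS
        intro v hv
        rcases Finset.mem_union.1 hv with h' | h'
        · have : v ∈ S ∩ X ∪ Z := by rw [h]; exact g.hX h'
          simp only [Finset.mem_union, Finset.mem_inter] at this
          rcases this with h | h
          · exact h.1
          · exact (g.nXZ h' h).elim
        · exact hB2 h')
      rw [mem_cut] at he
      simp only [Finset.mem_union, Finset.mem_inter, not_or, not_and] at he
      obtain ⟨he, h1, h2, h3⟩ := he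
      have h4 : e.2 ∈ X := (g.memV.1 (g.ext.hwf e he).2).resolve_right h3
      have h5 : e.2 ∉ S := fun h => h2 h h4
      rcases h1 with h1 | h1
      · exact ⟨e, mem_cut.2 ⟨g.inX he h1.2, h1.1, h5⟩⟩
      · exact ⟨_, mem_cut.2 ⟨g.inImg he h1 h4, hB2 (g.hr _), h5⟩⟩
    · obtain ⟨b', hb', hbS'⟩ := Finset.not_subset.1 hB2
      exact ⟨(b, b'), mem_cut.2 ⟨g.inB hb hb' (fun h => hbS' (h ▸ hbS)), hbS, hbS'⟩⟩
  · push Not at hB1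
    have hSX : S ⊆ X := fun v hv => (Finset.mem_union.1 (hS hv)).resolve_right (fun h => hB1 v h hv)
    obtain ⟨e, he⟩ := g.ext.strong S (hSX.trans g.hX) hne (fun h => g.XV (Finset.Subset.antisymm g.hX (h ▸ hSX)))
    rw [mem_cut] at he
    exact ⟨e, mem_cut.2 ⟨g.inX he.1 (hSX he.2.1), he.2⟩⟩

theorem conn (g : Gad k V A X Z B β r) : Conn A X :=
  MR.conn (by have := g.k3; omega) g.ext g.hX g.Xne g.XV (g.hZ ▸ g.mr)

theorem bic_aux (g : Gad k V A X Z B β r) : ∀ s ∈ X ∪ B, ∀ C ⊆ (X ∪ B).erase s, C.Nonempty →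
    (∀ b ∈ B, b ∉ C) →
    ∃ e ∈ gad A X Z B r, (e.1 ∈ C ∧ e.2 ∈ (X ∪ B).erase s \ C) ∨ (e.2 ∈ C ∧ e.1 ∈ (X ∪ B).erase s \ C) := by
  intro s hs C hC hne hCB
  have hCX : C ⊆ X := fun v hv =>
    (Finset.mem_union.1 (Finset.mem_of_mem_erase (hC hv))).resolve_right (fun h => hCB v h hv)
  have hCs : s ∉ C := fun h => (Finset.mem_erase.1 (hC h)).1 rfl
  obtain ⟨b0, hb0⟩ := g.Bne
  rcases Finset.mem_union.1 hs with hsX | hsB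
  · obtain ⟨e, he, hcase⟩ := g.ext.bic s (g.hX hsX) C
      (fun v hv => Finset.mem_erase.2 ⟨fun h => hCs (h ▸ hv), g.hX (hCX hv)⟩) hne
      (fun h => hCB b0 hb0 (by
        rw [h]
        exact Finset.mem_erase.2 ⟨fun h => g.nXZ hsX (g.BZ (h ▸ hb0)), g.memV.2 (Or.inr (g.BZ hb0))⟩))
    simp only [Finset.mem_sdiff, Finset.mem_erase, Finset.mem_union] at hcase ⊢
    rcases hcase with ⟨h1, ⟨h2, h3⟩, h4⟩ | ⟨h1, ⟨h2, h3⟩, h4⟩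
    · refine ⟨e, g.inX he (hCX h1), Or.inl ⟨h1, ⟨h2, ?_⟩, h4⟩⟩
      rcases g.memV.1 h3 with h5 | h5
      · exact Or.inl h5
      · exact Or.inr (g.head_B he (hCX h1) h5)
    · rcases g.memV.1 h3 with h5 | h5
      · exact ⟨e, g.inX he h5, Or.inr ⟨h1, ⟨h2, Or.inl h5⟩, h4⟩⟩
      · exact ⟨_, g.inImg he h5 (hCX h1), Or.inr ⟨h1, ⟨fun h => g.nXZ hsX (g.BZ (h ▸ g.hr e.1)), Or.inr (g.hr _)⟩,
          hCB _ (g.hr _)⟩⟩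
  · simp only [Finset.mem_sdiff, Finset.mem_erase, Finset.mem_union]
    by_cases hCX' : C = X
    · have : ∃ b ∈ B, b ≠ s := by
        have : 1 < B.card := by rw [g.Bcard]; have := g.k3; omega
        exact Finset.exists_mem_ne this s
      obtain ⟨b, hb, hbs⟩ := this
      obtain ⟨p, hp, hpb⟩ := g.ex_in hb
      exact ⟨(p, b), g.inX hpb hp, Or.inl ⟨hCX' ▸ hp, ⟨hbs, Or.inr hb⟩, hCB b hb⟩⟩
    · obtain ⟨e, he, hcase⟩ := g.conn C hCX hne hCX'
      simp only [Finset.mem_sdiff] at hcase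
      rcases hcase with ⟨h1, h2, h3⟩ | ⟨h1, h2, h3⟩
      · exact ⟨e, g.inX he (hCX h1), Or.inl ⟨h1, ⟨fun h => g.nXZ h2 (g.BZ (h ▸ hsB)), Or.inl h2⟩, h3⟩⟩
      · exact ⟨e, g.inX he h2, Or.inr ⟨h1, ⟨fun h => g.nXZ h2 (g.BZ (h ▸ hsB)), Or.inl h2⟩, h3⟩⟩

theorem bic' (g : Gad k V A X Z B β r) : ∀ s ∈ X ∪ B, ∀ C ⊆ (X ∪ B).erase s, C.Nonempty →
    C ≠ (X ∪ B).erase s →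
    ∃ e ∈ gad A X Z B r, (e.1 ∈ C ∧ e.2 ∈ (X ∪ B).erase s \ C) ∨ (e.2 ∈ C ∧ e.1 ∈ (X ∪ B).erase s \ C) := by
  intro s hs C hC hne hneq
  by_cases h1 : ∃ b ∈ B, b ∈ C
  · obtain ⟨b, hb, hbC⟩ := h1
    by_cases h2 : ∀ b ∈ B, b ∉ (X ∪ B).erase s \ C
    · obtain ⟨e, he, hcase⟩ := g.bic_aux s hs ((X ∪ B).erase s \ C) Finset.sdiff_subset
        (by
          rw [Finset.sdiff_nonempty]
          exact fun h => hneq (Finset.Subset.antisymm hC h)) h2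
      have hss : (X ∪ B).erase s \ ((X ∪ B).erase s \ C) = C := Finset.sdiff_sdiff_eq_self hC
      rw [hss] at hcase
      exact ⟨e, he, hcase.symm.imp (fun h => ⟨h.2, h.1⟩) (fun h => ⟨h.2, h.1⟩)⟩
    · push Not at h2
      obtain ⟨b', hb', hbC'⟩ := h2
      exact ⟨(b, b'), g.inB hb hb' (fun h => (Finset.mem_sdiff.1 hbC').2 (h ▸ hbC)), Or.inl ⟨hbC, hbC'⟩⟩
  · push Not at h1
    exact g.bic_aux s hs C hC hne h1

theorem ncol' (g : Gad k V A X Z B β r) : ¬ Colb k (gad A X Z B r) := by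
  rintro ⟨φ, hφ⟩
  have hα : Col (ind A X) φ := hφ.subset (fun e he => g.inX (mem_ind.1 he).1 (mem_ind.1 he).2.1)
  have hT := g.mr φ β hα g.hβ
  obtain ⟨c, hc1, hc2⟩ := hT.mc
  have hinj : Set.InjOn φ B := by
    intro b hb b' hb' h
    by_contra hne
    exact hφ b ((TransGen.single ⟨g.inB hb hb' hne, h⟩).tail ⟨g.inB hb' hb (Ne.symm hne), h.symm⟩)
  have hs : B.image φ = Finset.univ := by
    rw [← Finset.card_eq_iff_eq_univ, Finset.card_image_of_injOn hinj, g.Bcard]; simp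
  have hcm := Finset.mem_univ c
  rw [← hs] at hcm
  obtain ⟨b, hb, hbc⟩ := Finset.mem_image.1 hcm
  obtain ⟨p, hp, hpb⟩ := g.ex_in hb
  obtain ⟨f, f1, f2, f3, f4⟩ := g.ex_out hb
  have hpc := g.part.mem_cut.2 ⟨hpb, hp, g.BZ hb⟩
  have hfc := g.part.symm.mem_cut.2 ⟨f1, f2, f3⟩
  have hpath := hT.pa _ hpc _ hfc (by simp only; rw [← g.hβr f.1, f4])
  have hpath' : ReflTransGen (mono (gad A X Z B r) φ) f.2 p :=
    ReflTransGen.mono (fun a b h => ⟨g.inX (mem_ind.1 h.1).1 (mem_ind.1 h.1).2.1, h.2⟩) _ _ hpath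
  have hbf : mono (gad A X Z B r) φ b f.2 := by
    refine ⟨?_, hbc.trans (hc2 f hfc).symm⟩
    have := g.inImg f1 f2 f3
    rwa [f4] at this
  have hpb' : mono (gad A X Z B r) φ p b := ⟨g.inX hpb hp, (hc1 _ hpc).trans hbc.symm⟩
  exact hφ b ((TransGen.trans_left (TransGen.single hbf) hpath').tail hpb')

end Gad
end Ex

set_option linter.all false
namespace Ex
open Relation
namespace Gad
variable {k : ℕ} {V : Finset ℕ} {A : Finset (ℕ × ℕ)} {X Z B : Finset ℕ} {β : ℕ → Fin k} {r : ℕ → ℕ}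

theorem outB (g : Gad k V A X Z B β r) {b} (hb : b ∈ B) (S : Finset (ℕ × ℕ)) (hS : S ⊆ gad A X Z B r)
    (h : ∀ e ∈ S, e.1 = b) : S.card ≤ k := by
  classical
  rw [← g.Bcard]
  refine Finset.card_le_card_of_injOn (fun e => if e.2 ∈ B then e.2 else b) ?_ ?_
  · intro e _
    by_cases h : e.2 ∈ B
    · simp [h]
    · simp [h, hb]
  · rintro ⟨x, e⟩ he ⟨x', e'⟩ he' heq
    have h1 := h _ he
    have h1' := h _ he'
    have h2 := hS he
    have h2' := hS he'
    simp only at h1 h1' heq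
    rw [h1] at h2; rw [h1'] at h2'
    have n1 : b ≠ e := (g.wf' _ h2).2.2
    have n2 : b ≠ e' := (g.wf' _ h2').2.2
    have m1 := Finset.mem_union.1 (g.wf' _ h2).2.1
    have m2 := Finset.mem_union.1 (g.wf' _ h2').2.1
    rw [h1, h1']
    by_cases c1 : e ∈ B <;> by_cases c2 : e' ∈ B <;> simp only [c1, c2, if_true, if_false] at heq
    · rw [heq]
    · exact absurd heq.symm n1
    · exact absurd heq n2
    · have h9 : e = e' := g.uniq_out hb (m1.resolve_right c1) (m2.resolve_right c2) h2 h2'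
      rw [h9]

theorem inBc (g : Gad k V A X Z B β r) {b} (hb : b ∈ B) (S : Finset (ℕ × ℕ)) (hS : S ⊆ gad A X Z B r)
    (h : ∀ e ∈ S, e.2 = b) : S.card ≤ k := by
  classical
  rw [← g.Bcard]
  refine Finset.card_le_card_of_injOn (fun e => if e.1 ∈ B then e.1 else b) ?_ ?_
  · intro e _
    by_cases h : e.1 ∈ B
    · simp [h]
    · simp [h, hb]
  · rintro ⟨e, x⟩ he ⟨e', x'⟩ he' heq
    have h1 := h _ he
    have h1' := h _ he'
    have h2 := hS he
    have h2' := hS he'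
    simp only at h1 h1' heq
    rw [h1] at h2; rw [h1'] at h2'
    have n1 : e ≠ b := (g.wf' _ h2).2.2
    have n2 : e' ≠ b := (g.wf' _ h2').2.2
    have m1 := Finset.mem_union.1 (g.wf' _ h2).1
    have m2 := Finset.mem_union.1 (g.wf' _ h2').1
    rw [h1, h1']
    by_cases c1 : e ∈ B <;> by_cases c2 : e' ∈ B <;> simp only [c1, c2, if_true, if_false] at heq
    · rw [heq]
    · exact absurd heq n1
    · exact absurd heq.symm n2
    · have h9 : e = e' := g.uniq_in hb (m1.resolve_right c1) (m2.resolve_right c2) h2 h2'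
      rw [h9]

theorem sep' (g : Gad k V A X Z B β r) : ∀ u ∈ X ∪ B, ∀ v ∈ X ∪ B, u ≠ v →
    ∃ Y ⊆ X ∪ B, u ∈ Y ∧ v ∉ Y ∧ (cut (gad A X Z B r) Y).card ≤ k := by
  classical
  have hk0 : 0 < k := by have := g.k3; omega
  intro u hu v hv huv
  by_cases huB : u ∈ B
  · refine ⟨{u}, by simpa using hu, by simp, by simpa using huv.symm, ?_⟩
    exact g.outB huB _ (Finset.filter_subset _ _) (fun e he => by simpa using (mem_cut.1 he).2.1)
  by_cases hvB : v ∈ B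
  · refine ⟨(X ∪ B).erase v, Finset.erase_subset _ _, Finset.mem_erase.2 ⟨huv, hu⟩, by simp, ?_⟩
    refine g.inBc hvB _ (Finset.filter_subset _ _) (fun e he => ?_)
    rw [mem_cut] at he
    by_contra h
    exact he.2.2 (Finset.mem_erase.2 ⟨h, (g.wf' e he.1).2.1⟩)
  have huX := (Finset.mem_union.1 hu).resolve_right huB
  have hvX := (Finset.mem_union.1 hv).resolve_right hvB
  obtain ⟨Y, hY, h1, h2, h3⟩ := g.ext.sep u (g.hX huX) v (g.hX hvX) huv
  by_cases hYZ : (Y ∩ Z).Nonempty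
  · have hsub := submod A Y Z
    have hvYZ : v ∉ Y ∪ Z := by
      simp only [Finset.mem_union, not_or]; exact ⟨h2, fun h => g.nXZ hvX h⟩
    have hge : k ≤ (cut A (Y ∩ Z)).card := by
      refine g.ext.cut_ge hk0 (Finset.inter_subset_left.trans hY) hYZ ?_
      intro h
      have : v ∈ Y ∩ Z := by rw [h]; exact g.hX hvX
      exact h2 (Finset.mem_inter.1 this).1
    have hle : (cut A (Y ∪ Z)).card ≤ k := by have := g.cZ; omega
    refine ⟨(Y ∩ X) ∪ B, Finset.union_subset_union_left Finset.inter_subset_right, ?_, ?_, ?_⟩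
    · simp [h1, huX]
    · simp [h2, hvB]
    · refine le_trans ?_ hle
      refine le_trans (Finset.card_le_card (t := (cut A (Y ∪ Z)).image
        (fun e => if e.1 ∈ X then e else (r e.1, e.2))) ?_) Finset.card_image_le
      intro e he
      rw [mem_cut] at he
      simp only [Finset.mem_union, Finset.mem_inter, not_or, not_and] at he
      obtain ⟨a1, a2, a3, a4⟩ := he
      have e2X : e.2 ∈ X := (Finset.mem_union.1 (g.wf' e a1).2.1).resolve_right a4
      have e2Y : e.2 ∉ Y ∪ Z := by
        simp only [Finset.mem_union, not_or]; exact ⟨fun h => a3 h e2X, fun h => g.nXZ e2X h⟩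
      rw [Finset.mem_image]
      rcases a2 with a2 | a2
      · exact ⟨e, mem_cut.2 ⟨g.fromX a1 a2.2, Finset.mem_union_left _ a2.1, e2Y⟩, by simp [a2.2]⟩
      · obtain ⟨f, f1, f2, f3, rfl⟩ := g.toX a1 a2 e2X
        exact ⟨f, mem_cut.2 ⟨f1, Finset.mem_union_right _ f2, e2Y⟩, by
          simp [show f.1 ∉ X from fun h => g.nXZ h f2]⟩
  · have hYX : Y ⊆ X := fun y hy => (g.memV.1 (hY hy)).resolve_right
      (fun h => hYZ ⟨y, Finset.mem_inter.2 ⟨hy, h⟩⟩)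
    refine ⟨Y, hYX.trans Finset.subset_union_left, h1, h2, le_trans (Finset.card_le_card ?_) h3⟩
    intro e he
    rw [mem_cut] at he ⊢
    exact ⟨g.fromX he.1 (hYX he.2.1), he.2⟩

theorem ext' (g : Gad k V A X Z B β r) : Ext k (X ∪ B) (gad A X Z B r) :=
  ⟨g.wf', g.strong', g.bic', g.ncol', g.sep'⟩

theorem disjXB (g : Gad k V A X Z B β r) : Disjoint X B :=
  Finset.disjoint_left.2 (fun v h1 h2 => g.nXZ h1 (g.BZ h2))

theorem card' (g : Gad k V A X Z B β r) : (X ∪ B).card = X.card + k := by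
  rw [Finset.card_union_of_disjoint g.disjXB, g.Bcard]

theorem card_lt (g : Gad k V A X Z B β r) : (X ∪ B).card < V.card := by
  rw [g.card']
  have h1 := g.Zk
  have h2 : Z.card = V.card - X.card := by rw [g.hZ, Finset.card_sdiff_of_subset g.hX]
  omega

theorem notWheel (g : Gad k V A X Z B β r) : ¬ AWheel (X ∪ B) (gad A X Z B r) := by
  rintro ⟨x, hx, h1, h2, h3⟩
  by_cases hxB : x ∈ B
  · obtain ⟨p, hp, q, hq, hpq⟩ := Finset.one_lt_card.1 (show 1 < X.card from g.X2)
    have e1 := (h1 p (Finset.mem_union_left _ hp) (fun h => g.nXZ hp (g.BZ (h ▸ hxB)))).1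
    have e2 := (h1 q (Finset.mem_union_left _ hq) (fun h => g.nXZ hq (g.BZ (h ▸ hxB)))).1
    exact hpq (g.uniq_out hxB hp hq e1 e2)
  have hxX := (Finset.mem_union.1 hx).resolve_right hxB
  obtain ⟨p, hp, hpx⟩ := Finset.exists_mem_ne (show 1 < X.card from g.X2) x
  obtain ⟨e, he, hcase⟩ := g.bic' x hx B
    (fun b hb => Finset.mem_erase.2 ⟨fun h => hxB (h ▸ hb), Finset.mem_union_right _ hb⟩) g.Bne
    (fun h => by
      have : p ∈ B := by rw [h]; exact Finset.mem_erase.2 ⟨hpx, Finset.mem_union_left _ hp⟩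
      exact g.nXZ hp (g.BZ this))
  simp only [Finset.mem_sdiff, Finset.mem_erase, Finset.mem_union] at hcase
  rcases hcase with ⟨a1, ⟨a2, a3⟩, a4⟩ | ⟨a1, ⟨a2, a3⟩, a4⟩
  · have := (h1 e.1 (Finset.mem_union_right _ a1) (fun h => hxB (h ▸ a1))).2
    exact a2 (g.uniq_out a1 (a3.resolve_right a4) hxX he this)
  · have := (h1 e.2 (Finset.mem_union_right _ a1) (fun h => hxB (h ▸ a1))).1
    exact a2 (g.uniq_in a1 (a3.resolve_right a4) hxX he this)

/-- lifting separations when `a ∈ X` and `B ⊆ V1` -/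
theorem lift1 (g : Gad k V A X Z B β r) {a V1 V2} (h : SepAt (X ∪ B) (gad A X Z B r) a V1 V2) (haX : a ∈ X)
    (hB : B ⊆ V1) : SepAt V A a (V1 ∪ Z) V2 := by
  have hsub : ∀ v, v ∈ V1 ∨ v ∈ V2 ↔ (v ≠ a ∧ (v ∈ X ∨ v ∈ B)) := by
    intro v
    have := congrArg (v ∈ ·) h.un
    simpa using this
  have hdj : ∀ v, v ∈ V1 → v ∈ V2 → False := fun v h1 h2 => Finset.disjoint_left.1 h.dj h1 h2
  have hV2X : ∀ v ∈ V2, v ∈ X := fun v hv => ((hsub v).1 (Or.inr hv)).2.resolve_right (fun hb => hdj v (hB hb) hv)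
  have m12 : ∀ e ∈ A, e.1 ∈ V1 ∪ Z → e.2 ∈ V2 →
      ((if e.1 ∈ X then e else (r e.1, e.2)) ∈ gad A X Z B r ∧
        (if e.1 ∈ X then e else (r e.1, e.2)).1 ∈ V1 ∧ (if e.1 ∈ X then e else (r e.1, e.2)).2 ∈ V2) := by
    intro e he h1 h2
    by_cases hX : e.1 ∈ X
    · simp only [hX, if_true]
      refine ⟨g.inX he hX, ?_, h2⟩
      exact (Finset.mem_union.1 h1).resolve_right (fun h => g.nXZ hX h)
    · simp only [hX, if_false]
      have hZ : e.1 ∈ Z := (g.memV.1 (g.ext.hwf e he).1).resolve_left hX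
      exact ⟨g.inImg he hZ (hV2X _ h2), hB (g.hr _), h2⟩
  refine ⟨g.hX haX, h.n1.mono Finset.subset_union_left, h.n2, ?_, ?_, ?_, ?_⟩
  · rw [Finset.disjoint_left]
    intro v h1 h2
    rcases Finset.mem_union.1 h1 with h1 | h1
    · exact hdj v h1 h2
    · exact g.nXZ (hV2X v h2) h1
  · ext v
    have h1 := hsub v
    have h2 := g.memV (v := v)
    have h3 : v ∈ B → v ∈ Z := fun h => g.BZ h
    have h4 : v = a → v ∉ Z := fun h h' => g.nXZ haX (h ▸ h')
    simp only [Finset.mem_union, Finset.mem_erase]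
    tauto
  · intro e he e' he' h1 h2 h3 h4
    obtain ⟨a1, a2, a3⟩ := m12 e he h1 h2
    obtain ⟨b1, b2, b3⟩ := m12 e' he' h3 h4
    have heq := h.u12 _ a1 _ b1 a2 a3 b2 b3
    by_cases c1 : e.1 ∈ X <;> by_cases c2 : e'.1 ∈ X <;> simp only [c1, c2, if_true, if_false] at heq
    · exact heq
    · have : e.1 = r e'.1 := by rw [heq]
      exact (g.nXZ c1 (g.BZ (this ▸ g.hr e'.1))).elim
    · have : e'.1 = r e.1 := by rw [← heq]
      exact (g.nXZ c2 (g.BZ (this ▸ g.hr e.1))).elim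
    · simp only [Prod.mk.injEq] at heq
      exact g.rinj he ((g.memV.1 (g.ext.hwf e he).1).resolve_left c1) (hV2X _ h2)
        he' ((g.memV.1 (g.ext.hwf e' he').1).resolve_left c2) (hV2X _ h4) heq.1
  · intro e he e' he' h1 h2 h3 h4
    have aux : ∀ e ∈ A, e.1 ∈ V2 → e.2 ∈ V1 ∪ Z → e.2 ∈ V1 := by
      intro e he h1 h2
      rcases Finset.mem_union.1 h2 with h | h
      · exact h
      · exact hB (g.head_B he (hV2X _ h1) h)
    exact h.u21 e (g.inX he (hV2X _ h1)) e' (g.inX he' (hV2X _ h3)) h1 (aux e he h1 h2) h3 (aux e' he' h3 h4)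

/-- `a ∈ B`, `B \ a ⊆ V1`: impossible -/
theorem noB1 (g : Gad k V A X Z B β r) {a V1 V2} (h : SepAt (X ∪ B) (gad A X Z B r) a V1 V2) (haB : a ∈ B)
    (hB : ∀ b ∈ B, b ∉ V2) : False := by
  classical
  have hsub : ∀ v, v ∈ V1 ∨ v ∈ V2 ↔ (v ≠ a ∧ (v ∈ X ∨ v ∈ B)) := by
    intro v
    have := congrArg (v ∈ ·) h.un
    simpa using this
  have hV2X : ∀ v ∈ V2, v ∈ X := fun v hv => ((hsub v).1 (Or.inr hv)).2.resolve_right (fun hb => hB v hb hv)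
  have hge : k ≤ (cut (gad A X Z B r) V2).card := by
    refine g.ext'.cut_ge (by have := g.k3; omega) (fun v hv => Finset.mem_union_left _ (hV2X v hv)) h.n2 ?_
    intro h'
    exact hB a haB (by rw [h']; exact Finset.mem_union_right _ haB)
  have hle : (cut (gad A X Z B r) V2).card ≤ ({true, false} : Finset Bool).card := by
    refine Finset.card_le_card_of_injOn (fun e => decide (e.2 = a)) ?_ ?_
    · intro e _; simp; exact em _
    · intro e he e' he' heq
      have h1 := mem_cut.1 he
      have h2 := mem_cut.1 he'
      have hiff : e.2 = a ↔ e'.2 = a := by simpa using heq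
      by_cases hc : e.2 = a
      · have hc' := hiff.1 hc
        have := g.uniq_in haB (hV2X _ h1.2.1) (hV2X _ h2.2.1) (by rw [← hc]; exact h1.1) (by rw [← hc']; exact h2.1)
        exact Prod.ext this (hc.trans hc'.symm)
      · have hc' : ¬ e'.2 = a := fun h => hc (hiff.2 h)
        have m : ∀ e ∈ gad A X Z B r, e.1 ∈ V2 → e.2 ∉ V2 → e.2 ≠ a → e.2 ∈ V1 := by
          intro e he h1 h2 h3
          have := (hsub e.2).2 ⟨h3, Finset.mem_union.1 (g.wf' e he).2.1⟩
          tauto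
        exact h.u21 e h1.1 e' h2.1 h1.2.1 (m e h1.1 h1.2.1 h1.2.2 hc) h2.2.1 (m e' h2.1 h2.2.1 h2.2.2 hc')
  have : ({true, false} : Finset Bool).card = 2 := by decide
  have := g.k3
  omega

/-- `a ∈ B`, `X ⊆ V1`, impossible if `B` is split -/
theorem noB2 (g : Gad k V A X Z B β r) {a V1 V2} (h : SepAt (X ∪ B) (gad A X Z B r) a V1 V2)
    {b1 b2} (hb1 : b1 ∈ B) (hb2 : b2 ∈ B) (h1 : b1 ∈ V1) (h2 : b2 ∈ V2) (hX : X ⊆ V1) : False := by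
  have hne : b1 ≠ b2 := fun h' => Finset.disjoint_left.1 h.dj h1 (h' ▸ h2)
  obtain ⟨p, hp, hpb⟩ := g.ex_in hb2
  have := h.u12 (p, b2) (g.inX hpb hp) (b1, b2) (g.inB hb1 hb2 hne) (hX hp) h2 h1 h2
  simp only [Prod.mk.injEq, and_true] at this
  exact g.nXZ hp (g.BZ (this ▸ hb1))

theorem liftSep (g : Gad k V A X Z B β r) (h : Sep (X ∪ B) (gad A X Z B r)) : Sep V A := by
  obtain ⟨a, V1, V2, h⟩ := h
  have hsub : ∀ v, v ∈ V1 ∨ v ∈ V2 ↔ (v ≠ a ∧ (v ∈ X ∨ v ∈ B)) := by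
    intro v
    have := congrArg (v ∈ ·) h.un
    simpa using this
  have hdj : ∀ v, v ∈ V1 → v ∈ V2 → False := fun v h1 h2 => Finset.disjoint_left.1 h.dj h1 h2
  rcases Finset.mem_union.1 h.ha with haX | haB
  · by_cases c1 : ∃ b ∈ B, b ∈ V2
    · obtain ⟨b2, hb2, hbV2⟩ := c1
      by_cases c2 : ∃ b ∈ B, b ∈ V1
      · exfalso
        obtain ⟨b1, hb1, hbV1⟩ := c2
        have : ∃ b3 ∈ B, b3 ≠ b1 ∧ b3 ≠ b2 := by
          have : ((B.erase b1).erase b2).Nonempty := by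
            rw [← Finset.card_pos]
            have := g.Bcard
            have := g.k3
            have h1 := Finset.pred_card_le_card_erase (s := B) (a := b1)
            have h2 := Finset.pred_card_le_card_erase (s := B.erase b1) (a := b2)
            omega
          obtain ⟨b3, hb3⟩ := this
          simp only [Finset.mem_erase] at hb3
          exact ⟨b3, hb3.2.2, hb3.2.1, hb3.1⟩
        obtain ⟨b3, hb3, n1, n2⟩ := this
        have hne : b1 ≠ b2 := fun h' => hdj b1 hbV1 (h' ▸ hbV2)
        have : b3 ∈ V1 ∨ b3 ∈ V2 := (hsub b3).2 ⟨fun h' => g.nXZ haX (g.BZ (h' ▸ hb3)), Or.inr hb3⟩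
        rcases this with h3 | h3
        · have := h.u12 _ (g.inB hb3 hb2 n2) _ (g.inB hb1 hb2 hne) h3 hbV2 hbV1 hbV2
          simp only [Prod.mk.injEq, and_true] at this
          exact n1 this
        · have := h.u12 _ (g.inB hb1 hb3 n1.symm) _ (g.inB hb1 hb2 hne) hbV1 h3 hbV1 hbV2
          simp only [Prod.mk.injEq, true_and] at this
          exact n2 this
      · push Not at c2
        have hB : B ⊆ V2 := fun b hb =>
          ((hsub b).2 ⟨fun h' => g.nXZ haX (g.BZ (h' ▸ hb)), Or.inr hb⟩).resolve_left (c2 b hb)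
        exact ⟨_, _, _, g.lift1 h.symm haX hB⟩
    · push Not at c1
      have hB : B ⊆ V1 := fun b hb =>
        ((hsub b).2 ⟨fun h' => g.nXZ haX (g.BZ (h' ▸ hb)), Or.inr hb⟩).resolve_right (c1 b hb)
      exact ⟨_, _, _, g.lift1 h haX hB⟩
  · exfalso
    by_cases c1 : ∃ b ∈ B, b ∈ V2
    · by_cases c2 : ∃ b ∈ B, b ∈ V1
      · obtain ⟨b2, hb2, hbV2⟩ := c1
        obtain ⟨b1, hb1, hbV1⟩ := c2
        have hne : b1 ≠ b2 := fun h' => hdj b1 hbV1 (h' ▸ hbV2)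
        have hXs : ∀ x ∈ X, x ∈ V1 ∨ x ∈ V2 := fun x hx =>
          (hsub x).2 ⟨fun h' => g.nXZ hx (g.BZ (h' ▸ haB)), Or.inl hx⟩
        by_cases d1 : X ⊆ V1
        · exact g.noB2 h hb1 hb2 hbV1 hbV2 d1
        by_cases d2 : X ⊆ V2
        · exact g.noB2 h.symm hb2 hb1 hbV2 hbV1 d2
        obtain ⟨x2, hx2, hx21⟩ := Finset.not_subset.1 d1
        obtain ⟨x1, hx1, hx12⟩ := Finset.not_subset.1 d2
        obtain ⟨e, he, hcase⟩ := g.conn (X ∩ V1) Finset.inter_subset_left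
          ⟨x1, Finset.mem_inter.2 ⟨hx1, (hXs x1 hx1).resolve_right hx12⟩⟩
          (fun h' => hx21 (Finset.mem_inter.1 (show x2 ∈ X ∩ V1 by rw [h']; exact hx2)).2)
        simp only [Finset.mem_sdiff, Finset.mem_inter] at hcase
        rcases hcase with ⟨a1, a2, a3⟩ | ⟨a1, a2, a3⟩
        · have := h.u12 e (g.inX he a1.1) _ (g.inB hb1 hb2 hne) a1.2
            ((hXs _ a2).resolve_left (fun h' => a3 ⟨a2, h'⟩)) hbV1 hbV2
          exact g.nXZ a1.1 (g.BZ (by rw [this]; exact hb1))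
        · have := h.u21 e (g.inX he a2) _ (g.inB hb2 hb1 hne.symm)
            ((hXs _ a2).resolve_left (fun h' => a3 ⟨a2, h'⟩)) a1.2 hbV2 hbV1
          exact g.nXZ a1.1 (g.BZ (by rw [this]; exact hb1))
      · push Not at c2
        exact g.noB1 h.symm haB c2
    · push Not at c1
      exact g.noB1 h haB c1

end Gad

def Out (k : ℕ) (V : Finset ℕ) (A : Finset (ℕ × ℕ)) : Prop :=
  (V.card = k + 1 ∧ Compl V A) ∨ (k = 3 ∧ AWheel V A) ∨ Sep V A

/-- induction hypothesis -/
def IH (n : ℕ) : Prop := ∀ k V A, 3 ≤ k → V.card < n → Ext k V A → Out k V A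

theorem gadget {k : ℕ} (hk : 3 ≤ k) {V A} (h : Ext k V A) (ih : IH V.card) {X : Finset ℕ} (hX : X ⊆ V)
    (h2 : 2 ≤ X.card) (hZ : k < (V \ X).card) (hc : (cut A X).card = k) (hM : MR k A X (V \ X)) :
    Sep V A := by
  classical
  have hk0 : 0 < k := by omega
  have hXne : X.Nonempty := by rw [← Finset.card_pos]; omega
  have hXV : X ≠ V := by rintro rfl; simp at hZ
  obtain ⟨α, hα⟩ := h.ind_colb hk0 (fun h' => hXV (Finset.Subset.antisymm hX h'))
  obtain ⟨β, hβ⟩ := h.ind_colb hk0 (not_sub_sdiff hX hXne)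
  have hT := hM α β hα hβ
  have hs : (cut A X).image (fun e => β e.2) = Finset.univ := by
    rw [← Finset.card_eq_iff_eq_univ, Finset.card_image_of_injOn hT.ih, hc]; simp
  have : ∀ c : Fin k, ∃ b ∈ (cut A X).image Prod.snd, β b = c := by
    intro c
    have := Finset.mem_univ c
    rw [← hs] at this
    obtain ⟨e, he, hec⟩ := Finset.mem_image.1 this
    exact ⟨e.2, Finset.mem_image.2 ⟨e, he, rfl⟩, hec⟩
  choose ρ hρ1 hρ2 using this
  have g : Gad k V A X (V \ X) ((cut A X).image Prod.snd) β (fun z => ρ (β z)) :=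
    ⟨hk, h, hX, rfl, hc, by rw [h.cut_compl hk0, hc], hM, hβ, rfl, fun z => hρ1 _, fun z => hρ2 _, h2, hZ⟩
  rcases ih k _ _ hk g.card_lt g.ext' with ⟨h1, -⟩ | ⟨-, h1⟩ | h1
  · rw [g.card'] at h1; omega
  · exact (g.notWheel h1).elim
  · exact g.liftSep h1

end Ex

set_option linter.all false
namespace Ex
open Relation

theorem Ext.loop {k V A} (h : Ext k V A) : ∀ e ∈ A, e.1 ≠ e.2 := fun e he => (h.wf e he).2.2

theorem Ext.ne_single {k : ℕ} (hk : 0 < k) {V A} (h : Ext k V A) (v : ℕ) : V ≠ {v} := by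
  rintro rfl
  obtain ⟨hc, hv⟩ := h.crit hk
  obtain ⟨e, he⟩ := hc.nonempty hk
  have := h.wf e he
  simp only [Finset.mem_singleton] at this
  exact this.2.2 (this.1.trans this.2.1.symm)

theorem Ext.odeg_ge {k : ℕ} (hk : 0 < k) {V A} (h : Ext k V A) {v : ℕ} (hv : v ∈ V) : k ≤ odeg A v := by
  rw [← cut_single h.loop]
  exact h.cut_ge hk (by simpa using hv) (by simp) (fun h' => h.ne_single hk v h'.symm)

theorem mr_small {k : ℕ} (hk : 0 < k) {V A X} (h : Ext k V A) (hX : X ⊆ V) (h1 : X.Nonempty) (h2 : X ≠ V)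
    (hM : MR k A X (V \ X)) (hs : (V \ X).card ≤ k) {b : ℕ} (hb : b ∈ V \ X) : odeg A b = k := by
  classical
  have hge := h.odeg_ge hk (Finset.mem_sdiff.1 hb).1
  obtain ⟨α, hα⟩ := h.ind_colb hk (fun h' => h2 (Finset.Subset.antisymm hX h'))
  obtain ⟨β, hβ⟩ := h.ind_colb hk (not_sub_sdiff hX h1)
  have hT := hM α β hα hβ
  have hle : ideg A b ≤ (V \ X).card := by
    refine Finset.card_le_card_of_injOn (fun e => if e.1 ∈ X then b else e.1) ?_ ?_
    · intro e he
      have h1 := Finset.mem_filter.1 he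
      have h3 := h.wf e h1.1
      by_cases hc : e.1 ∈ X
      · simp only [hc, if_true]; exact hb
      · simp only [hc, if_false]; exact Finset.mem_sdiff.2 ⟨h3.1, hc⟩
    · intro e he e' he' heq
      have h1 := Finset.mem_filter.1 he
      have h1' := Finset.mem_filter.1 he'
      have n1 := h.loop e h1.1
      have n2 := h.loop e' h1'.1
      rw [h1.2] at n1
      rw [h1'.2] at n2
      by_cases c1 : e.1 ∈ X <;> by_cases c2 : e'.1 ∈ X <;> simp only [c1, c2, if_true, if_false] at heq
      · refine hT.ih (mem_cut.2 ⟨h1.1, c1, ?_⟩) (mem_cut.2 ⟨h1'.1, c2, ?_⟩) ?_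
        · rw [h1.2]; exact (Finset.mem_sdiff.1 hb).2
        · rw [h1'.2]; exact (Finset.mem_sdiff.1 hb).2
        · simp only [h1.2, h1'.2]
      · exact absurd heq.symm n2
      · exact absurd heq n1
      · exact Prod.ext heq (h1.2.trans h1'.2.symm)
  rw [← h.euler hk] at hle
  omega

theorem one_big {k : ℕ} (hk : 3 ≤ k) {V A} (h : Ext k V A) (ih : IH V.card) (hS : ¬ Sep V A)
    {u v : ℕ} (hu : u ∈ V) (hv : v ∈ V) (huv : u ≠ v) : odeg A u = k ∨ odeg A v = k := by
  classical
  have hk0 : 0 < k := by omega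
  obtain ⟨Y, hY, huY, hvY, hle⟩ := h.sep u hu v hv huv
  have hYne : Y.Nonempty := ⟨u, huY⟩
  have hYV : Y ≠ V := fun h' => hvY (h' ▸ hv)
  have hge := h.cut_ge hk0 hY hYne hYV
  have hc : (cut A Y).card = k := le_antisymm hle hge
  have hc' : (cut A (V \ Y)).card = k := by rw [h.cut_compl hk0, hc]
  have huu : V \ (V \ Y) = Y := by
    ext w; simp only [Finset.mem_sdiff]; have := @hY w; tauto
  have hvm : v ∈ V \ Y := Finset.mem_sdiff.2 ⟨hv, hvY⟩
  -- a tight side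
  have key : ∀ X ⊆ V, X.Nonempty → X ≠ V → (cut A X).card = k → MR k A X (V \ X) →
      (∃ w, X = {w}) ∨ ∀ b ∈ V \ X, odeg A b = k := by
    intro X hX h1 h2 hc hM
    by_cases c : 2 ≤ X.card
    · right
      intro b hb
      refine mr_small hk0 h hX h1 h2 hM ?_ hb
      by_contra hcon
      exact hS (gadget hk h ih hX c (by omega) hc hM)
    · left
      have : 0 < X.card := h1.card_pos
      exact Finset.card_eq_one.1 (by omega)
  rcases h.tight (by omega) hY hYne hYV hc with hM | hM
  · rcases key Y hY hYne hYV hc hM with ⟨w, hw⟩ | hb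
    · left
      have : u = w := by simpa [hw] using huY
      rw [← cut_single h.loop, this, ← hw, hc]
    · exact Or.inr (hb v hvm)
  · rcases key (V \ Y) Finset.sdiff_subset ⟨v, hvm⟩ (fun h' => by rw [← h'] at hu; exact (Finset.mem_sdiff.1 hu).2 huY) hc' (by rw [huu]; exact hM) with ⟨w, hw⟩ | hb
    · right
      have : v = w := by simpa [hw] using hvm
      rw [← cut_single h.loop, this, ← hw, hc']
    · exact Or.inl (hb u (by rw [huu]; exact huY))

theorem big_vertex {k : ℕ} (hk : 3 ≤ k) {V A} (h : Ext k V A) (ih : IH V.card) (hS : ¬ Sep V A) :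
    ∃ x ∈ V, ∀ y ∈ V, y ≠ x → odeg A y = k ∧ ideg A y = k := by
  have hk0 : 0 < k := by omega
  obtain ⟨hc, hv⟩ := h.crit hk0
  by_cases hb : ∃ x ∈ V, odeg A x ≠ k
  · obtain ⟨x, hx, hxk⟩ := hb
    refine ⟨x, hx, fun y hy hyx => ?_⟩
    have := (one_big hk h ih hS hy hx hyx).resolve_right hxk
    exact ⟨this, by rw [← h.euler hk0, this]⟩
  · push Not at hb
    obtain ⟨e, he⟩ := hc.nonempty hk0
    exact ⟨e.1, (h.wf e he).1, fun y hy _ => ⟨hb y hy, by rw [← h.euler hk0, hb y hy]⟩⟩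

/-- the splitting lemma -/
theorem split {k : ℕ} (hk : 3 ≤ k) {V A} (h : Ext k V A) {x y z : ℕ} (hxy : (x, y) ∈ A) (hyz : (y, z) ∈ A)
    (hxz : x ≠ z) {U : Finset ℕ} (hU : U ⊆ V) (hxU : x ∈ U) (hzU : z ∈ U) (hyU : y ∉ U)
    (hn : ¬ Colb k (insert (x, z) (ind A U))) : Sep V A := by
  classical
  have hk0 : 0 < k := by omega
  have ⟨hx, hy, nxy⟩ := h.wf _ hxy
  have ⟨_, hz, nyz⟩ := h.wf _ hyz
  simp only at hx hy hz nxy nyz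
  set A' := insert (x, z) ((A.erase (x, y)).erase (y, z)) with hA'
  have memA' : ∀ e, e ∈ A' ↔ e = (x, z) ∨ (e ≠ (y, z) ∧ e ≠ (x, y) ∧ e ∈ A) := by
    intro e; simp [hA']
  have cutle : ∀ Y : Finset ℕ, (cut A' Y).card ≤ (cut A Y).card := by
    intro Y
    by_cases c : x ∈ Y ∧ z ∉ Y
    · by_cases cy : y ∈ Y
      · have : cut A' Y ⊆ insert (x, z) ((cut A Y).erase (y, z)) := by
          intro e he
          rw [mem_cut, memA'] at he
          simp only [Finset.mem_insert, Finset.mem_erase, mem_cut]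
          tauto
        refine (Finset.card_le_card this).trans ?_
        refine (Finset.card_insert_le _ _).trans ?_
        rw [Finset.card_erase_add_one]
        exact mem_cut.2 ⟨hyz, cy, c.2⟩
      · have : cut A' Y ⊆ insert (x, z) ((cut A Y).erase (x, y)) := by
          intro e he
          rw [mem_cut, memA'] at he
          simp only [Finset.mem_insert, Finset.mem_erase, mem_cut]
          tauto
        refine (Finset.card_le_card this).trans ?_
        refine (Finset.card_insert_le _ _).trans ?_
        rw [Finset.card_erase_add_one]
        exact mem_cut.2 ⟨hxy, c.1, cy⟩
    · apply Finset.card_le_card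
      intro e he
      rw [mem_cut, memA'] at he
      rw [mem_cut]
      rcases he with ⟨rfl | he, he2⟩
      · exact absurd he2 c
      · exact ⟨he.2.2, he2⟩
  have strong' : ∀ X ⊆ V, X.Nonempty → X ≠ V → (cut A' X).Nonempty := by
    intro X hX h1 h2
    have hge := h.cut_ge hk0 hX h1 h2
    have : (((cut A X).erase (x, y)).erase (y, z)).Nonempty := by
      rw [← Finset.card_pos]
      have := Finset.pred_card_le_card_erase (s := cut A X) (a := (x, y))
      have := Finset.pred_card_le_card_erase (s := (cut A X).erase (x, y)) (a := (y, z))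
      omega
    obtain ⟨e, he⟩ := this
    refine ⟨e, ?_⟩
    simp only [Finset.mem_erase, mem_cut] at he
    rw [mem_cut, memA']
    exact ⟨Or.inr ⟨he.1, he.2.1, he.2.2.1⟩, he.2.2.2⟩
  have wf' : ∀ e ∈ A', e.1 ∈ V ∧ e.2 ∈ V ∧ e.1 ≠ e.2 := by
    intro e he
    rcases (memA' e).1 he with rfl | he
    · exact ⟨hx, hz, hxz⟩
    · exact h.wf e he.2.2
  obtain ⟨Q, hQ, hQc⟩ := exists_crit hn
  have hQU : vs Q ⊆ U := by
    intro v hv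
    obtain ⟨e, he, h'⟩ := mem_vs.1 hv
    have := hQ he
    simp only [Finset.mem_insert, mem_ind] at this
    rcases this with rfl | he'
    · rcases h' with rfl | rfl; exacts [hxU, hzU]
    · rcases h' with rfl | rfl; exacts [he'.2.1, he'.2.2]
  have hQA : Q ⊆ A' := by
    intro e he
    have := hQ he
    rw [Finset.mem_insert, mem_ind] at this
    rw [memA']
    rcases this with rfl | ⟨h1, h2, h3⟩
    · exact Or.inl rfl
    · right
      refine ⟨?_, ?_, h1⟩
      · rintro rfl; exact hyU h2
      · rintro rfl; exact hyU h3
  have hxzQ : (x, z) ∈ Q := by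
    by_contra hcon
    apply hQc.1
    refine (h.ind_colb hk0 (X := U) (fun h' => hyU (h' hy))).subset ?_
    intro e he
    rcases Finset.mem_insert.1 (hQ he) with rfl | h'
    · exact absurd he hcon
    · exact h'
  obtain ⟨ea, q, hq⟩ := ear wf' strong' (fun u hu v hv huv => by
    obtain ⟨Y, h1, h2, h3, h4⟩ := h.sep u hu v hv huv
    exact ⟨Y, h1, h2, h3, (cutle Y).trans h4⟩) hQA (hQc.nonempty hk0) (fun X h1 h2 => crit_cut hk0 hQc h1 h2)
  have hxQ : x ∈ vs Q := mem_vs.2 ⟨_, hxzQ, Or.inl rfl⟩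
  have hzQ : z ∈ vs Q := mem_vs.2 ⟨_, hxzQ, Or.inr rfl⟩
  have hyQ : y ∉ vs Q := fun h' => hyU (hQU h')
  have hUV : vs Q ⊆ V := hQU.trans hU
  obtain ⟨hqy, -, -⟩ := hq y hy hyQ
  -- all outside vertices have the same attachment
  have hsame : ∀ w ∈ V, w ∉ vs Q → q w = q y := by
    by_contra hcon
    push Not at hcon
    obtain ⟨w, hw, hwQ, hne⟩ := hcon
    set C := V.filter (fun v => v ∉ vs Q ∧ q v = q w) with hC
    have hqw := (hq w hw hwQ).1
    obtain ⟨e, he, h'⟩ := h.bic (q w) (hUV hqw) C (by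
      intro v hv
      rw [hC, Finset.mem_filter] at hv
      exact Finset.mem_erase.2 ⟨fun h' => hv.2.1 (h' ▸ hqw), hv.1⟩) ⟨w, by simp [hC, hw, hwQ]⟩ (by
      intro h'
      have : y ∈ V.erase (q w) := Finset.mem_erase.2 ⟨fun h' => hyQ (h' ▸ hqw), hy⟩
      rw [← h', hC, Finset.mem_filter] at this
      exact hne this.2.2.symm)
    have gen : ∀ c d, c ∈ C → d ∈ V.erase (q w) \ C → ((c, d) ∈ A ∨ (d, c) ∈ A) → False := by
      intro c d hc hd hcd
      rw [hC, Finset.mem_filter] at hc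
      simp only [hC, Finset.mem_sdiff, Finset.mem_erase, Finset.mem_filter] at hd
      have hcy : c ≠ y := fun h' => hne (by rw [← h']; exact hc.2.2.symm)
      have hcQ := hc.2.1
      have hcx : c ≠ x := fun h' => hcQ (h' ▸ hxQ)
      have hcz : c ≠ z := fun h' => hcQ (h' ▸ hzQ)
      have hcd' : (c, d) ∈ A' ∨ (d, c) ∈ A' := by
        rw [memA', memA']
        rcases hcd with hcd | hcd
        · left; right
          exact ⟨fun h' => hcy (Prod.ext_iff.1 h').1, fun h' => hcx (Prod.ext_iff.1 h').1, hcd⟩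
        · right; right
          exact ⟨fun h' => hcz (Prod.ext_iff.1 h').2, fun h' => hcy (Prod.ext_iff.1 h').2, hcd⟩
      obtain ⟨-, g1, g2⟩ := hq c hc.1 hcQ
      by_cases hdQ : d ∈ vs Q
      · have := g1 d hdQ hcd'.symm
        exact hd.1.1 (this.trans hc.2.2)
      · rcases hcd' with h' | h'
        · exact hd.2 ⟨hd.1.2, hdQ, (g2 d hd.1.2 hdQ h').trans hc.2.2⟩
        · have := (hq d hd.1.2 hdQ).2.2 c hc.1 hcQ h'
          exact hd.2 ⟨hd.1.2, hdQ, by rw [← this, hc.2.2]⟩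
    rcases h' with ⟨h1, h2⟩ | ⟨h1, h2⟩
    · exact gen _ _ h1 h2 (Or.inl he)
    · exact gen _ _ h1 h2 (Or.inr he)
  have hq' : ∀ e ∈ A', (e.1 ∈ (vs Q).erase (q y) → e.2 ∈ V \ vs Q → False) ∧
      (e.2 ∈ (vs Q).erase (q y) → e.1 ∈ V \ vs Q → False) := by
    intro e he
    constructor
    · intro h1 h2
      rw [Finset.mem_erase] at h1; rw [Finset.mem_sdiff] at h2
      exact h1.1 (((hq _ h2.1 h2.2).2.1 _ h1.2 (Or.inl he)).trans (hsame _ h2.1 h2.2))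
    · intro h1 h2
      rw [Finset.mem_erase] at h1; rw [Finset.mem_sdiff] at h2
      exact h1.1 (((hq _ h2.1 h2.2).2.1 _ h1.2 (Or.inr he)).trans (hsame _ h2.1 h2.2))
  have h12 : ∀ e ∈ A, e.1 ∈ (vs Q).erase (q y) → e.2 ∈ V \ vs Q → e = (x, y) := by
    intro e he h1 h2
    by_contra hne
    refine (hq' e ((memA' e).2 (Or.inr ⟨?_, hne, he⟩))).1 h1 h2
    rintro rfl
    exact (Finset.mem_sdiff.1 h2).2 hzQ
  have h21 : ∀ e ∈ A, e.1 ∈ V \ vs Q → e.2 ∈ (vs Q).erase (q y) → e = (y, z) := by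
    intro e he h1 h2
    by_contra hne
    refine (hq' e ((memA' e).2 (Or.inr ⟨hne, ?_, he⟩))).2 h2 h1
    rintro rfl
    exact (Finset.mem_sdiff.1 h1).2 hxQ
  refine ⟨q y, (vs Q).erase (q y), V \ vs Q, hUV hqy, ?_, ⟨y, Finset.mem_sdiff.2 ⟨hy, hyQ⟩⟩, ?_, ?_, ?_, ?_⟩
  · by_cases c : x = q y
    · exact ⟨z, Finset.mem_erase.2 ⟨fun h' => hxz (c.trans h'.symm), hzQ⟩⟩
    · exact ⟨x, Finset.mem_erase.2 ⟨c, hxQ⟩⟩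
  · exact Finset.disjoint_left.2 fun v h1 h2 => (Finset.mem_sdiff.1 h2).2 (Finset.mem_of_mem_erase h1)
  · ext v
    simp only [Finset.mem_union, Finset.mem_erase, Finset.mem_sdiff]
    have h1 := @hUV v
    have h2 : v = q y → v ∈ vs Q := fun h' => h' ▸ hqy
    tauto
  · intro e he e' he' h1 h2 h3 h4
    rw [h12 e he h1 h2, h12 e' he' h3 h4]
  · intro e he e' he' h1 h2 h3 h4
    rw [h21 e he h1 h2, h21 e' he' h3 h4]

end Ex

set_option linter.all false
namespace Ex
open Relation

theorem odeg_split (A : Finset (ℕ × ℕ)) {S : Finset ℕ} {y : ℕ} (hy : y ∈ S) :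
    odeg A y = odeg (ind A S) y + (A.filter fun e => e.1 = y ∧ e.2 ∉ S).card := by
  classical
  unfold odeg
  rw [← Finset.card_union_of_disjoint]
  · congr 1; ext e
    simp only [Finset.mem_filter, Finset.mem_union, mem_ind]
    constructor
    · rintro ⟨a, rfl⟩; tauto
    · tauto
  · rw [Finset.disjoint_left]; intro e h1 h2
    simp only [Finset.mem_filter, mem_ind] at h1 h2; tauto

theorem ideg_split (A : Finset (ℕ × ℕ)) {S : Finset ℕ} {y : ℕ} (hy : y ∈ S) :
    ideg A y = ideg (ind A S) y + (A.filter fun e => e.2 = y ∧ e.1 ∉ S).card := by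
  classical
  unfold ideg
  rw [← Finset.card_union_of_disjoint]
  · congr 1; ext e
    simp only [Finset.mem_filter, Finset.mem_union, mem_ind]
    constructor
    · rintro ⟨a, rfl⟩; tauto
    · tauto
  · rw [Finset.disjoint_left]; intro e h1 h2
    simp only [Finset.mem_filter, mem_ind] at h1 h2; tauto

/-- list of colours available when `x` has colour `c0` -/
def Lx {k : ℕ} (A : Finset (ℕ × ℕ)) (x : ℕ) (c0 : Fin k) (y : ℕ) : Finset (Fin k) :=
  if (x, y) ∈ A then Finset.univ.erase c0 else Finset.univ

theorem Lx_card {k : ℕ} (A : Finset (ℕ × ℕ)) (x : ℕ) (c0 : Fin k) (y : ℕ) :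
    (Lx A x c0 y).card + (if (x, y) ∈ A then 1 else 0) = k := by
  unfold Lx
  split_ifs
  · rw [Finset.card_erase_of_mem (Finset.mem_univ _)]
    have : 0 < k := c0.pos
    simp; omega
  · simp

theorem mem_Lx {k : ℕ} {A : Finset (ℕ × ℕ)} {x : ℕ} {c0 : Fin k} {y : ℕ} {c : Fin k} :
    c ∈ Lx A x c0 y ↔ ((x, y) ∈ A → c ≠ c0) := by
  unfold Lx
  split_ifs with h <;> simp [h]

def LC {k : ℕ} (A : Finset (ℕ × ℕ)) (x : ℕ) (c0 : Fin k) (S : Finset ℕ) : Prop :=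
  ∃ φ : ℕ → Fin k, (∀ y ∈ S, φ y ∈ Lx A x c0 y) ∧ Col (ind A S) φ

theorem Ext.nLC {k : ℕ} {V A} (h : Ext k V A) {x : ℕ} (c0 : Fin k) : ¬ LC A x c0 (V.erase x) := by
  rintro ⟨φ, h1, h2⟩
  refine h.ncol ⟨_, extend_one (w := x) (c := c0) (fun hl => h.loop _ hl rfl) (h2.subset ?_) (Or.inr ?_)⟩
  · intro e he
    simp only [mem_away, Finset.mem_singleton] at he
    have := h.wf e he.1
    simp only [mem_ind, Finset.mem_erase]; tauto
  · intro b hb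
    have h3 := h.wf _ hb
    exact mem_Lx.1 (h1 b (Finset.mem_erase.2 ⟨fun h' => h3.2.2 h'.symm, h3.2.1⟩)) hb

/-- in a minimal non-`L`-colourable set, arc degrees are at least the list sizes -/
theorem lc_extend {k : ℕ} {A : Finset (ℕ × ℕ)} (hl : ∀ e ∈ A, e.1 ≠ e.2) {S : Finset ℕ} {y : ℕ} (hy : y ∈ S)
    {φ : ℕ → Fin k} (hφ : Col (ind A (S.erase y)) φ) {M : Finset (Fin k)}
    (hd : ideg (ind A S) y < M.card ∨ odeg (ind A S) y < M.card) :
    ∃ c ∈ M, Col (ind A S) (Function.update φ y c) := by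
  have hc : ∃ c ∈ M, (∀ a, (a, y) ∈ ind A S → φ a ≠ c) ∨ (∀ b, (y, b) ∈ ind A S → φ b ≠ c) := by
    rcases hd with hd | hd
    · obtain ⟨c, hc, hc2⟩ := exists_color M _ (fun e => φ e.1) hd
      exact ⟨c, hc, Or.inl fun a ha => hc2 (a, y) (by simp [ha])⟩
    · obtain ⟨c, hc, hc2⟩ := exists_color M _ (fun e => φ e.2) hd
      exact ⟨c, hc, Or.inr fun a ha => hc2 (y, a) (by simp [ha])⟩
  obtain ⟨c, hcM, hc⟩ := hc
  refine ⟨c, hcM, extend_one (fun h => hl _ (mem_ind.1 h).1 rfl) (hφ.subset ?_) hc⟩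
  intro e he
  simp only [mem_away, mem_ind, Finset.mem_singleton, Finset.mem_erase] at he ⊢
  tauto

structure Hub (k : ℕ) (V : Finset ℕ) (A : Finset (ℕ × ℕ)) (x : ℕ) : Prop where
  ext : Ext k V A
  hx : x ∈ V
  od : ∀ y ∈ V, y ≠ x → odeg A y = k
  id : ∀ y ∈ V, y ≠ x → ideg A y = k
  sym : ∀ y, (x, y) ∈ A ↔ (y, x) ∈ A

theorem hub {k : ℕ} (hk : 3 ≤ k) {V A} (h : Ext k V A) (ih : IH V.card) (hSep : ¬ Sep V A) :
    ∃ x, Hub k V A x := by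
  classical
  obtain ⟨x, hx, hd⟩ := big_vertex hk h ih hSep
  refine ⟨x, h, hx, fun y hy hyx => (hd y hy hyx).1, fun y hy hyx => (hd y hy hyx).2, ?_⟩
  have hk0 : 0 < k := by omega
  set c0 : Fin k := ⟨0, hk0⟩
  have hne : ((V.erase x).powerset.filter (fun T => ¬ LC A x c0 T)).Nonempty := ⟨V.erase x, by simp [h.nLC c0]⟩
  obtain ⟨S, hS, hmin⟩ := Finset.exists_min_image _ Finset.card hne
  simp only [Finset.mem_filter, Finset.mem_powerset] at hS hmin
  have hSV : S ⊆ V := hS.1.trans (Finset.erase_subset _ _)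
  have hxS : x ∉ S := fun h' => (Finset.mem_erase.1 (hS.1 h')).1 rfl
  have hlc : ∀ T ⊂ S, LC A x c0 T := by
    intro T hT
    by_contra hcon
    have := hmin T ⟨hT.1.trans hS.1, hcon⟩
    have := Finset.card_lt_card hT
    omega
  have hge : ∀ y ∈ S, (Lx A x c0 y).card ≤ ideg (ind A S) y ∧ (Lx A x c0 y).card ≤ odeg (ind A S) y := by
    intro y hy
    by_contra hcon
    rw [not_and_or, not_le, not_le] at hcon
    obtain ⟨φ, h1, h2⟩ := hlc _ (Finset.erase_ssubset hy)
    obtain ⟨c, hc, hcol⟩ := lc_extend h.loop hy h2 hcon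
    refine hS.2 ⟨_, ?_, hcol⟩
    intro v hv
    by_cases hvy : v = y
    · subst hvy; simpa using hc
    · rw [Function.update_of_ne hvy]; exact h1 v (Finset.mem_erase.2 ⟨hvy, hv⟩)
  have hid : ∀ y ∈ S, (A.filter fun e => e.2 = y ∧ e.1 ∉ S).card ≤ (if (x, y) ∈ A then 1 else 0) := by
    intro y hy
    have h1 := ideg_split A hy
    have h2 := Lx_card A x c0 y
    have h3 := hge y hy
    have h4 := (hd y (hSV hy) (fun h' => hxS (h' ▸ hy))).2
    omega
  have hod : ∀ y ∈ S, (A.filter fun e => e.1 = y ∧ e.2 ∉ S).card ≤ (if (x, y) ∈ A then 1 else 0) := by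
    intro y hy
    have h1 := odeg_split A hy
    have h2 := Lx_card A x c0 y
    have h3 := hge y hy
    have h4 := (hd y (hSV hy) (fun h' => hxS (h' ▸ hy))).1
    omega
  have hinx : ∀ e ∈ A, e.2 ∈ S → e.1 ∉ S → e.1 = x := by
    intro e he h2 h1
    have h3 := hid e.2 h2
    have hm : e ∈ A.filter fun f => f.2 = e.2 ∧ f.1 ∉ S := by simp [he, h1]
    have hpos : 0 < (A.filter fun f => f.2 = e.2 ∧ f.1 ∉ S).card := Finset.card_pos.2 ⟨e, hm⟩
    split_ifs at h3 with hc
    · have hm' : (x, e.2) ∈ A.filter fun f => f.2 = e.2 ∧ f.1 ∉ S := by simp [hc, hxS]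
      have := Finset.card_le_one.1 h3 _ hm _ hm'
      rw [this]
    · omega
  have houtx : ∀ e ∈ A, e.1 ∈ S → e.2 ∉ S → (x, e.1) ∈ A ∧ ∀ e' ∈ A, e'.1 = e.1 → e'.2 ∉ S → e' = e := by
    intro e he h1 h2
    have h3 := hod e.1 h1
    have hm : e ∈ A.filter fun f => f.1 = e.1 ∧ f.2 ∉ S := by simp [he, h2]
    have hpos : 0 < (A.filter fun f => f.1 = e.1 ∧ f.2 ∉ S).card := Finset.card_pos.2 ⟨e, hm⟩
    split_ifs at h3 with hc
    · refine ⟨hc, fun e' he' h4 h5 => ?_⟩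
      exact Finset.card_le_one.1 h3 _ (by simp [he', h4, h5]) _ hm
    · omega
  have hSne : S.Nonempty := by
    by_contra hcon
    rw [Finset.not_nonempty_iff_eq_empty] at hcon
    refine hS.2 ⟨fun _ => c0, by simp [hcon], ?_⟩
    intro v hv
    obtain ⟨w, hw, -⟩ := TransGen.head'_iff.1 hv
    have := (mem_ind.1 hw.1).2.1
    rw [hcon] at this; simp at this
  by_cases hSfull : S = V.erase x
  · -- degrees are exact
    have hsum : ∑ y ∈ S, ideg (ind A S) y = ∑ y ∈ S, odeg (ind A S) y := by
      have e1 := sum_odeg (ind A S) S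
      have e2 := sum_ideg (A := ind A S) (V := S) (fun e he => (mem_ind.1 he).2) S
      have e3 : cut (ind A S) S = ∅ := by
        ext e; rw [mem_cut, mem_ind]; simp; tauto
      have e4 : cut (ind A S) (S \ S) = ∅ := by
        ext e; rw [mem_cut]; simp
      rw [e1, e2, e3, e4]
    have hi : ∀ y ∈ S, ideg (ind A S) y = (Lx A x c0 y).card := by
      intro y hy
      have h1 := ideg_split A hy
      have h2 := Lx_card A x c0 y
      have h3 := hge y hy
      have h4 := (hd y (hSV hy) (fun h' => hxS (h' ▸ hy))).2
      split_ifs at h2 with hc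
      · have : 0 < (A.filter fun e => e.2 = y ∧ e.1 ∉ S).card := Finset.card_pos.2 ⟨(x, y), by simp [hc, hxS]⟩
        omega
      · omega
    have ho : ∀ y ∈ S, odeg (ind A S) y = (Lx A x c0 y).card := by
      have h5 : ∑ y ∈ S, (Lx A x c0 y).card = ∑ y ∈ S, odeg (ind A S) y := by
        rw [← hsum]; exact Finset.sum_congr rfl (fun y hy => (hi y hy).symm)
      intro y hy
      exact (((Finset.sum_eq_sum_iff_of_le (fun y hy => (hge y hy).2)).1 h5) y hy).symm
    intro y
    constructor
    · intro hxy
      have hw := h.wf _ hxy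
      have hy : y ∈ S := by rw [hSfull]; exact Finset.mem_erase.2 ⟨fun h' => hw.2.2 h'.symm, hw.2.1⟩
      have h1 := odeg_split A hy
      have h2 := Lx_card A x c0 y
      rw [if_pos hxy] at h2
      have h3 := ho y hy
      have h4 := (hd y (hSV hy) (fun h' => hxS (h' ▸ hy))).1
      have : 0 < (A.filter fun e => e.1 = y ∧ e.2 ∉ S).card := by omega
      obtain ⟨e, he⟩ := Finset.card_pos.1 this
      simp only [Finset.mem_filter] at he
      have hwe := h.wf e he.1
      have : e.2 = x := by
        by_contra hne
        exact he.2.2 (by rw [hSfull]; exact Finset.mem_erase.2 ⟨hne, hwe.2.1⟩)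
      rw [show (y, x) = e from Prod.ext he.2.1.symm this.symm]
      exact he.1
    · intro hyx
      have hw := h.wf _ hyx
      have hy : y ∈ S := by rw [hSfull]; exact Finset.mem_erase.2 ⟨fun h' => hw.2.2 h', hw.1⟩
      exact (houtx _ hyx hy hxS).1
  · exfalso
    apply hSep
    obtain ⟨e, he, h'⟩ := h.bic x hx S hS.1 hSne hSfull
    have h' : e.1 ∈ S ∧ e.2 ∈ V.erase x \ S := by
      rcases h' with h' | ⟨h1, h2⟩
      · exact h'
      · rw [Finset.mem_sdiff, Finset.mem_erase] at h2
        exact absurd (hinx e he h1 h2.2) h2.1.1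
    obtain ⟨y, z⟩ := e
    obtain ⟨hy, hz⟩ := h'
    simp only [Finset.mem_sdiff, Finset.mem_erase] at hy hz
    obtain ⟨hxy, huniq⟩ := houtx _ he hy hz.2
    simp only at hxy huniq
    refine split hk h hxy he (Ne.symm hz.1.1) (U := V \ S) Finset.sdiff_subset (Finset.mem_sdiff.2 ⟨hx, hxS⟩)
      (Finset.mem_sdiff.2 ⟨hz.1.2, hz.2⟩) (fun h' => (Finset.mem_sdiff.1 h').2 hy) ?_
    rintro ⟨ψ0, hψ0⟩
    obtain ⟨ψ, hψ, hψx⟩ : ∃ ψ : ℕ → Fin k, Col (insert (x, z) (ind A (V \ S))) ψ ∧ ψ x = c0 :=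
      ⟨_, hψ0.comp_inj (Equiv.swap (ψ0 x) c0) (Equiv.injective _), by simp⟩
    obtain ⟨φ0, g1, g2⟩ := hlc _ (Finset.erase_ssubset hy)
    have hod' : odeg (ind A S) y < (Finset.univ : Finset (Fin k)).card := by
      have h1 := odeg_split A hy
      have h4 := (hd y (hSV hy) (fun h' => hxS (h' ▸ hy))).1
      have : 0 < (A.filter fun e => e.1 = y ∧ e.2 ∉ S).card := Finset.card_pos.2 ⟨(y, z), by simp [he, hz.2]⟩
      simp; omega
    obtain ⟨c, -, hcol⟩ := lc_extend h.loop hy g2 (Or.inr hod')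
    set φ := Function.update φ0 y c with hφ
    have hφv : ∀ v ∈ S, v ≠ y → φ v ∈ Lx A x c0 v := by
      intro v hv hvy
      rw [hφ, Function.update_of_ne hvy]; exact g1 v (Finset.mem_erase.2 ⟨hvy, hv⟩)
    set θ : ℕ → Fin k := fun v => if v ∈ S then φ v else ψ v with hθ
    have hθS : ∀ v ∈ S, θ v = φ v := fun v hv => by simp [hθ, hv]
    have hθN : ∀ v, v ∉ S → θ v = ψ v := fun v hv => by simp [hθ, hv]
    have hcN : ∀ v, ¬ TransGen (fun a b => mono A θ a b ∧ a ∉ S ∧ b ∉ S) v v := by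
      refine acyc_mono ?_ hψ
      rintro a b ⟨⟨h1, h2⟩, ha, hb⟩
      rw [hθN a ha, hθN b hb] at h2
      have := h.wf _ h1
      exact ⟨Finset.mem_insert_of_mem (mem_ind.2 ⟨h1, Finset.mem_sdiff.2 ⟨this.1, ha⟩, Finset.mem_sdiff.2 ⟨this.2.1, hb⟩⟩), h2⟩
    have hcS : ∀ v, ¬ TransGen (fun a b => mono A θ a b ∧ ¬ a ∉ S ∧ ¬ b ∉ S) v v := by
      refine acyc_mono ?_ hcol
      rintro a b ⟨⟨h1, h2⟩, ha, hb⟩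
      rw [not_not] at ha hb
      rw [hθS a ha, hθS b hb] at h2
      exact ⟨mem_ind.2 ⟨h1, ha, hb⟩, h2⟩
    obtain ⟨b, a, hba, hb, ha, hpq, hqb, hap⟩ := unique_cross (r := mono A θ) (fun v => v ∉ S) x y hxS (not_not.2 hy) (by
      intro a b hab ha hb
      rw [not_not] at hb
      have hax := hinx _ hab.1 hb ha
      simp only at hax
      subst hax
      refine ⟨rfl, ?_⟩
      by_contra hne
      have h1 := hab.2
      rw [hθN _ ha, hθS _ hb, hψx] at h1
      exact mem_Lx.1 (hφv b hb hne) hab.1 h1.symm) hcN hcS (fun hcon => h.ncol ⟨θ, hcon⟩)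
    rw [not_not] at hb
    have hyc : φ y = c0 := by
      have := hpq.2
      rw [hθN _ hxS, hθS _ hy, hψx] at this
      exact this.symm
    have hyb : θ y = θ b := by
      have : ReflTransGen (mono A θ) y b := ReflTransGen.mono (fun _ _ h => h.1) _ _ hqb
      exact rtg_color this
    rw [hθS y hy, hθS b hb, hyc] at hyb
    have hxb := (houtx _ hba.1 hb ha).1
    have hbY : b = y := by
      by_contra hne
      exact mem_Lx.1 (hφv b hb hne) hxb hyb.symm
    subst hbY
    have haz := huniq _ hba.1 rfl ha
    have haz : a = z := (Prod.ext_iff.1 haz).2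
    subst haz
    refine hψ x (TransGen.head' (b := a) ⟨by simp, ?_⟩ (ReflTransGen.mono ?_ _ _ hap))
    · have := hba.2
      rw [hθS b hb, hθN a ha, ← hyb] at this
      rw [hψx, this]
    · rintro u v ⟨⟨h1, h2⟩, hu, hv⟩
      rw [hθN u hu, hθN v hv] at h2
      have := h.wf _ h1
      exact ⟨Finset.mem_insert_of_mem (mem_ind.2 ⟨h1, Finset.mem_sdiff.2 ⟨this.1, hu⟩, Finset.mem_sdiff.2 ⟨this.2.1, hv⟩⟩), h2⟩

end Ex

set_option linter.all false
namespace Ex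
open Relation

/-- gluing along one vertex -/
theorem glue_vertex {r : ℕ → ℕ → Prop} (X Y : ℕ → Prop) (s : ℕ) (hXY : ∀ v, X v → Y v → v = s)
    (hr : ∀ a b, r a b → (X a ∧ X b) ∨ (Y a ∧ Y b))
    (h1 : ∀ x, ¬ TransGen (fun a b => r a b ∧ X a ∧ X b) x x)
    (h2 : ∀ x, ¬ TransGen (fun a b => r a b ∧ Y a ∧ Y b) x x) : ∀ x, ¬ TransGen r x x := by
  set rX : ℕ → ℕ → Prop := fun a b => r a b ∧ X a ∧ X b with hrX
  set rY : ℕ → ℕ → Prop := fun a b => r a b ∧ Y a ∧ Y b with hrY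
  have tX : ∀ a b, TransGen rX a b → X a ∧ X b := by
    intro a b h
    obtain ⟨c, hc, -⟩ := TransGen.head'_iff.1 h
    obtain ⟨d, -, hd⟩ := TransGen.tail'_iff.1 h
    exact ⟨hc.2.1, hd.2.2⟩
  have tY : ∀ a b, TransGen rY a b → Y a ∧ Y b := by
    intro a b h
    obtain ⟨c, hc, -⟩ := TransGen.head'_iff.1 h
    obtain ⟨d, -, hd⟩ := TransGen.tail'_iff.1 h
    exact ⟨hc.2.1, hd.2.2⟩
  have key : ∀ a b, TransGen r a b → TransGen rX a b ∨ TransGen rY a b ∨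
      (TransGen rX a s ∧ TransGen rY s b) ∨ (TransGen rY a s ∧ TransGen rX s b) := by
    intro a b h
    induction h with
    | single hab =>
      rcases hr _ _ hab with h | h
      · exact Or.inl (.single ⟨hab, h⟩)
      · exact Or.inr (Or.inl (.single ⟨hab, h⟩))
    | @tail b c _ hbc ih =>
      rcases hr _ _ hbc with h | h
      · have st : rX b c := ⟨hbc, h⟩
        rcases ih with ih | ih | ih | ih
        · exact Or.inl (ih.tail st)
        · have := hXY b h.1 (tY _ _ ih).2
          subst this
          exact Or.inr (Or.inr (Or.inr ⟨ih, .single st⟩))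
        · have := hXY b h.1 (tY _ _ ih.2).2
          subst this
          exact absurd ih.2 (h2 _)
        · exact Or.inr (Or.inr (Or.inr ⟨ih.1, ih.2.tail st⟩))
      · have st : rY b c := ⟨hbc, h⟩
        rcases ih with ih | ih | ih | ih
        · have := hXY b (tX _ _ ih).2 h.1
          subst this
          exact Or.inr (Or.inr (Or.inl ⟨ih, .single st⟩))
        · exact Or.inr (Or.inl (ih.tail st))
        · exact Or.inr (Or.inr (Or.inl ⟨ih.1, ih.2.tail st⟩))
        · have := hXY b (tX _ _ ih.2).2 h.1
          subst this
          exact absurd ih.2 (h1 _)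
  intro v hv
  rcases key v v hv with h | h | h | h
  · exact h1 v h
  · exact h2 v h
  · have := hXY v (tX _ _ h.1).1 (tY _ _ h.2).2
    subst this
    exact h1 _ h.1
  · have := hXY v (tX _ _ h.2).2 (tY _ _ h.1).1
    subst this
    exact h1 _ h.2

theorem color_slack {k : ℕ} (L : Finset (Fin k)) (N : Finset (ℕ × ℕ)) (f : ℕ × ℕ → Fin k)
    (h : N.card ≤ L.card) (e0 : ℕ × ℕ) (he0 : e0 ∈ N)
    (hs : f e0 ∉ L ∨ ∃ e1 ∈ N, e1 ≠ e0 ∧ f e1 = f e0) : ∃ c ∈ L, ∀ e ∈ N, f e ≠ c := by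
  have hlt : (N.erase e0).card < L.card := by
    have := Finset.card_erase_lt_of_mem he0; omega
  obtain ⟨c, hc, h1⟩ := exists_color L _ f hlt
  refine ⟨c, hc, fun e he => ?_⟩
  by_cases hee : e = e0
  · subst hee
    rcases hs with hs | ⟨e1, h2, h3, h4⟩
    · intro h'; exact hs (h' ▸ hc)
    · rw [← h4]; exact h1 e1 (Finset.mem_erase.2 ⟨h3, h2⟩)
  · exact h1 e (Finset.mem_erase.2 ⟨hee, he⟩)

theorem greedyFull {k : ℕ} {H : Finset (ℕ × ℕ)} (hloop : ∀ e ∈ H, e.1 ≠ e.2) {U : Finset ℕ} (hU : Conn H U)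
    {u : ℕ} (hu : u ∈ U) {L : ℕ → Finset (Fin k)}
    (hdeg : ∀ w ∈ U, w ≠ u → ideg H w ≤ (L w).card ∧ odeg H w ≤ (L w).card)
    (φ : ℕ → Fin k) (hφ : Col (away H U) φ)
    (hs : ∀ φ' : ℕ → Fin k, (∀ v, v ∉ U → φ' v = φ v) →
      ∃ c ∈ L u, (∀ a, (a, u) ∈ H → φ' a ≠ c) ∨ (∀ b, (u, b) ∈ H → φ' b ≠ c)) :
    ∃ φ' : ℕ → Fin k, (∀ v, v ∉ U → φ' v = φ v) ∧ (∀ w ∈ U, φ' w ∈ L w) ∧ Col H φ' := by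
  classical
  have hB : Built (fun a b => (a, b) ∈ H ∨ (b, a) ∈ H) u U := by
    refine built_of_conn hu ?_
    intro X hX huX hne
    obtain ⟨e, he, h⟩ := hU X hX ⟨u, huX⟩ hne
    rcases h with ⟨h1, h2⟩ | ⟨h1, h2⟩ <;> rw [Finset.mem_sdiff] at h2
    · exact ⟨_, h1, _, h2.1, h2.2, Or.inl he⟩
    · exact ⟨_, h1, _, h2.1, h2.2, Or.inr he⟩
  obtain ⟨φ', h1, h2, h3⟩ := greedy hloop (L := L) hB (by
    intro w hw hwu w' hw' hR
    have := hdeg w hw hwu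
    rcases hR with hR | hR
    · exact Or.inl ⟨hR, this.1⟩
    · exact Or.inr ⟨hR, this.2⟩) φ hφ
  obtain ⟨c, hc, hc2⟩ := hs φ' h1
  refine ⟨Function.update φ' u c, ?_, ?_, extend_one (fun h => hloop _ h rfl) h3 hc2⟩
  · intro v hv
    have hvu : v ≠ u := fun h' => hv (h' ▸ hu)
    rw [Function.update_of_ne hvu, h1 v hv]
  · intro w hw
    by_cases hwu : w = u
    · subst hwu; simpa using hc
    · rw [Function.update_of_ne hwu]; exact h2 w hw hwu

/-- greedy with slack at the last vertex -/
theorem greedySlack {k : ℕ} {H : Finset (ℕ × ℕ)} (hloop : ∀ e ∈ H, e.1 ≠ e.2) {U : Finset ℕ} (hU : Conn H U)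
    (hHU : ∀ e ∈ H, e.1 ∈ U ∧ e.2 ∈ U)
    {u : ℕ} (hu : u ∈ U) {L : ℕ → Finset (Fin k)}
    (hdeg : ∀ w ∈ U, w ≠ u → ideg H w ≤ (L w).card ∧ odeg H w ≤ (L w).card)
    (hs : ideg H u < (L u).card ∨ odeg H u < (L u).card) :
    ∃ φ' : ℕ → Fin k, (∀ w ∈ U, φ' w ∈ L w) ∧ Col H φ' := by
  have hc0 : ∃ c : Fin k, c ∈ L u := Finset.card_pos.1 (by omega)
  obtain ⟨c0, -⟩ := hc0
  obtain ⟨φ', -, h1, h2⟩ := greedyFull hloop hU hu (L := L) hdeg (fun _ => c0) (by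
    intro v hv
    obtain ⟨w, hw, -⟩ := TransGen.head'_iff.1 hv
    have := mem_away.1 hw.1
    exact this.2.1 (hHU _ this.1).1) (by
    intro φ' _
    rcases hs with hs | hs
    · obtain ⟨c, hc, hc2⟩ := exists_color _ _ (fun e => φ' e.1) hs
      exact ⟨c, hc, Or.inl fun a ha => hc2 (a, u) (by simp [ha])⟩
    · obtain ⟨c, hc, hc2⟩ := exists_color _ _ (fun e => φ' e.2) hs
      exact ⟨c, hc, Or.inr fun a ha => hc2 (u, a) (by simp [ha])⟩)
  exact ⟨φ', h1, h2⟩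

theorem odeg_mono {A B : Finset (ℕ × ℕ)} (h : A ⊆ B) (v : ℕ) : odeg A v ≤ odeg B v :=
  Finset.card_le_card (Finset.filter_subset_filter _ h)
theorem ideg_mono {A B : Finset (ℕ × ℕ)} (h : A ⊆ B) (v : ℕ) : ideg A v ≤ ideg B v :=
  Finset.card_le_card (Finset.filter_subset_filter _ h)
theorem odeg_lt {A B : Finset (ℕ × ℕ)} (h : A ⊆ B) {v w : ℕ} (h1 : (v, w) ∈ B) (h2 : (v, w) ∉ A) :
    odeg A v < odeg B v := by
  apply Finset.card_lt_card
  refine ⟨Finset.filter_subset_filter _ h, fun hs => ?_⟩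
  have := hs (show (v, w) ∈ _ by simp [h1])
  exact h2 (Finset.mem_filter.1 this).1
theorem ideg_lt {A B : Finset (ℕ × ℕ)} (h : A ⊆ B) {v w : ℕ} (h1 : (w, v) ∈ B) (h2 : (w, v) ∉ A) :
    ideg A v < ideg B v := by
  apply Finset.card_lt_card
  refine ⟨Finset.filter_subset_filter _ h, fun hs => ?_⟩
  have := hs (show (w, v) ∈ _ by simp [h1])
  exact h2 (Finset.mem_filter.1 this).1
theorem ind_mono (A : Finset (ℕ × ℕ)) {X Y : Finset ℕ} (h : X ⊆ Y) : ind A X ⊆ ind A Y := by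
  intro e he
  rw [mem_ind] at he ⊢
  exact ⟨he.1, h he.2.1, h he.2.2⟩
theorem ind_sub (A : Finset (ℕ × ℕ)) (X : Finset ℕ) : ind A X ⊆ A := Finset.filter_subset _ _

theorem Conn.ind {A : Finset (ℕ × ℕ)} {U X : Finset ℕ} (h : Conn A U) (hX : U ⊆ X) : Conn (ind A X) U := by
  intro C hC h1 h2
  obtain ⟨e, he, h'⟩ := h C hC h1 h2
  refine ⟨e, mem_ind.2 ⟨he, ?_⟩, h'⟩
  rcases h' with ⟨a, b⟩ | ⟨a, b⟩
  · exact ⟨hX (hC a), hX (Finset.mem_sdiff.1 b).1⟩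
  · exact ⟨hX (Finset.mem_sdiff.1 b).1, hX (hC a)⟩

namespace Hub
variable {k : ℕ} {V : Finset ℕ} {A : Finset (ℕ × ℕ)} {x : ℕ}

theorem conn (g : Hub k V A x) : Conn A (V.erase x) := g.ext.bic x g.hx

theorem odH (g : Hub k V A x) (c0 : Fin k) {y : ℕ} (hy : y ∈ V.erase x) :
    odeg (ind A (V.erase x)) y = (Lx A x c0 y).card := by
  have h0 := Finset.mem_erase.1 hy
  have h1 := odeg_split A hy
  have h2 := Lx_card A x c0 y
  have h3 := g.od y h0.2 h0.1
  have : (A.filter fun e => e.1 = y ∧ e.2 ∉ V.erase x).card = (if (x, y) ∈ A then 1 else 0) := by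
    split_ifs with hc
    · rw [Finset.card_eq_one]
      refine ⟨(y, x), ?_⟩
      ext e
      simp only [Finset.mem_filter, Finset.mem_singleton, Finset.mem_erase]
      constructor
      · rintro ⟨a, b, c⟩
        have := g.ext.wf e a
        exact Prod.ext b (by simp only; tauto)
      · rintro rfl
        exact ⟨(g.sym y).1 hc, rfl, by simp⟩
    · rw [Finset.card_eq_zero]
      ext e
      simp only [Finset.mem_filter, Finset.mem_erase, Finset.notMem_empty, iff_false]
      rintro ⟨a, b, c⟩
      have := g.ext.wf e a
      have he2 : e.2 = x := by tauto
      refine hc ((g.sym y).2 ?_)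
      rw [← b, ← he2]; exact a
  omega

theorem idH (g : Hub k V A x) (c0 : Fin k) {y : ℕ} (hy : y ∈ V.erase x) :
    ideg (ind A (V.erase x)) y = (Lx A x c0 y).card := by
  have h0 := Finset.mem_erase.1 hy
  have h1 := ideg_split A hy
  have h2 := Lx_card A x c0 y
  have h3 := g.id y h0.2 h0.1
  have : (A.filter fun e => e.2 = y ∧ e.1 ∉ V.erase x).card = (if (x, y) ∈ A then 1 else 0) := by
    split_ifs with hc
    · rw [Finset.card_eq_one]
      refine ⟨(x, y), ?_⟩
      ext e
      simp only [Finset.mem_filter, Finset.mem_singleton, Finset.mem_erase]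
      constructor
      · rintro ⟨a, b, c⟩
        have := g.ext.wf e a
        exact Prod.ext (by simp only; tauto) b
      · rintro rfl
        exact ⟨hc, rfl, by simp⟩
    · rw [Finset.card_eq_zero]
      ext e
      simp only [Finset.mem_filter, Finset.mem_erase, Finset.notMem_empty, iff_false]
      rintro ⟨a, b, c⟩
      have := g.ext.wf e a
      have he2 : e.1 = x := by tauto
      refine hc ?_
      rw [← b, ← he2]; exact a
  omega

theorem loopH (g : Hub k V A x) (X : Finset ℕ) : ∀ e ∈ ind A X, e.1 ≠ e.2 :=
  fun e he => g.ext.loop e (mem_ind.1 he).1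

theorem eulerH (g : Hub k V A x) (c0 : Fin k) (v : ℕ) : odeg (ind A (V.erase x)) v = ideg (ind A (V.erase x)) v := by
  by_cases hv : v ∈ V.erase x
  · rw [g.odH c0 hv, g.idH c0 hv]
  · have h1 : odeg (ind A (V.erase x)) v = 0 := by
      unfold odeg; rw [Finset.card_eq_zero, Finset.filter_eq_empty_iff]
      rintro e he rfl
      exact hv (mem_ind.1 he).2.1
    have h2 : ideg (ind A (V.erase x)) v = 0 := by
      unfold ideg; rw [Finset.card_eq_zero, Finset.filter_eq_empty_iff]
      rintro e he rfl
      exact hv (mem_ind.1 he).2.2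
    rw [h1, h2]

/-- L8a -/
theorem noMixed (g : Hub k V A x) (c0 : Fin k) {y y' : ℕ} (hy : y ∈ V.erase x) (hy' : y' ∈ V.erase x)
    (hyN : (x, y) ∈ A) (hyN' : (x, y') ∉ A) (hadj : (y, y') ∈ A ∨ (y', y) ∈ A)
    (hc : Conn A ((V.erase x).erase y')) : False := by
  classical
  have hne : y ≠ y' := fun h => hyN' (h ▸ hyN)
  set H := ind A (V.erase x) with hH
  have hc' : Conn H ((V.erase x).erase y') := hc.ind (Finset.erase_subset _ _)
  obtain ⟨φ, h1, h2, h3⟩ := greedyFull (g.loopH _) hc' (u := y) (Finset.mem_erase.2 ⟨hne, hy⟩) (L := Lx A x c0)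
    (fun w hw _ => ⟨(g.idH c0 (Finset.mem_of_mem_erase hw)).le, (g.odH c0 (Finset.mem_of_mem_erase hw)).le⟩)
    (fun _ => c0) (by
      intro v hv
      obtain ⟨w, hw, -⟩ := TransGen.head'_iff.1 hv
      have h4 := mem_away.1 hw.1
      have h5 := mem_ind.1 h4.1
      simp only [Finset.mem_erase] at h4 h5
      have h6 := g.ext.loop _ h5.1
      simp only at h6
      apply h6
      have : v = y' := by tauto
      have : w = y' := by tauto
      simp_all) (by
      intro φ' hφ'
      have hc0 : φ' y' = c0 := hφ' y' (by simp)
      have hn : φ' y' ∉ Lx A x c0 y := by rw [hc0, mem_Lx]; simp [hyN]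
      rcases hadj with ha | ha
      · obtain ⟨c, hcL, h4⟩ := color_slack (Lx A x c0 y) (H.filter fun e => e.1 = y) (fun e => φ' e.2)
          (g.odH c0 hy).le (y, y') (Finset.mem_filter.2 ⟨mem_ind.2 ⟨ha, hy, hy'⟩, rfl⟩) (Or.inl hn)
        exact ⟨c, hcL, Or.inr fun b hb => h4 (y, b) (Finset.mem_filter.2 ⟨hb, rfl⟩)⟩
      · obtain ⟨c, hcL, h4⟩ := color_slack (Lx A x c0 y) (H.filter fun e => e.2 = y) (fun e => φ' e.1)
          (g.idH c0 hy).le (y', y) (Finset.mem_filter.2 ⟨mem_ind.2 ⟨ha, hy', hy⟩, rfl⟩) (Or.inl hn)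
        exact ⟨c, hcL, Or.inl fun b hb => h4 (b, y) (Finset.mem_filter.2 ⟨hb, rfl⟩)⟩)
  refine g.ext.nLC c0 (x := x) ⟨φ, ?_, h3⟩
  intro w hw
  by_cases hwy : w = y'
  · subst hwy; rw [mem_Lx]; intro h; exact absurd h hyN'
  · exact h2 w (Finset.mem_erase.2 ⟨hwy, hw⟩)

end Hub
end Ex

set_option linter.all false
namespace Ex
open Relation

def nb (A : Finset (ℕ × ℕ)) (a b : ℕ) : Prop := (a, b) ∈ A ∨ (b, a) ∈ A
theorem nb.symm {A a b} (h : nb A a b) : nb A b a := Or.symm h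

theorem conn_iff {A : Finset (ℕ × ℕ)} {X : Finset ℕ} :
    Conn A X ↔ ∀ C ⊆ X, C.Nonempty → C ≠ X → ∃ c ∈ C, ∃ d ∈ X, d ∉ C ∧ nb A c d := by
  constructor
  · intro h C hC h1 h2
    obtain ⟨e, he, ⟨a, b⟩ | ⟨a, b⟩⟩ := h C hC h1 h2 <;> rw [Finset.mem_sdiff] at b
    · exact ⟨_, a, _, b.1, b.2, Or.inl he⟩
    · exact ⟨_, a, _, b.1, b.2, Or.inr he⟩
  · intro h C hC h1 h2
    obtain ⟨c, hc, d, hd, hdC, h'⟩ := h C hC h1 h2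
    rcases h' with h' | h'
    · exact ⟨_, h', Or.inl ⟨hc, Finset.mem_sdiff.2 ⟨hd, hdC⟩⟩⟩
    · exact ⟨_, h', Or.inr ⟨hc, Finset.mem_sdiff.2 ⟨hd, hdC⟩⟩⟩

/-- a cut vertex `s` with a union of components `C` -/
structure CP (A : Finset (ℕ × ℕ)) (W : Finset ℕ) (s : ℕ) (C : Finset ℕ) : Prop where
  hs : s ∈ W
  hC : C ⊆ W.erase s
  ne : C.Nonempty
  nf : C ≠ W.erase s
  no : ∀ c ∈ C, ∀ d ∈ W, d ≠ s → d ∉ C → ¬ nb A c d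

theorem cp_of_not_conn {A : Finset (ℕ × ℕ)} {W : Finset ℕ} {s : ℕ} (hs : s ∈ W) (h : ¬ Conn A (W.erase s)) :
    ∃ C, CP A W s C := by
  rw [conn_iff] at h
  push Not at h
  obtain ⟨C, h1, h2, h3, h4⟩ := h
  exact ⟨C, hs, h1, h2, h3, fun c hc d hd hds hdC => h4 c hc d (Finset.mem_erase.2 ⟨hds, hd⟩) hdC⟩

theorem CP.compl {A W s C} (h : CP A W s C) : CP A W s (W.erase s \ C) := by
  refine ⟨h.hs, Finset.sdiff_subset, ?_, ?_, ?_⟩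
  · rw [Finset.sdiff_nonempty]
    intro h'; exact h.nf (Finset.Subset.antisymm h.hC h')
  · intro h'
    obtain ⟨c, hc⟩ := h.ne
    have := h.hC hc
    rw [← h'] at this
    exact (Finset.mem_sdiff.1 this).2 hc
  · intro c hc d hd hds hdC hn
    rw [Finset.mem_sdiff, Finset.mem_erase] at hc
    have : d ∈ C := by
      by_contra hcon
      exact hdC (Finset.mem_sdiff.2 ⟨Finset.mem_erase.2 ⟨hds, hd⟩, hcon⟩)
    exact h.no d this c hc.1.2 hc.1.1 hc.2 hn.symm

/-- a set with no neighbours in a connected `W` is everything -/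
theorem conn_all {A : Finset (ℕ × ℕ)} {W D : Finset ℕ} (h : Conn A W) (hD : D ⊆ W) (hne : D.Nonempty)
    (hno : ∀ c ∈ D, ∀ d ∈ W, d ∉ D → ¬ nb A c d) : D = W := by
  by_contra hcon
  obtain ⟨c, hc, d, hd, hdC, h'⟩ := conn_iff.1 h D hD hne hcon
  exact hno c hc d hd hdC h'

namespace Hub
variable {k : ℕ} {V : Finset ℕ} {A : Finset (ℕ × ℕ)} {x : ℕ}

theorem cutpair_sep (hk : 3 ≤ k) (g : Hub k V A x) (hcp : ∃ s C, CP A (V.erase x) s C) : Sep V A := by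
  classical
  have hk0 : 0 < k := by omega
  obtain ⟨c0⟩ : Nonempty (Fin k) := ⟨⟨0, hk0⟩⟩
  set W := V.erase x with hW
  have hWV : W ⊆ V := Finset.erase_subset _ _
  have hconn : Conn A W := g.conn
  -- minimal cut pair
  have hne : ((W ×ˢ W.powerset).filter (fun p => CP A W p.1 p.2)).Nonempty := by
    obtain ⟨s, C, h⟩ := hcp
    exact ⟨(s, C), by simp only [Finset.mem_filter, Finset.mem_product, Finset.mem_powerset]; exact ⟨⟨h.hs, h.hC.trans (Finset.erase_subset _ _)⟩, h⟩⟩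
  obtain ⟨⟨s, C⟩, hp, hmin⟩ := Finset.exists_min_image _ (fun p => p.2.card) hne
  simp only [Finset.mem_filter, Finset.mem_product, Finset.mem_powerset, Prod.forall] at hp hmin
  have hcp := hp.2
  have hsmall : ∀ s' C', C' ⊂ C → ¬ CP A W s' C' := by
    intro s' C' hC' h'
    have := hmin s' C' ⟨⟨h'.hs, h'.hC.trans (Finset.erase_subset _ _)⟩, h'⟩
    have := Finset.card_lt_card hC'
    omega
  have hCW : C ⊆ W := hp.1.2
  have hsW : s ∈ W := hp.1.1
  have hsC : s ∉ C := fun h => (Finset.mem_erase.1 (hcp.hC h)).1 rfl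
  have hno : ∀ c ∈ C, ∀ d ∈ W, d ∉ C → nb A c d → d = s := by
    intro c hc d hd hdC hn
    by_contra hne
    exact hcp.no c hc d hd hne hdC hn
  obtain ⟨t, ht, htC⟩ : ∃ t ∈ W.erase s, t ∉ C := by
    by_contra hcon; push Not at hcon
    exact hcp.nf (Finset.Subset.antisymm hcp.hC hcon)
  -- C connected
  have hCconn : Conn A C := by
    rw [conn_iff]
    by_contra hcon
    push Not at hcon
    obtain ⟨C', h1, h2, h3, h4⟩ := hcon
    refine hsmall s C' ⟨h1, fun h => h3 (Finset.Subset.antisymm h1 h)⟩ ⟨hsW, h1.trans hcp.hC, h2, ?_, ?_⟩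
    · rintro rfl; exact htC (h1 ht)
    · intro c hc d hd hds hdC' hn
      by_cases hdC : d ∈ C
      · exact h4 c hc d hdC hdC' hn
      · exact hds (hno c (h1 hc) d hd hdC hn)
  -- removing a vertex of C leaves H connected
  have hrem : ∀ y ∈ C, Conn A (W.erase y) := by
    intro y hy
    by_contra hcon
    obtain ⟨D0, hD0⟩ := cp_of_not_conn (hCW hy) hcon
    have hsy : s ≠ y := fun h => hsC (h ▸ hy)
    obtain ⟨D, hD, hsD⟩ : ∃ D, CP A W y D ∧ s ∉ D := by
      by_cases hs : s ∈ D0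
      · exact ⟨_, hD0.compl, fun h => (Finset.mem_sdiff.1 h).2 hs⟩
      · exact ⟨_, hD0, hs⟩
    have hyD : y ∉ D := fun h => (Finset.mem_erase.1 (hD.hC h)).1 rfl
    have hDC : D ⊆ C := by
      by_contra hcon
      have hne : (D \ C).Nonempty := Finset.sdiff_nonempty.2 hcon
      have hDW : D \ C ⊆ W := fun v hv => Finset.mem_of_mem_erase (hD.hC (Finset.mem_sdiff.1 hv).1)
      have := conn_all hconn hDW hne (by
        intro c hc d hd hdD hn
        have hcW := hDW hc
        rw [Finset.mem_sdiff] at hc hdD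
        have hcs : c ≠ s := fun h => hsD (h ▸ hc.1)
        by_cases hdC : d ∈ C
        · exact hcs (hno d hdC c hcW hc.2 hn.symm)
        · have hdy : d ≠ y := fun h => hdC (h ▸ hy)
          exact hD.no c hc.1 d hd hdy (fun h => hdD ⟨h, hdC⟩) hn)
      rw [← this] at hsW
      exact hsD (Finset.mem_sdiff.1 hsW).1
    exact hsmall y D ⟨hDC, fun h => hyD (h hy)⟩ hD
  -- C ∩ N nonempty
  have hxC : x ∉ C := fun h => (Finset.mem_erase.1 (hCW h)).1 rfl
  obtain ⟨n, hnC, hnN⟩ : ∃ n ∈ C, (x, n) ∈ A := by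
    obtain ⟨c, hc, d, hd, hdC, hn⟩ := conn_iff.1 (g.ext.bic s (hWV hsW)) C
      (fun v hv => Finset.mem_erase.2 ⟨fun h => hsC (h ▸ hv), hWV (hCW hv)⟩) hcp.ne
      (fun h => hxC (by rw [h]; exact Finset.mem_erase.2 ⟨fun h' => (Finset.mem_erase.1 hsW).1 h'.symm, g.hx⟩))
    rw [Finset.mem_erase] at hd
    have hdx : d = x := by
      by_contra hne
      exact hd.1 (hno c hc d (Finset.mem_erase.2 ⟨hne, hd.2⟩) hdC hn)
    subst hdx
    rcases hn with h | h
    · exact ⟨c, hc, (g.sym c).2 h⟩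
    · exact ⟨c, hc, h⟩
  have hCN : ∀ c ∈ C, (x, c) ∈ A := by
    by_contra hcon
    push Not at hcon
    obtain ⟨m, hm, hmN⟩ := hcon
    obtain ⟨c, hc, d, hd, hdC, hn⟩ := conn_iff.1 hCconn (C.filter fun c => (x, c) ∈ A) (Finset.filter_subset _ _)
      ⟨n, by simp [hnC, hnN]⟩ (fun h => by rw [← h] at hm; exact hmN (Finset.mem_filter.1 hm).2)
    rw [Finset.mem_filter] at hc hdC
    exact g.noMixed c0 (hCW hc.1) (hCW hd) hc.2 (fun h => hdC ⟨hd, h⟩) hn (hrem d hd)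
  -- neighbour of s in C
  obtain ⟨p, hpC, hps⟩ : ∃ p ∈ C, nb A p s := by
    obtain ⟨c, hc, d, hd, hdC, hn⟩ := conn_iff.1 hconn C hCW hcp.ne (fun h => hsC (h ▸ hsW))
    exact ⟨c, hc, hno c hc d hd hdC hn ▸ hn⟩
  have hLC : ∀ c ∈ C, Lx A x c0 c = Finset.univ.erase c0 := fun c hc => by simp [Lx, hCN c hc]
  have hL1 : (Finset.univ.erase c0 : Finset (Fin k)).card = k - 1 := by
    rw [Finset.card_erase_of_mem (Finset.mem_univ _)]; simp
  set B := insert s C with hB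
  have hBW : B ⊆ W := Finset.insert_subset hsW hCW
  -- the main degree claim
  have main : k - 1 ≤ ideg (ind A B) s ∧ k - 1 ≤ odeg (ind A B) s := by
    by_contra hcon
    rw [not_and_or, not_le, not_le] at hcon
    set U := W \ C with hU
    have hUW : U ⊆ W := Finset.sdiff_subset
    have hsU : s ∈ U := Finset.mem_sdiff.2 ⟨hsW, hsC⟩
    have hUconn : Conn A U := by
      have one : ∀ D ⊆ U, D.Nonempty → s ∉ D → ∃ c ∈ D, ∃ d ∈ U, d ∉ D ∧ nb A c d := by
        intro D hD hne hsD
        by_contra hcon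
        push Not at hcon
        have := conn_all hconn (hD.trans hUW) hne (by
          intro c hc d hd hdD hn
          have hcU := Finset.mem_sdiff.1 (hD hc)
          by_cases hdC : d ∈ C
          · exact hsD (hno d hdC c hcU.1 hcU.2 hn.symm ▸ hc)
          · exact hcon c hc d (Finset.mem_sdiff.2 ⟨hd, hdC⟩) hdD hn)
        exact hsD (this ▸ hsW)
      rw [conn_iff]
      intro D hD hne hDU
      by_cases hsD : s ∈ D
      · obtain ⟨c, hc, d, hd, hdD, hn⟩ := one (U \ D) Finset.sdiff_subset
          (Finset.sdiff_nonempty.2 fun h => hDU (Finset.Subset.antisymm hD h)) (fun h => (Finset.mem_sdiff.1 h).2 hsD)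
        rw [Finset.mem_sdiff] at hc hdD
        exact ⟨d, by tauto, c, hc.1, hc.2, hn.symm⟩
      · exact one D hD hne hsD
    have hpU : p ∉ U := fun h => (Finset.mem_sdiff.1 h).2 hpC
    have hslackU : ideg (ind A U) s < (Lx A x c0 s).card ∨ odeg (ind A U) s < (Lx A x c0 s).card := by
      rcases hps with h | h
      · left
        rw [← g.idH c0 hsW]
        exact ideg_lt (ind_mono A hUW) (w := p) (mem_ind.2 ⟨h, hCW hpC, hsW⟩) (fun h => hpU (mem_ind.1 h).2.1)
      · right
        rw [← g.odH c0 hsW]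
        exact odeg_lt (ind_mono A hUW) (w := p) (mem_ind.2 ⟨h, hsW, hCW hpC⟩) (fun h => hpU (mem_ind.1 h).2.2)
    obtain ⟨φ1, h1L, h1C⟩ := greedySlack (g.loopH U) (hUconn.ind (Finset.Subset.refl _))
      (fun e he => (mem_ind.1 he).2) hsU (L := Lx A x c0) (fun w hw _ =>
        ⟨(ideg_mono (ind_mono A hUW) w).trans (g.idH c0 (hUW hw)).le,
         (odeg_mono (ind_mono A hUW) w).trans (g.odH c0 (hUW hw)).le⟩) hslackU
    by_cases hc : φ1 s = c0
    · have hslackC : ideg (ind A C) p < (Lx A x c0 p).card ∨ odeg (ind A C) p < (Lx A x c0 p).card := by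
        rcases hps with h | h
        · right
          rw [← g.odH c0 (hCW hpC)]
          exact odeg_lt (ind_mono A hCW) (w := s) (mem_ind.2 ⟨h, hCW hpC, hsW⟩) (fun h => hsC (mem_ind.1 h).2.2)
        · left
          rw [← g.idH c0 (hCW hpC)]
          exact ideg_lt (ind_mono A hCW) (w := s) (mem_ind.2 ⟨h, hsW, hCW hpC⟩) (fun h => hsC (mem_ind.1 h).2.1)
      obtain ⟨φ2, h2L, h2C⟩ := greedySlack (g.loopH C) (hCconn.ind (Finset.Subset.refl _))
        (fun e he => (mem_ind.1 he).2) hpC (L := Lx A x c0) (fun w hw _ =>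
          ⟨(ideg_mono (ind_mono A hCW) w).trans (g.idH c0 (hCW hw)).le,
           (odeg_mono (ind_mono A hCW) w).trans (g.odH c0 (hCW hw)).le⟩) hslackC
      refine g.ext.nLC c0 (x := x) ⟨fun v => if v ∈ C then φ2 v else φ1 v, ?_, ?_⟩
      · intro y hy
        by_cases hyC : y ∈ C
        · simp only [hyC, if_true]; exact h2L y hyC
        · simp only [hyC, if_false]; exact h1L y (Finset.mem_sdiff.2 ⟨hy, hyC⟩)
      · apply glue_col
        · refine h2C.subset ?_
          intro e he; rw [mem_ind, mem_ind] at he; exact mem_ind.2 ⟨he.1.1, he.2⟩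
        · refine h1C.subset ?_
          intro e he; rw [mem_away, mem_ind] at he
          exact mem_ind.2 ⟨he.1.1, Finset.mem_sdiff.2 ⟨he.1.2.1, he.2.1⟩, Finset.mem_sdiff.2 ⟨he.1.2.2, he.2.2⟩⟩
        · intro e he
          rw [mem_cut, mem_ind] at he
          have := hno e.1 he.2.1 e.2 he.1.2.2 he.2.2 (Or.inl he.1.1)
          rw [this, hc]
          exact mem_Lx.1 (h2L _ he.2.1) (hCN _ he.2.1)
    · have hBconn : Conn A B := by
        rw [conn_iff]
        have one : ∀ D ⊆ B, D.Nonempty → s ∉ D → ∃ c ∈ D, ∃ d ∈ B, d ∉ D ∧ nb A c d := by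
          intro D hD hne hsD
          have hDC : D ⊆ C := fun v hv => (Finset.mem_insert.1 (hD hv)).resolve_left (fun h => hsD (h ▸ hv))
          by_cases hDe : D = C
          · exact ⟨p, hDe ▸ hpC, s, Finset.mem_insert_self _ _, hsD, hps⟩
          · obtain ⟨c, hc, d, hd, h'⟩ := conn_iff.1 hCconn D hDC hne hDe
            exact ⟨c, hc, d, Finset.mem_insert_of_mem hd, h'⟩
        intro D hD hne hDU
        by_cases hsD : s ∈ D
        · obtain ⟨c, hc, d, hd, hdD, hn⟩ := one (B \ D) Finset.sdiff_subset
            (Finset.sdiff_nonempty.2 fun h => hDU (Finset.Subset.antisymm hD h)) (fun h => (Finset.mem_sdiff.1 h).2 hsD)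
          rw [Finset.mem_sdiff] at hc hdD
          exact ⟨d, by tauto, c, hc.1, hc.2, hn.symm⟩
        · exact one D hD hne hsD
      obtain ⟨φ0, h2L, h2C⟩ := greedySlack (g.loopH B) (hBconn.ind (Finset.Subset.refl _))
        (fun e he => (mem_ind.1 he).2) (Finset.mem_insert_self s C) (L := fun _ => Finset.univ.erase c0) (fun w hw hws => by
          have hwC : w ∈ C := (Finset.mem_insert.1 hw).resolve_left hws
          rw [← hLC w hwC]
          exact ⟨(ideg_mono (ind_mono A hBW) w).trans (g.idH c0 (hCW hwC)).le,
           (odeg_mono (ind_mono A hBW) w).trans (g.odH c0 (hCW hwC)).le⟩) (by rw [hL1]; exact hcon)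
      set σ := Equiv.swap (φ0 s) (φ1 s) with hσ
      have hσ0 : ∀ c, c ≠ c0 → σ c ≠ c0 := by
        intro c hcc h'
        have hs0 : φ0 s ≠ c0 := (Finset.mem_erase.1 (h2L s (Finset.mem_insert_self _ _))).1
        have : σ c0 = c0 := by
          rw [hσ]; exact Equiv.swap_apply_of_ne_of_ne (Ne.symm hs0) (Ne.symm hc)
        exact hcc (σ.injective (h'.trans this.symm))
      have h2C' := h2C.comp_inj σ σ.injective
      set φ2 := σ ∘ φ0 with hφ2
      have h2s : φ2 s = φ1 s := by simp [hφ2, hσ]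
      have h2L' : ∀ w ∈ B, φ2 w ≠ c0 := fun w hw => hσ0 _ (Finset.mem_erase.1 (h2L w hw)).1
      set θ : ℕ → Fin k := fun v => if v ∈ C then φ2 v else φ1 v with hθ
      have hθU : ∀ v, v ∈ U → θ v = φ1 v := fun v hv => by simp [hθ, (Finset.mem_sdiff.1 hv).2]
      have hθB : ∀ v, v ∈ B → θ v = φ2 v := by
        intro v hv
        rcases Finset.mem_insert.1 hv with rfl | hv
        · simp [hθ, hsC, h2s]
        · simp [hθ, hv]
      refine g.ext.nLC c0 (x := x) ⟨θ, ?_, ?_⟩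
      · intro y hy
        by_cases hyC : y ∈ C
        · rw [hθB y (Finset.mem_insert_of_mem hyC), hLC y hyC]
          simp [h2L' y (Finset.mem_insert_of_mem hyC)]
        · have hyU : y ∈ U := Finset.mem_sdiff.2 ⟨hy, hyC⟩
          rw [hθU y hyU]; exact h1L y hyU
      · refine glue_vertex (fun v => v ∈ U) (fun v => v ∈ B) s ?_ ?_ ?_ ?_
        · intro v h1 h2
          exact (Finset.mem_insert.1 h2).resolve_right (Finset.mem_sdiff.1 h1).2
        · intro a b hab
          have hab' := mem_ind.1 hab.1
          by_cases ha : a ∈ C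
          · right
            refine ⟨Finset.mem_insert_of_mem ha, ?_⟩
            by_cases hb : b ∈ C
            · exact Finset.mem_insert_of_mem hb
            · rw [hno a ha b hab'.2.2 hb (Or.inl hab'.1)]; exact Finset.mem_insert_self _ _
          · by_cases hb : b ∈ C
            · right
              refine ⟨?_, Finset.mem_insert_of_mem hb⟩
              rw [hno b hb a hab'.2.1 ha (Or.inr hab'.1)]; exact Finset.mem_insert_self _ _
            · left
              exact ⟨Finset.mem_sdiff.2 ⟨hab'.2.1, ha⟩, Finset.mem_sdiff.2 ⟨hab'.2.2, hb⟩⟩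
        · refine acyc_mono ?_ h1C
          rintro a b ⟨⟨h1, h2⟩, ha, hb⟩
          rw [hθU a ha, hθU b hb] at h2
          exact ⟨mem_ind.2 ⟨(mem_ind.1 h1).1, ha, hb⟩, h2⟩
        · refine acyc_mono ?_ h2C'
          rintro a b ⟨⟨h1, h2⟩, ha, hb⟩
          rw [hθB a ha, hθB b hb] at h2
          exact ⟨mem_ind.2 ⟨(mem_ind.1 h1).1, ha, hb⟩, h2⟩
  -- conclusion
  have hdo := odeg_split (ind A W) (S := B) (y := s) (Finset.mem_insert_self _ _)
  have hdi := ideg_split (ind A W) (S := B) (y := s) (Finset.mem_insert_self _ _)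
  have hii : ind (ind A W) B = ind A B := by
    ext e; simp only [mem_ind]
    have h1 := @hBW e.1; have h2 := @hBW e.2; tauto
  rw [hii, g.odH c0 hsW] at hdo
  rw [hii, g.idH c0 hsW] at hdi
  have hLs := Lx_card A x c0 s
  have h1o : ((ind A W).filter fun e => e.1 = s ∧ e.2 ∉ B).card ≤ 1 := by omega
  have h1i : ((ind A W).filter fun e => e.2 = s ∧ e.1 ∉ B).card ≤ 1 := by omega
  have only : ∀ a b, a ∈ B → b ∈ W \ B → nb A a b → a = s := by
    intro a b ha hb hn
    rw [Finset.mem_sdiff] at hb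
    by_contra hne
    have haC : a ∈ C := (Finset.mem_insert.1 ha).resolve_left hne
    have := hno a haC b hb.1 (fun h => hb.2 (Finset.mem_insert_of_mem h)) hn
    exact hb.2 (this ▸ Finset.mem_insert_self _ _)
  refine ⟨x, B, W \ B, g.hx, ⟨s, Finset.mem_insert_self _ _⟩, ⟨t, ?_⟩, Finset.disjoint_sdiff, ?_, ?_, ?_⟩
  · rw [Finset.mem_erase] at ht
    simp only [Finset.mem_sdiff, hB, Finset.mem_insert]
    tauto
  · exact Finset.union_sdiff_of_subset hBW
  · intro e he e' he' h1 h2 h3 h4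
    have hm : ∀ e ∈ A, e.1 ∈ B → e.2 ∈ W \ B → e ∈ (ind A W).filter fun e => e.1 = s ∧ e.2 ∉ B := by
      intro e he h1 h2
      have h3 := only _ _ h1 h2 (Or.inl he)
      rw [Finset.mem_sdiff] at h2
      exact Finset.mem_filter.2 ⟨mem_ind.2 ⟨he, hBW h1, h2.1⟩, h3, h2.2⟩
    exact Finset.card_le_one.1 h1o _ (hm e he h1 h2) _ (hm e' he' h3 h4)
  · intro e he e' he' h1 h2 h3 h4
    have hm : ∀ e ∈ A, e.1 ∈ W \ B → e.2 ∈ B → e ∈ (ind A W).filter fun e => e.2 = s ∧ e.1 ∉ B := by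
      intro e he h1 h2
      have h3 := only _ _ h2 h1 (Or.inr he)
      rw [Finset.mem_sdiff] at h1
      exact Finset.mem_filter.2 ⟨mem_ind.2 ⟨he, h1.1, hBW h2⟩, h3, h1.2⟩
    exact Finset.card_le_one.1 h1i _ (hm e he h1 h2) _ (hm e' he' h3 h4)

end Hub
end Ex

set_option linter.all false
namespace Ex
open Relation

theorem Hub.noCP {k V A x} (hk : 3 ≤ k) (g : Hub k V A x) (hS : ¬ Sep V A) {s : ℕ} (hs : s ∈ V.erase x) :
    Conn A ((V.erase x).erase s) := by
  by_contra hc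
  obtain ⟨C, hC⟩ := cp_of_not_conn hs hc
  exact hS (g.cutpair_sep hk ⟨s, C, hC⟩)

theorem Hub.full {k V A x} (hk : 3 ≤ k) (g : Hub k V A x) (hS : ¬ Sep V A) :
    ∀ y ∈ V.erase x, (x, y) ∈ A ∧ (y, x) ∈ A := by
  have key : (V.erase x).filter (fun y => (x, y) ∈ A) = V.erase x := by
    by_contra hne
    have hxs := g.ext.strong {x} (by simpa using g.hx) (by simp)
      (fun h' => g.ext.ne_single (by omega) x h'.symm)
    obtain ⟨e, he⟩ := hxs
    rw [mem_cut] at he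
    simp only [Finset.mem_singleton] at he
    obtain ⟨he1, he2, he3⟩ := he
    have hex : (x, e.2) ∈ A := by rw [← he2]; exact he1
    obtain ⟨c, hc, d, hd, hdN, hcd⟩ := conn_iff.1 g.conn _ (Finset.filter_subset _ _)
      ⟨e.2, by simp [he3, (g.ext.wf e he1).2.1, hex]⟩ hne
    rw [Finset.mem_filter] at hc
    have hdN' : (x, d) ∉ A := fun h' => hdN (Finset.mem_filter.2 ⟨hd, h'⟩)
    exact g.noMixed ⟨0, by omega⟩ hc.1 hd hc.2 hdN' hcd (g.noCP hk hS hd)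
  intro y hy
  have : (x, y) ∈ A := by
    rw [← key] at hy; exact (Finset.mem_filter.1 hy).2
  exact ⟨this, (g.sym y).1 this⟩

theorem Hub.degs {m V A x} (hm : 2 ≤ m) (g : Hub (m+1) V A x) (hS : ¬ Sep V A) {y} (hy : y ∈ V.erase x) :
    odeg (ind A (V.erase x)) y = m ∧ ideg (ind A (V.erase x)) y = m := by
  have h := Lx_card A x (⟨0, by omega⟩ : Fin (m+1)) y
  rw [if_pos (g.full (by omega) hS y hy).1] at h
  rw [g.odH ⟨0, by omega⟩ hy, g.idH ⟨0, by omega⟩ hy]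
  omega

theorem Hub.extH {m V A x} (hm : 2 ≤ m) (g : Hub (m+1) V A x) (hS : ¬ Sep V A) :
    Ext m (V.erase x) (ind A (V.erase x)) := by
  have wf : ∀ e ∈ ind A (V.erase x), e.1 ∈ V.erase x ∧ e.2 ∈ V.erase x ∧ e.1 ≠ e.2 := by
    intro e he
    rw [mem_ind] at he
    exact ⟨he.2.1, he.2.2, g.ext.loop e he.1⟩
  have hwf : ∀ e ∈ ind A (V.erase x), e.1 ∈ V.erase x ∧ e.2 ∈ V.erase x := fun e he => ⟨(wf e he).1, (wf e he).2.1⟩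
  refine ⟨wf, ?_, ?_, ?_, ?_⟩
  · intro X hX h1 h2
    obtain ⟨e, he, h⟩ := g.conn X hX h1 h2
    have hcc := cut_compl_eq hwf (g.eulerH ⟨0, by omega⟩) X
    rcases h with ⟨a, b⟩ | ⟨a, b⟩
    · rw [Finset.mem_sdiff] at b
      exact ⟨e, mem_cut.2 ⟨mem_ind.2 ⟨he, hX a, b.1⟩, a, b.2⟩⟩
    · rw [← Finset.card_pos, ← hcc, Finset.card_pos]
      refine ⟨e, mem_cut.2 ⟨mem_ind.2 ⟨he, (Finset.mem_sdiff.1 b).1, hX a⟩, b, ?_⟩⟩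
      simp [a]
  · intro s hs
    exact (g.noCP (by omega) hS hs).ind (Finset.erase_subset _ _)
  · rintro ⟨φ, hφ⟩
    apply g.ext.nLC (x := x) (Fin.last m)
    refine ⟨Fin.castSucc ∘ φ, ?_, hφ.comp_inj _ (Fin.castSucc_injective m)⟩
    intro y hy
    rw [mem_Lx]
    intro _
    exact (Fin.castSucc_lt_last _).ne
  · intro u hu v hv huv
    rw [Finset.mem_erase] at hu hv
    obtain ⟨Y, hY, huY, hvY, hc⟩ := g.ext.sep u hu.2 v hv.2 huv
    have hfu := g.full (by omega) hS u (by simp [hu])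
    have hfv := g.full (by omega) hS v (by simp [hv])
    refine ⟨Y.erase x, Finset.erase_subset_erase _ hY, by simp [hu.1, huY], by simp [hvY], ?_⟩
    have : ∃ f ∈ cut A Y, f.1 = x ∨ f.2 = x := by
      by_cases hx : x ∈ Y
      · exact ⟨(x, v), mem_cut.2 ⟨hfv.1, hx, hvY⟩, Or.inl rfl⟩
      · exact ⟨(u, x), mem_cut.2 ⟨hfu.2, huY, hx⟩, Or.inr rfl⟩
    obtain ⟨f, hf, hfx⟩ := this
    have hsub : cut (ind A (V.erase x)) (Y.erase x) ⊆ (cut A Y).erase f := by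
      intro e he
      rw [mem_cut, mem_ind] at he
      simp only [Finset.mem_erase] at he
      rw [Finset.mem_erase, mem_cut]
      refine ⟨?_, he.1.1, he.2.1.2, fun h' => he.2.2 ⟨he.1.2.2.1, h'⟩⟩
      rintro rfl
      tauto
    have := Finset.card_le_card hsub
    rw [Finset.card_erase_of_mem hf] at this
    omega

theorem full_of_card {W : Finset ℕ} {H : Finset (ℕ × ℕ)} (wf : ∀ e ∈ H, e.1 ∈ W ∧ e.2 ∈ W ∧ e.1 ≠ e.2) {y : ℕ}
    (hy : y ∈ W) (h : W.card ≤ odeg H y + 1) : ∀ z ∈ W, y ≠ z → (y, z) ∈ H := by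
  have hs : (H.filter fun e => e.1 = y).image Prod.snd ⊆ W.erase y := by
    intro z hz
    obtain ⟨e, he, rfl⟩ := Finset.mem_image.1 hz
    rw [Finset.mem_filter] at he
    have := wf e he.1
    rw [Finset.mem_erase]
    refine ⟨?_, this.2.1⟩
    rw [← he.2]; exact this.2.2.symm
  have hc : ((H.filter fun e => e.1 = y).image Prod.snd).card = odeg H y := by
    rw [Finset.card_image_of_injOn]
    · rfl
    · intro e he f hf hef
      simp only [Finset.coe_filter, Set.mem_setOf_eq] at he hf
      exact Prod.ext (he.2.trans hf.2.symm) hef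
  have he := Finset.eq_of_subset_of_card_le hs (by rw [hc, Finset.card_erase_of_mem hy]; omega)
  intro z hz hyz
  have : z ∈ W.erase y := Finset.mem_erase.2 ⟨hyz.symm, hz⟩
  rw [← he] at this
  obtain ⟨e, he, rfl⟩ := Finset.mem_image.1 this
  rw [Finset.mem_filter] at he
  rw [← he.2]; exact he.1

theorem card_le_odeg {W : Finset ℕ} {H : Finset (ℕ × ℕ)} {y : ℕ} 
    (hy : y ∈ W) (h : ∀ z ∈ W, z ≠ y → (y, z) ∈ H) : W.card ≤ odeg H y + 1 := by
  have : ((W.erase y).image (fun z => (y, z))).card ≤ odeg H y := by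
    apply Finset.card_le_card
    intro e he
    obtain ⟨z, hz, rfl⟩ := Finset.mem_image.1 he
    rw [Finset.mem_erase] at hz
    exact Finset.mem_filter.2 ⟨h z hz.2 hz.1, rfl⟩
  rw [Finset.card_image_of_injective _ (fun a b h => (Prod.mk.inj h).2), Finset.card_erase_of_mem hy] at this
  omega

theorem sep_half {m W H} (hm : 0 < m) (h : Ext m W H) {a V1 V2} (hS : SepAt W H a V1 V2) :
    m ≤ (H.filter fun e => e.2 = a ∧ e.1 ∈ V1).card + 1 := by
  have hun := hS.un
  have hmem : ∀ v, v ∈ V1 ∨ v ∈ V2 ↔ v ≠ a ∧ v ∈ W := by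
    intro v; rw [← Finset.mem_union, hun, Finset.mem_erase]
  have h1 := h.cut_ge hm (X := V1) (fun v hv => ((hmem v).1 (Or.inl hv)).2) hS.n1
    (by rintro rfl; exact ((hmem a).1 (Or.inl hS.ha)).1 rfl)
  have hsub : cut H V1 ⊆ (H.filter fun e => e.2 = a ∧ e.1 ∈ V1) ∪ (H.filter fun e => e.1 ∈ V1 ∧ e.2 ∈ V2) := by
    intro e he
    rw [mem_cut] at he
    simp only [Finset.mem_union, Finset.mem_filter]
    have := (h.wf e he.1).2.1
    have := hmem e.2
    tauto
  have h2 : (H.filter fun e => e.1 ∈ V1 ∧ e.2 ∈ V2).card ≤ 1 := by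
    rw [Finset.card_le_one]
    intro e he f hf
    rw [Finset.mem_filter] at he hf
    exact hS.u12 e he.1 f hf.1 he.2.1 he.2.2 hf.2.1 hf.2.2
  have := (Finset.card_le_card hsub).trans (Finset.card_union_le _ _)
  omega

theorem Hub.out4 {m V A x} (hm : 3 ≤ m) (g : Hub (m+1) V A x) (hS : ¬ Sep V A) (ih : IH V.card) :
    V.card = m + 1 + 1 ∧ Compl V A := by
  have hE := g.extH (by omega) hS
  have hcard : (V.erase x).card + 1 = V.card := Finset.card_erase_add_one g.hx
  have fin : (V.erase x).card = m + 1 → Compl (V.erase x) (ind A (V.erase x)) → V.card = m + 1 + 1 ∧ Compl V A := by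
    intro h1 h2
    refine ⟨by omega, fun u hu v hv huv => ?_⟩
    by_cases hux : u = x
    · subst hux; exact (g.full (by omega) hS v (by simp [hv, huv.symm])).1
    · by_cases hvx : v = x
      · subst hvx; exact (g.full (by omega) hS u (by simp [hu, huv])).2
      · exact (mem_ind.1 (h2 u (by simp [hu, hux]) v (by simp [hv, hvx]) huv)).1
  rcases ih m (V.erase x) (ind A (V.erase x)) hm (by omega) hE with h | h | h
  · exact fin h.1 h.2
  · obtain ⟨rfl, w, hw, h1, h2, h3⟩ := h
    have hc := card_le_odeg hw (fun z hz hzw => (h1 z hz hzw).1)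
    rw [(g.degs (by omega) hS hw).1] at hc
    have hcomp : Compl (V.erase x) (ind A (V.erase x)) := by
      intro u hu v hv huv
      exact full_of_card hE.wf hu (by rw [(g.degs (by omega) hS hu).1]; omega) v hv huv
    refine fin ?_ hcomp
    have : odeg (ind A (V.erase x)) w + 1 ≤ (V.erase x).card := by
      have hs : (((ind A (V.erase x)).filter fun e => e.1 = w).image Prod.snd) ⊆ (V.erase x).erase w := by
        intro z hz
        obtain ⟨e, he, rfl⟩ := Finset.mem_image.1 hz
        rw [Finset.mem_filter] at he
        have := hE.wf e he.1
        rw [Finset.mem_erase]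
        refine ⟨?_, this.2.1⟩
        rw [← he.2]; exact this.2.2.symm
      have hc : (((ind A (V.erase x)).filter fun e => e.1 = w).image Prod.snd).card = odeg (ind A (V.erase x)) w := by
        rw [Finset.card_image_of_injOn]
        · rfl
        · intro e he f hf hef
          simp only [Finset.coe_filter, Set.mem_setOf_eq] at he hf
          exact Prod.ext (he.2.trans hf.2.symm) hef
      have h4 := Finset.card_le_card hs
      rw [hc] at h4
      have := Finset.card_erase_add_one hw
      omega
    rw [(g.degs (by omega) hS hw).1] at this
    omega
  · obtain ⟨a, V1, V2, hSA⟩ := h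
    exfalso
    have h1 := sep_half (by omega) hE hSA
    have h2 := sep_half (by omega) hE hSA.symm
    have h3 := (g.degs (by omega) hS hSA.ha).2
    have : ((ind A (V.erase x)).filter fun e => e.2 = a ∧ e.1 ∈ V1).card +
        ((ind A (V.erase x)).filter fun e => e.2 = a ∧ e.1 ∈ V2).card ≤ ideg (ind A (V.erase x)) a := by
      rw [← Finset.card_union_of_disjoint]
      · apply Finset.card_le_card
        intro e he
        simp only [Finset.mem_union, Finset.mem_filter] at he ⊢
        tauto
      · rw [Finset.disjoint_left]
        intro e he hf
        rw [Finset.mem_filter] at he hf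
        exact Finset.disjoint_left.1 hSA.dj he.2.2 hf.2.2
    omega
end Ex

set_option linter.all false
namespace Ex
open Relation

theorem in_two {H : Finset (ℕ × ℕ)} {u : ℕ} (h : ideg H u = 2) :
    ∃ a b, a ≠ b ∧ ∀ v, (v, u) ∈ H ↔ v = a ∨ v = b := by
  obtain ⟨e, f, hef, hs⟩ := Finset.card_eq_two.1 h
  have key : ∀ g, g ∈ H ∧ g.2 = u ↔ g = e ∨ g = f := by
    intro g
    have : g ∈ H.filter (fun e => e.2 = u) ↔ g ∈ ({e, f} : Finset (ℕ × ℕ)) := by rw [hs]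
    simpa using this
  have he := (key e).2 (Or.inl rfl)
  have hf := (key f).2 (Or.inr rfl)
  refine ⟨e.1, f.1, fun h' => hef (Prod.ext h' (he.2.trans hf.2.symm)), fun v => ⟨fun hv => ?_, ?_⟩⟩
  · rcases (key (v, u)).1 ⟨hv, rfl⟩ with h | h
    · left; rw [← h]
    · right; rw [← h]
  · rintro (rfl | rfl)
    · rw [← he.2]; exact he.1
    · rw [← hf.2]; exact hf.1

theorem out_two {H : Finset (ℕ × ℕ)} {u : ℕ} (h : odeg H u = 2) :
    ∃ a b, a ≠ b ∧ ∀ v, (u, v) ∈ H ↔ v = a ∨ v = b := by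
  obtain ⟨e, f, hef, hs⟩ := Finset.card_eq_two.1 h
  have key : ∀ g, g ∈ H ∧ g.1 = u ↔ g = e ∨ g = f := by
    intro g
    have : g ∈ H.filter (fun e => e.1 = u) ↔ g ∈ ({e, f} : Finset (ℕ × ℕ)) := by rw [hs]
    simpa using this
  have he := (key e).2 (Or.inl rfl)
  have hf := (key f).2 (Or.inr rfl)
  refine ⟨e.2, f.2, fun h' => hef (Prod.ext (he.2.trans hf.2.symm) h'), fun v => ⟨fun hv => ?_, ?_⟩⟩
  · rcases (key (u, v)).1 ⟨hv, rfl⟩ with h | h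
    · left; rw [← h]
    · right; rw [← h]
  · rintro (rfl | rfl)
    · rw [← he.2]; exact he.1
    · rw [← hf.2]; exact hf.1

theorem two_noconn {W H} (h : Ext 2 W H) (hd : ∀ y ∈ W, odeg H y = 2 ∧ ideg H y = 2) {u a b : ℕ} (hu : u ∈ W)
    (hab : a ≠ b) (hin : ∀ v, (v, u) ∈ H ↔ v = a ∨ v = b) {Y : Finset ℕ}
    (hY : Y ⊆ (W.erase a).erase b) (huY : u ∈ Y) (hYU : Y ≠ (W.erase a).erase b)
    (hno : ∀ c ∈ Y, ∀ d ∈ (W.erase a).erase b, d ∉ Y → ¬ nb H c d) :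
    (u, a) ∈ H ∧ (u, b) ∈ H := by
  have hau : (a, u) ∈ H := (hin a).2 (Or.inl rfl)
  have hbu : (b, u) ∈ H := (hin b).2 (Or.inr rfl)
  have haW : a ∈ W := (h.wf _ hau).1
  have hbW : b ∈ W := (h.wf _ hbu).1
  have hYm : ∀ v ∈ Y, v ≠ b ∧ v ≠ a ∧ v ∈ W := by
    intro v hv; have := hY hv; simpa [Finset.mem_erase] using this
  have hYW : Y ⊆ W := fun v hv => (hYm v hv).2.2
  set R := (W.erase a).erase b \ Y with hR
  have hRm : ∀ v, v ∈ R ↔ (v ≠ b ∧ v ≠ a ∧ v ∈ W) ∧ v ∉ Y := by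
    intro v; simp [hR, Finset.mem_erase]
  have hRne : R.Nonempty := by
    rw [Finset.nonempty_iff_ne_empty]
    intro h0
    exact hYU (Finset.Subset.antisymm hY (Finset.sdiff_eq_empty_iff_subset.1 h0))
  clear_value R
  have c1 : 2 ≤ (cut H (W \ Y)).card := h.cut_ge (by omega) Finset.sdiff_subset
    ⟨a, by rw [Finset.mem_sdiff]; exact ⟨haW, fun h' => (hYm a h').2.1 rfl⟩⟩
    (fun h' => by rw [← h'] at hu; exact (Finset.mem_sdiff.1 hu).2 huY)
  have c2 : 2 ≤ (cut H (W \ R)).card := by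
    obtain ⟨r, hr⟩ := hRne
    refine h.cut_ge (by omega) Finset.sdiff_subset
      ⟨a, by rw [Finset.mem_sdiff]; exact ⟨haW, fun h' => ((hRm a).1 h').1.2.1 rfl⟩⟩
      (fun h' => ?_)
    have := ((hRm r).1 hr).1.2.2
    rw [← h'] at this; exact (Finset.mem_sdiff.1 this).2 hr
  have t1 : ∀ e ∈ cut H (W \ Y), (e.1 = a ∨ e.1 = b) ∧ e.2 ∈ Y := by
    intro e he
    rw [mem_cut, Finset.mem_sdiff, Finset.mem_sdiff] at he
    have hw := h.wf e he.1
    have h2 : e.2 ∈ Y := by by_contra h'; exact he.2.2 ⟨hw.2.1, h'⟩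
    refine ⟨?_, h2⟩
    by_contra hc
    push Not at hc
    exact hno e.2 h2 e.1 (by simp [Finset.mem_erase, hc, hw.1]) he.2.1.2 (Or.inr he.1)
  have t2 : ∀ e ∈ cut H (W \ R), (e.1 = a ∨ e.1 = b) ∧ e.2 ∉ Y := by
    intro e he
    rw [mem_cut, Finset.mem_sdiff, Finset.mem_sdiff] at he
    have hw := h.wf e he.1
    have h2 : e.2 ∈ R := by by_contra h'; exact he.2.2 ⟨hw.2.1, h'⟩
    have h2' := (hRm _).1 h2
    refine ⟨?_, h2'.2⟩
    by_contra hc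
    push Not at hc
    have : e.1 ∈ Y := by
      by_contra h'
      exact he.2.1.2 ((hRm _).2 ⟨⟨hc.2, hc.1, hw.1⟩, h'⟩)
    exact hno e.1 this e.2 (by simpa [Finset.mem_erase] using h2'.1) h2'.2 (Or.inl he.1)
  have hcard : (cut H (W \ Y)).card = 2 := by
    have hdj : Disjoint (cut H (W \ Y)) (cut H (W \ R)) := by
      rw [Finset.disjoint_left]; intro e h1 h2; exact (t2 e h2).2 (t1 e h1).2
    have hs : cut H (W \ Y) ∪ cut H (W \ R) ⊆ (H.filter fun e => e.1 = a) ∪ (H.filter fun e => e.1 = b) := by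
      intro e he
      simp only [Finset.mem_union, Finset.mem_filter] at he ⊢
      rcases he with he | he
      · have := (t1 e he).1; have := (mem_cut.1 he).1; tauto
      · have := (t2 e he).1; have := (mem_cut.1 he).1; tauto
    have h1 := (Finset.card_le_card hs).trans (Finset.card_union_le _ _)
    rw [Finset.card_union_of_disjoint hdj] at h1
    have ha := (hd a haW).1
    have hb := (hd b hbW).1
    unfold odeg at ha hb
    omega
  have haY : a ∉ Y := fun h' => (hYm a h').2.1 rfl
  have hbY : b ∉ Y := fun h' => (hYm b h').1 rfl
  have heq : ({(a, u), (b, u)} : Finset (ℕ × ℕ)) = cut H (W \ Y) := by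
    apply Finset.eq_of_subset_of_card_le
    · intro e he
      simp only [Finset.mem_insert, Finset.mem_singleton] at he
      rw [mem_cut, Finset.mem_sdiff, Finset.mem_sdiff]
      rcases he with rfl | rfl
      · exact ⟨hau, ⟨haW, haY⟩, fun h' => h'.2 huY⟩
      · exact ⟨hbu, ⟨hbW, hbY⟩, fun h' => h'.2 huY⟩
    · rw [hcard, Finset.card_pair (by simp [hab])]
  have hin2 : ∀ e ∈ H, e.1 ∉ Y → e.2 ∈ Y → e.2 = u := by
    intro e he h1 h2
    have : e ∈ cut H (W \ Y) := by
      rw [mem_cut, Finset.mem_sdiff, Finset.mem_sdiff]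
      exact ⟨he, ⟨(h.wf e he).1, h1⟩, fun h' => h'.2 h2⟩
    rw [← heq] at this
    simp only [Finset.mem_insert, Finset.mem_singleton] at this
    rcases this with rfl | rfl <;> rfl
  obtain ⟨p, q, hpq, hout⟩ := out_two (hd u hu).1
  by_cases hW' : Y.erase u = ∅
  · have hYu : ∀ v ∈ Y, v = u := by
      intro v hv
      by_contra hvu
      have : v ∈ Y.erase u := Finset.mem_erase.2 ⟨hvu, hv⟩
      rw [hW'] at this; simp at this
    have hnb : ∀ v, (u, v) ∈ H → v = a ∨ v = b := by
      intro v hv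
      by_contra hc
      push Not at hc
      have hw := h.wf _ hv
      exact hno u huY v (by simp [Finset.mem_erase, hc, hw.2.1]) (fun h' => hw.2.2 (hYu v h').symm) (Or.inl hv)
    have hp := hnb p ((hout p).2 (Or.inl rfl))
    have hq := hnb q ((hout q).2 (Or.inr rfl))
    have : (a = p ∨ a = q) ∧ (b = p ∨ b = q) := by omega
    exact ⟨(hout a).2 this.1, (hout b).2 this.2⟩
  · exfalso
    set W' := Y.erase u with hW'd
    have hW'ne : W'.Nonempty := Finset.nonempty_iff_ne_empty.2 hW'
    have hW'm : ∀ v, v ∈ W' ↔ v ≠ u ∧ v ∈ Y := fun v => by rw [hW'd, Finset.mem_erase]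
    have hW'W : W' ⊆ W := fun v hv => hYW ((hW'm v).1 hv).2
    have hW'V : W' ≠ W := fun h' => by rw [← h'] at hu; exact ((hW'm u).1 hu).1 rfl
    have c3 : 2 ≤ (cut H (W \ W')).card := by
      rw [h.cut_compl (by omega)]
      exact h.cut_ge (by omega) hW'W hW'ne hW'V
    have hs3 : cut H (W \ W') ⊆ H.filter (fun e => e.1 = u) := by
      intro e he
      rw [mem_cut, Finset.mem_sdiff, Finset.mem_sdiff] at he
      have hw := h.wf e he.1
      have h2 : e.2 ∈ W' := by by_contra h'; exact he.2.2 ⟨hw.2.1, h'⟩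
      rw [Finset.mem_filter]
      refine ⟨he.1, ?_⟩
      by_contra hc
      have h1 : e.1 ∉ Y := fun h' => he.2.1.2 ((hW'm _).2 ⟨hc, h'⟩)
      exact ((hW'm _).1 h2).1 (hin2 e he.1 h1 ((hW'm _).1 h2).2)
    have heq3 : cut H (W \ W') = H.filter (fun e => e.1 = u) := by
      apply Finset.eq_of_subset_of_card_le hs3
      have := (hd u hu).1; unfold odeg at this; omega
    have c3' : (cut H W').card = 2 := by
      rw [← h.cut_compl (by omega), heq3]; exact (hd u hu).1
    have hcc : cut H W' = cut H Y := by
      ext e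
      rw [mem_cut, mem_cut]
      constructor
      · rintro ⟨he, h1, h2⟩
        refine ⟨he, ((hW'm _).1 h1).2, fun h' => ?_⟩
        have he2 : e.2 = u := by by_contra hc; exact h2 ((hW'm _).2 ⟨hc, h'⟩)
        have : (e.1, u) ∈ H := by rw [← he2]; exact he
        have h3 := hYm _ ((hW'm _).1 h1).2
        rcases (hin _).1 this with h4 | h4
        · exact h3.2.1 h4
        · exact h3.1 h4
      · rintro ⟨he, h1, h2⟩
        refine ⟨he, (hW'm _).2 ⟨fun hc => ?_, h1⟩, fun h' => h2 ((hW'm _).1 h').2⟩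
        have : e ∈ cut H (W \ W') := by rw [heq3, Finset.mem_filter]; exact ⟨he, hc⟩
        rw [mem_cut, Finset.mem_sdiff, Finset.mem_sdiff] at this
        exact h2 ((hW'm _).1 (by by_contra h'; exact this.2.2 ⟨(h.wf e he).2.1, h'⟩)).2
    have hYV : Y ≠ W := fun h' => haY (h' ▸ haW)
    obtain ⟨α, hα⟩ := h.ind_colb (by omega) (X := Y) (fun h' => haY (h' haW))
    obtain ⟨β, hβ⟩ := h.ind_colb (by omega) (X := W \ Y) (not_sub_sdiff hYW ⟨u, huY⟩)
    obtain ⟨β', hβ'⟩ := h.ind_colb (by omega) (X := W \ W') (not_sub_sdiff hW'W hW'ne)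
    have mono1 : ∀ e ∈ cut H Y, ∀ f ∈ cut H Y, α e.1 = α f.1 := by
      rcases h.tight (by omega) hYW ⟨u, huY⟩ hYV (by rw [← hcc, c3']) with hM | hM
      · obtain ⟨c, hc, _⟩ := (hM α β hα hβ).mc
        intro e he f hf; rw [hc e he, hc f hf]
      · exfalso
        have := (hM β α hβ hα).ih
        rw [← heq] at this
        have := this (x₁ := (a, u)) (x₂ := (b, u)) (by simp) (by simp) rfl
        exact hab (Prod.mk.inj this).1
    have inj1 : Set.InjOn (fun e : ℕ × ℕ => α e.1) (cut H W') := by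
      have hα' : Col (ind H W') α := hα.subset (ind_mono _ (Finset.erase_subset _ _))
      rcases h.tight (by omega) hW'W hW'ne hW'V c3' with hM | hM
      · exfalso
        have := (hM α β' hα' hβ').it
        rw [heq3] at this
        have := this (x₁ := (u, p)) (x₂ := (u, q)) (by simp [hout]) (by simp [hout]) rfl
        exact hpq (Prod.mk.inj this).2
      · exact (hM β' α hβ' hα').it
    obtain ⟨e, f, hef, hs⟩ := Finset.card_eq_two.1 c3'
    have he : e ∈ cut H W' := by rw [hs]; simp
    have hf : f ∈ cut H W' := by rw [hs]; simp
    exact hef (inj1 he hf (mono1 e (hcc ▸ he) f (hcc ▸ hf)))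

theorem two_key {W H} (h : Ext 2 W H) (hd : ∀ y ∈ W, odeg H y = 2 ∧ ideg H y = 2) {u a b : ℕ} (hu : u ∈ W)
    (hab : a ≠ b) (hin : ∀ v, (v, u) ∈ H ↔ v = a ∨ v = b) :
    ((a, b) ∈ H ∧ (b, a) ∈ H) ∨ ((u, a) ∈ H ∧ (u, b) ∈ H) := by
  by_contra hcon
  push Not at hcon
  obtain ⟨hnd, hno⟩ := hcon
  have hau : (a, u) ∈ H := (hin a).2 (Or.inl rfl)
  have hbu : (b, u) ∈ H := (hin b).2 (Or.inr rfl)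
  set U := (W.erase a).erase b with hU
  have huU : u ∈ U := by
    simp only [hU, Finset.mem_erase]
    exact ⟨(h.wf _ hbu).2.2.symm, (h.wf _ hau).2.2.symm, hu⟩
  by_cases hc : Conn H U
  · have hcol : Col (away H U) (fun _ => (0 : Fin 2)) := by
      have step : ∀ p q, mono (away H U) (fun _ => (0 : Fin 2)) p q → ((p = a ∧ q = b) ∨ (p = b ∧ q = a)) ∧ (p, q) ∈ H := by
        intro p q hpq
        have h1 := mem_away.1 hpq.1
        have h2 := h.wf _ h1.1
        simp only [hU, Finset.mem_erase] at h1 h2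
        refine ⟨?_, h1.1⟩
        have : p ≠ q := h2.2.2
        have hp : p = a ∨ p = b := by tauto
        have hq : q = a ∨ q = b := by tauto
        rcases hp with rfl | rfl <;> rcases hq with rfl | rfl <;> simp_all
      by_cases hab' : (a, b) ∈ H
      · have hba : (b, a) ∉ H := hnd hab'
        intro x hx
        have mx : ∀ y, TransGen (mono (away H U) (fun _ => (0 : Fin 2))) x y → x = a ∧ y = b := by
          intro y hy
          induction hy with
          | single hr =>
            obtain ⟨(h1 | h1), h2⟩ := step _ _ hr
            · exact h1
            · rw [h1.1, h1.2] at h2; exact absurd h2 hba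
          | tail _ hr ih =>
            obtain ⟨(h1 | h1), h2⟩ := step _ _ hr
            · exact absurd (h1.1.symm.trans ih.2) hab
            · rw [h1.1, h1.2] at h2; exact absurd h2 hba
        have := mx x hx
        exact hab (this.1.symm.trans this.2)
      · intro x hx
        have mx : ∀ y, TransGen (mono (away H U) (fun _ => (0 : Fin 2))) x y → x = b ∧ y = a := by
          intro y hy
          induction hy with
          | single hr =>
            obtain ⟨(h1 | h1), h2⟩ := step _ _ hr
            · rw [h1.1, h1.2] at h2; exact absurd h2 hab'
            · exact h1
          | tail _ hr ih =>
            obtain ⟨(h1 | h1), h2⟩ := step _ _ hr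
            · rw [h1.1, h1.2] at h2; exact absurd h2 hab'
            · exact absurd (h1.1.symm.trans ih.2) hab.symm
        have := mx x hx
        exact hab (this.2.symm.trans this.1)
    obtain ⟨φ, _, _, hφ⟩ := greedyFull h.loop hc huU (L := fun _ => Finset.univ)
      (by
        intro w hw _
        have : w ∈ W := by simp only [hU, Finset.mem_erase] at hw; exact hw.2.2
        have := hd w this
        simp; omega) (fun _ => (0 : Fin 2)) hcol
      (by
        intro φ' hφ'
        refine ⟨1, by simp, Or.inl ?_⟩
        intro v hv
        rcases (hin v).1 hv with rfl | rfl
        · rw [hφ' v (by simp [hU])]; decide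
        · rw [hφ' v (by simp [hU])]; decide)
    exact h.ncol ⟨φ, hφ⟩
  · rw [conn_iff] at hc
    push Not at hc
    obtain ⟨C, hC, hne, hCU, hn⟩ := hc
    have : ∃ Y ⊆ U, u ∈ Y ∧ Y ≠ U ∧ ∀ c ∈ Y, ∀ d ∈ U, d ∉ Y → ¬ nb H c d := by
      by_cases huC : u ∈ C
      · exact ⟨C, hC, huC, hCU, hn⟩
      · refine ⟨U \ C, Finset.sdiff_subset, by simp [huU, huC], ?_, ?_⟩
        · intro h'
          obtain ⟨c, hcC⟩ := hne
          have := hC hcC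
          rw [← h'] at this
          exact (Finset.mem_sdiff.1 this).2 hcC
        · intro c hc d hd hdn hnb
          rw [Finset.mem_sdiff] at hc hdn
          have : d ∈ C := by by_contra h'; exact hdn ⟨hd, h'⟩
          exact hn d this c hc.1 hc.2 hnb.symm
    obtain ⟨Y, hY, huY, hYU, hn'⟩ := this
    have := two_noconn h hd hu hab hin hY huY hYU hn'
    exact hno this.1 this.2

theorem two_sym {W H} (h : Ext 2 W H) (hd : ∀ y ∈ W, odeg H y = 2 ∧ ideg H y = 2) :
    ∀ a u, (a, u) ∈ H → (u, a) ∈ H := by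
  intro a' u hau'
  have hu := (h.wf _ hau').2.1
  obtain ⟨a, b, hab, hin⟩ := in_two (hd u hu).2
  have hau : (a, u) ∈ H := (hin a).2 (Or.inl rfl)
  have hbu : (b, u) ∈ H := (hin b).2 (Or.inr rfl)
  have haW := (h.wf _ hau).1
  have hbW := (h.wf _ hbu).1
  have goal : (u, a) ∈ H ∧ (u, b) ∈ H := by
    rcases two_key h hd hu hab hin with hdg | hg
    swap
    · exact hg
    have nau : a ≠ u := (h.wf _ hau).2.2
    have nbu : b ≠ u := (h.wf _ hbu).2.2
    obtain ⟨p, q, hpq, hout⟩ := out_two (hd u hu).1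
    have outA : ∀ v, (a, v) ∈ H → v = u ∨ v = b := by
      obtain ⟨p', q', hpq', ho⟩ := out_two (hd a haW).1
      intro v hv
      have := (ho v).1 hv
      have := (ho u).1 hau
      have := (ho b).1 hdg.1
      omega
    have outB : ∀ v, (b, v) ∈ H → v = u ∨ v = a := by
      obtain ⟨p', q', hpq', ho⟩ := out_two (hd b hbW).1
      intro v hv
      have := (ho v).1 hv
      have := (ho u).1 hbu
      have := (ho a).1 hdg.2
      omega
    by_cases hW : ({a, b, u} : Finset ℕ) = W
    · have f : ∀ v, (u, v) ∈ H → v = a ∨ v = b := by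
        intro v hv
        have := (h.wf _ hv).2
        rw [← hW] at this
        simp only [Finset.mem_insert, Finset.mem_singleton] at this
        omega
      have hp := f p ((hout p).2 (Or.inl rfl))
      have hq := f q ((hout q).2 (Or.inr rfl))
      have : (a = p ∨ a = q) ∧ (b = p ∨ b = q) := by omega
      exact ⟨(hout a).2 this.1, (hout b).2 this.2⟩
    · exfalso
      have hc := h.cut_ge (by omega) (X := {a, b, u}) (by
        intro v hv
        simp only [Finset.mem_insert, Finset.mem_singleton] at hv
        rcases hv with rfl | rfl | rfl <;> assumption) ⟨a, by simp⟩ hW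
      have hs : cut H {a, b, u} ⊆ H.filter (fun e => e.1 = u) := by
        intro e he
        rw [mem_cut] at he
        simp only [Finset.mem_insert, Finset.mem_singleton] at he
        rw [Finset.mem_filter]
        refine ⟨he.1, ?_⟩
        rcases he.2.1 with h1 | h1 | h1
        · have := outA e.2 (by rw [← h1]; exact he.1); tauto
        · have := outB e.2 (by rw [← h1]; exact he.1); tauto
        · exact h1
      have heq := Finset.eq_of_subset_of_card_le hs (by
        have := (hd u hu).1; unfold odeg at this; omega)
      have nuv : ∀ v, (u, v) ∈ H → v ≠ a ∧ v ≠ b := by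
        intro v hv
        have : (u, v) ∈ cut H {a, b, u} := by rw [heq, Finset.mem_filter]; exact ⟨hv, rfl⟩
        rw [mem_cut] at this
        simp only [Finset.mem_insert, Finset.mem_singleton] at this
        tauto
      obtain ⟨c1, c2, hcc, hin'⟩ := in_two (hd a haW).2
      have hb := (hin' b).1 hdg.2
      have : ∃ c, c ≠ b ∧ ∀ v, (v, a) ∈ H ↔ v = b ∨ v = c := by
        rcases hb with rfl | rfl
        · exact ⟨c2, hcc.symm, hin'⟩
        · exact ⟨c1, hcc, fun v => by rw [hin', or_comm]⟩
      obtain ⟨c, hcb, hinc⟩ := this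
      have hca : (c, a) ∈ H := (hinc c).2 (Or.inr rfl)
      have hcu : c ≠ u := fun h' => (nuv a (h' ▸ hca)).1 rfl
      have hcna : c ≠ a := (h.wf _ hca).2.2
      rcases two_key h hd haW hcb.symm hinc with h1 | h1
      · have := outB c h1.1; tauto
      · have := outA c h1.2; tauto
  rcases (hin a').1 hau' with rfl | rfl
  · exact goal.1
  · exact goal.2

theorem Hub.out3 {V A x} (g : Hub 3 V A x) (hS : ¬ Sep V A) : AWheel V A := by
  have hE : Ext 2 (V.erase x) (ind A (V.erase x)) := Hub.extH (m := 2) (by omega) g hS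
  have hd := fun y hy => Hub.degs (m := 2) (by omega) g hS (y := y) hy
  refine ⟨x, g.hx, fun y hy hyx => g.full (by omega) hS y (by simp [hy, hyx]), ?_, fun y hy hyx => g.od y hy hyx⟩
  intro a b hab
  have hw := g.ext.wf _ hab
  simp only at hw
  by_cases hax : a = x
  · subst hax; exact (g.sym b).1 hab
  · by_cases hbx : b = x
    · subst hbx; exact (g.sym a).2 hab
    · have : (a, b) ∈ ind A (V.erase x) := mem_ind.2 ⟨hab, by simp [hax, hw.1], by simp [hbx, hw.2.1]⟩
      exact (mem_ind.1 (two_sym hE hd _ _ this)).1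

theorem main_out : ∀ n, IH n := by
  intro n
  induction n using Nat.strong_induction_on with
  | _ n ih =>
    intro k V A hk hV h
    by_cases hS : Sep V A
    · exact Or.inr (Or.inr hS)
    obtain ⟨x, g⟩ := hub hk h (ih _ hV) hS
    by_cases h3 : k = 3
    · subst h3; exact Or.inr (Or.inl ⟨rfl, g.out3 hS⟩)
    · obtain ⟨m, rfl⟩ : ∃ m, k = m + 1 := ⟨k - 1, by omega⟩
      exact Or.inl (g.out4 (by omega) hS (ih _ hV))
end Ex

set_option linter.all false
namespace Ex
open Relation

def pr (a : ℕ) (V2 : Finset ℕ) (v : ℕ) : ℕ := if v ∈ V2 then a else v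

def con (A : Finset (ℕ × ℕ)) (a : ℕ) (V2 : Finset ℕ) : Finset (ℕ × ℕ) :=
  (A.image (fun e => (pr a V2 e.1, pr a V2 e.2))).filter (fun e => e.1 ≠ e.2)

theorem mem_con {A a V2} {f : ℕ × ℕ} : f ∈ con A a V2 ↔
    (∃ e ∈ A, (pr a V2 e.1, pr a V2 e.2) = f) ∧ f.1 ≠ f.2 := by
  simp only [con, Finset.mem_filter, Finset.mem_image]

theorem pr_in {a V2 v} (h : v ∈ V2) : pr a V2 v = a := if_pos h
theorem pr_out {a V2 v} (h : v ∉ V2) : pr a V2 v = v := if_neg h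

namespace SepAt
variable {k : ℕ} {V V1 V2 : Finset ℕ} {A : Finset (ℕ × ℕ)} {a : ℕ}

theorem memV (h : SepAt V A a V1 V2) {v} : v ∈ V ↔ v = a ∨ v ∈ V1 ∨ v ∈ V2 := by
  have : v ∈ V1 ∪ V2 ↔ v ∈ V.erase a := by rw [h.un]
  rw [Finset.mem_union, Finset.mem_erase] at this
  have := h.ha
  by_cases hv : v = a
  · subst hv; tauto
  · tauto
theorem a1 (h : SepAt V A a V1 V2) : a ∉ V1 := fun h' => by
  have : a ∈ V.erase a := by rw [← h.un]; exact Finset.mem_union_left _ h'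
  simp at this
theorem a2 (h : SepAt V A a V1 V2) : a ∉ V2 := h.symm.a1
theorem n12 (h : SepAt V A a V1 V2) {v} (h1 : v ∈ V1) : v ∉ V2 := Finset.disjoint_left.1 h.dj h1
theorem n21 (h : SepAt V A a V1 V2) {v} (h1 : v ∈ V2) : v ∉ V1 := h.symm.n12 h1

theorem prV (h : SepAt V A a V1 V2) {v} (hv : v ∈ V) : pr a V2 v ∈ insert a V1 := by
  by_cases h2 : v ∈ V2
  · rw [pr_in h2]; simp
  · rw [pr_out h2]; rw [Finset.mem_insert]; have := h.memV.1 hv; tauto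

theorem nIns (h : SepAt V A a V1 V2) {v} (hv : v ∈ insert a V1) : v ∉ V2 := by
  rcases Finset.mem_insert.1 hv with rfl | hv
  · exact h.a2
  · exact h.n12 hv

/-- saturated separators -/
theorem satsep (hk : 2 ≤ k) (hE : Ext k V A) (h : SepAt V A a V1 V2) {u v : ℕ} (hu : u ∈ insert a V1)
    (hv : v ∈ insert a V1) (huv : u ≠ v) :
    ∃ Y ⊆ V, u ∈ Y ∧ v ∉ Y ∧ (cut A Y).card ≤ k ∧ ∀ z ∈ V2, z ∈ Y ↔ a ∈ Y := by
  have insV : ∀ {x}, x ∈ insert a V1 → x ∈ V := by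
    intro x hx; rcases Finset.mem_insert.1 hx with h1 | h1
    · exact h.memV.2 (Or.inl h1)
    · exact h.memV.2 (Or.inr (Or.inl h1))
  have V2V : V2 ⊆ V := fun x hx => h.memV.2 (Or.inr (Or.inr hx))
  obtain ⟨Y0, hY0, huY, hvY, hc⟩ := hE.sep u (insV hu) v (insV hv) huv
  by_cases ha : a ∈ Y0
  · refine ⟨Y0 ∪ V2, Finset.union_subset hY0 V2V, Finset.mem_union_left _ huY, ?_, ?_, ?_⟩
    · rw [Finset.mem_union]; rintro (h' | h')
      · exact hvY h'
      · exact h.nIns hv h'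
    · by_cases hbad : ∃ e ∈ A, e.1 ∈ V2 ∧ e.1 ∉ Y0 ∧ e.2 ∉ Y0 ∧ e.2 ∉ V2
      · obtain ⟨e, he, h1, h2, h3, h4⟩ := hbad
        have he2 : e.2 ∈ V1 := by
          rcases h.memV.1 (hE.wf e he).2.1 with h' | h' | h'
          · exact absurd (h' ▸ ha) h3
          · exact h'
          · exact absurd h' h4
        have hcin : k ≤ (cut A (V \ (V2 \ Y0))).card := by
          refine hE.cut_ge (by omega) Finset.sdiff_subset ⟨a, ?_⟩ ?_
          · simp [h.ha, ha]
          · intro h'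
            have := V2V h1
            rw [← h'] at this
            simp [h1, h2] at this
        have : ∃ f ∈ cut A (V \ (V2 \ Y0)), ¬ (f.1 ∈ V1 ∧ f.2 ∈ V2) := by
          by_contra hcon
          push Not at hcon
          obtain ⟨f, hf, g, hg, hfg⟩ := Finset.one_lt_card.1 (show 1 < (cut A (V \ (V2 \ Y0))).card by omega)
          have hf' := hcon f hf
          have hg' := hcon g hg
          exact hfg (h.u12 f (mem_cut.1 hf).1 g (mem_cut.1 hg).1 hf'.1 hf'.2 hg'.1 hg'.2)
        obtain ⟨f, hf, hfn⟩ := this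
        rw [mem_cut] at hf
        obtain ⟨hfA, hf1, hf2⟩ := hf
        have hfw := hE.wf f hfA
        simp only [Finset.mem_sdiff, not_and, not_not] at hf1 hf2
        have hf2' := hf2 hfw.2.1
        have hf2V : f.2 ∈ V2 := by by_contra h'; tauto
        have hf2Y : f.2 ∉ Y0 := by by_contra h'; tauto
        have hf1Y : f.1 ∈ Y0 := by
          rcases h.memV.1 hf1.1 with h' | h' | h'
          · rw [h']; exact ha
          · tauto
          · tauto
        have hfc : f ∈ cut A Y0 := mem_cut.2 ⟨hfA, hf1Y, hf2Y⟩
        have hs : cut A (Y0 ∪ V2) ⊆ insert e ((cut A Y0).erase f) := by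
          intro g hg
          rw [mem_cut] at hg
          simp only [Finset.mem_union] at hg
          rw [Finset.mem_insert, Finset.mem_erase, mem_cut]
          by_cases hgY : g.1 ∈ Y0
          · right
            refine ⟨?_, hg.1, hgY, by tauto⟩
            rintro rfl; tauto
          · left
            have hg2 : g.2 ∈ V1 := by
              rcases h.memV.1 (hE.wf g hg.1).2.1 with h' | h' | h'
              · exact absurd (Or.inl (h' ▸ ha)) hg.2.2
              · exact h'
              · tauto
            exact h.u21 g hg.1 e he (by tauto) hg2 h1 he2
        have h5 := (Finset.card_le_card hs).trans (Finset.card_insert_le _ _)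
        rw [Finset.card_erase_of_mem hfc] at h5
        have := Finset.card_pos.2 ⟨f, hfc⟩
        omega
      · push Not at hbad
        refine le_trans (Finset.card_le_card ?_) hc
        intro g hg
        rw [mem_cut] at hg ⊢
        simp only [Finset.mem_union, not_or] at hg
        refine ⟨hg.1, ?_, hg.2.2.1⟩
        by_contra h'
        have := hbad g hg.1 (by tauto) h' hg.2.2.1
        tauto
    · intro z hz; simp [hz, ha]
  · refine ⟨Y0 \ V2, (Finset.sdiff_subset).trans hY0, ?_, ?_, ?_, ?_⟩
    · rw [Finset.mem_sdiff]; exact ⟨huY, h.nIns hu⟩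
    · rw [Finset.mem_sdiff]; tauto
    · by_cases hbad : ∃ e ∈ A, e.2 ∈ V2 ∧ e.2 ∈ Y0 ∧ e.1 ∈ Y0 ∧ e.1 ∉ V2
      · obtain ⟨e, he, h1, h2, h3, h4⟩ := hbad
        have he2 : e.1 ∈ V1 := by
          rcases h.memV.1 (hE.wf e he).1 with h' | h' | h'
          · exact absurd (h' ▸ h3) ha
          · exact h'
          · exact absurd h' h4
        have hcin : k ≤ (cut A (V2 ∩ Y0)).card := by
          refine hE.cut_ge (by omega) (Finset.inter_subset_left.trans V2V) ⟨e.2, by simp [h1, h2]⟩ ?_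
          intro h'
          have := h.ha
          rw [← h'] at this
          simp [ha] at this
        have : ∃ f ∈ cut A (V2 ∩ Y0), ¬ (f.1 ∈ V2 ∧ f.2 ∈ V1) := by
          by_contra hcon
          push Not at hcon
          obtain ⟨f, hf, g, hg, hfg⟩ := Finset.one_lt_card.1 (show 1 < (cut A (V2 ∩ Y0)).card by omega)
          have hf' := hcon f hf
          have hg' := hcon g hg
          exact hfg (h.u21 f (mem_cut.1 hf).1 g (mem_cut.1 hg).1 hf'.1 hf'.2 hg'.1 hg'.2)
        obtain ⟨f, hf, hfn⟩ := this
        rw [mem_cut] at hf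
        obtain ⟨hfA, hf1, hf2⟩ := hf
        have hfw := hE.wf f hfA
        simp only [Finset.mem_inter] at hf1 hf2
        have hf2Y : f.2 ∉ Y0 := by
          intro h'
          rcases h.memV.1 hfw.2.1 with h'' | h'' | h''
          · exact ha (h'' ▸ h')
          · tauto
          · tauto
        have hfc : f ∈ cut A Y0 := mem_cut.2 ⟨hfA, hf1.2, hf2Y⟩
        have hs : cut A (Y0 \ V2) ⊆ insert e ((cut A Y0).erase f) := by
          intro g hg
          rw [mem_cut] at hg
          simp only [Finset.mem_sdiff, not_and, not_not] at hg
          rw [Finset.mem_insert, Finset.mem_erase, mem_cut]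
          by_cases hgY : g.2 ∈ Y0
          · left
            have hg2 : g.1 ∈ V1 := by
              rcases h.memV.1 (hE.wf g hg.1).1 with h' | h' | h'
              · exact absurd (h' ▸ hg.2.1.1) ha
              · exact h'
              · tauto
            exact h.u12 g hg.1 e he hg2 (hg.2.2 hgY) he2 h1
          · right
            refine ⟨?_, hg.1, hg.2.1.1, by tauto⟩
            rintro rfl; tauto
        have h5 := (Finset.card_le_card hs).trans (Finset.card_insert_le _ _)
        rw [Finset.card_erase_of_mem hfc] at h5
        have := Finset.card_pos.2 ⟨f, hfc⟩
        omega
      · push Not at hbad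
        refine le_trans (Finset.card_le_card ?_) hc
        intro g hg
        rw [mem_cut] at hg ⊢
        simp only [Finset.mem_sdiff, not_and, not_not] at hg
        refine ⟨hg.1, hg.2.1.1, ?_⟩
        intro h'
        have := hbad g hg.1 (hg.2.2 h') h' hg.2.1.1
        tauto
    · intro z hz; simp [hz, ha]

theorem pr_sat {Y : Finset ℕ} (hs : ∀ z ∈ V2, z ∈ Y ↔ a ∈ Y) (v : ℕ) : pr a V2 v ∈ Y ↔ v ∈ Y := by
  by_cases h : v ∈ V2
  · rw [pr_in h, hs v h]
  · rw [pr_out h]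

theorem con_nV2 (h : SepAt V A a V1 V2) {f : ℕ × ℕ} (hf : f ∈ con A a V2) : f.1 ∉ V2 ∧ f.2 ∉ V2 := by
  obtain ⟨⟨e, he, rfl⟩, _⟩ := mem_con.1 hf
  have : ∀ v, pr a V2 v ∉ V2 := by
    intro v
    by_cases hv : v ∈ V2
    · rw [pr_in hv]; exact h.a2
    · rw [pr_out hv]; exact hv
  exact ⟨this _, this _⟩

theorem cut_con (h : SepAt V A a V1 V2) {Y : Finset ℕ} (hs : ∀ z ∈ V2, z ∈ Y ↔ a ∈ Y) :
    cut (con A a V2) (Y \ V2) = (cut A Y).image (fun e => (pr a V2 e.1, pr a V2 e.2)) := by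
  ext f
  rw [mem_cut, Finset.mem_image]
  constructor
  · rintro ⟨hf, h1, h2⟩
    have hn := h.con_nV2 hf
    obtain ⟨⟨e, he, rfl⟩, _⟩ := mem_con.1 hf
    simp only [Finset.mem_sdiff] at h1 h2
    refine ⟨e, mem_cut.2 ⟨he, (pr_sat hs _).1 h1.1, fun h' => h2 ⟨(pr_sat hs _).2 h', hn.2⟩⟩, rfl⟩
  · rintro ⟨e, he, rfl⟩
    rw [mem_cut] at he
    have h1 := (pr_sat hs e.1).2 he.2.1
    have h2 : pr a V2 e.2 ∉ Y := fun h' => he.2.2 ((pr_sat hs e.2).1 h')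
    have hf : (pr a V2 e.1, pr a V2 e.2) ∈ con A a V2 :=
      mem_con.2 ⟨⟨e, he.1, rfl⟩, fun h' => h2 (by simp only at h'; rw [← h']; exact h1)⟩
    exact ⟨hf, Finset.mem_sdiff.2 ⟨h1, (h.con_nV2 hf).1⟩, fun h' => h2 (Finset.mem_sdiff.1 h').1⟩

theorem con_ncol (hk : 3 ≤ k) (hE : Ext k V A) (h : SepAt V A a V1 V2) : ¬ Colb k (con A a V2) := by
  rintro ⟨φ1, hφ1⟩
  obtain ⟨φ0, hφ0⟩ := hE.ind_colb (by omega) (X := insert a V2) (by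
    intro h'
    obtain ⟨z, hz⟩ := h.n1
    rcases Finset.mem_insert.1 (h' (h.memV.2 (Or.inr (Or.inl hz)))) with h1 | h1
    · exact h.a1 (h1 ▸ hz)
    · exact h.n12 hz h1)
  -- adjust φ0
  have adj : ∃ σ : Equiv.Perm (Fin k), σ (φ0 a) = φ1 a ∧
      ∀ e ∈ A, e.1 ∈ V1 → e.2 ∈ V2 → φ1 e.1 ≠ φ1 a → σ (φ0 e.2) ≠ φ1 e.1 := by
    by_cases hex : ∃ e ∈ A, e.1 ∈ V1 ∧ e.2 ∈ V2
    · obtain ⟨e, he, h1, h2⟩ := hex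
      have hc : ∃ c : Fin k, c ≠ φ1 a ∧ c ≠ φ1 e.1 := by
        have : ({φ1 a, φ1 e.1} : Finset (Fin k)).card < (Finset.univ : Finset (Fin k)).card := by
          have : ({φ1 a, φ1 e.1} : Finset (Fin k)).card ≤ 2 := Finset.card_le_two
          simp; omega
        obtain ⟨c, _, hc⟩ := Finset.exists_mem_notMem_of_card_lt_card this
        simp only [Finset.mem_insert, Finset.mem_singleton, not_or] at hc
        exact ⟨c, hc.1, hc.2⟩
      obtain ⟨c, hc1, hc2⟩ := hc
      have fin : ∀ σ : Equiv.Perm (Fin k), (φ1 e.1 ≠ φ1 a → σ (φ0 e.2) ≠ φ1 e.1) →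
          ∀ f ∈ A, f.1 ∈ V1 → f.2 ∈ V2 → φ1 f.1 ≠ φ1 a → σ (φ0 f.2) ≠ φ1 f.1 := by
        intro σ hσ f hf g1 g2
        rw [h.u12 f hf e he g1 g2 h1 h2]; exact hσ
      by_cases h3 : φ0 a = φ0 e.2
      · refine ⟨Equiv.swap (φ0 a) (φ1 a), by simp, fin _ ?_⟩
        intro hn
        rw [← h3]; simp; exact hn.symm
      · obtain ⟨τ, ht1, ht2⟩ := exists_perm_two (φ1 a) c (φ0 a) (φ0 e.2)
          ⟨fun h' => absurd h'.symm hc1, fun h' => absurd h' h3⟩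
        exact ⟨τ, ht1, fin _ (fun _ => by rw [ht2]; exact hc2)⟩
    · refine ⟨Equiv.swap (φ0 a) (φ1 a), by simp, ?_⟩
      intro e he h1 h2; exact absurd ⟨e, he, h1, h2⟩ hex
  obtain ⟨σ, hσa, hσ⟩ := adj
  have hφ2 : Col (ind A (insert a V2)) (σ ∘ φ0) := hφ0.comp_inj σ σ.injective
  generalize hg : σ ∘ φ0 = φ2 at hφ2
  have h2a : φ2 a = φ1 a := by rw [← hg]; exact hσa
  have h2c : ∀ e ∈ A, e.1 ∈ V1 → e.2 ∈ V2 → φ1 e.1 ≠ φ1 a → φ2 e.2 ≠ φ1 e.1 := by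
    rw [← hg]; exact hσ
  apply hE.ncol
  refine ⟨fun v => if v ∈ V1 then φ1 v else φ2 v, ?_⟩
  set φ : ℕ → Fin k := fun v => if v ∈ V1 then φ1 v else φ2 v with hφ
  have e1 : ∀ v, v ∈ V1 → φ v = φ1 v := fun v hv => by simp [hφ, hv]
  have e2 : ∀ v, v ∉ V1 → φ v = φ2 v := fun v hv => by simp [hφ, hv]
  have ea : φ a = φ1 a := by rw [e2 a h.a1, h2a]
  intro x hx
  by_cases hxc : φ x = φ1 a
  · have epr : ∀ v, φ v = φ1 a → v ∈ V → φ1 (pr a V2 v) = φ1 a := by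
      intro v hv hvV
      by_cases h2 : v ∈ V2
      · rw [pr_in h2]
      · rw [pr_out h2]
        rcases h.memV.1 hvV with h' | h' | h'
        · rw [h']
        · rw [← e1 v h']; exact hv
        · exact absurd h' h2
    have step : ∀ p q, mono A φ p q → φ p = φ1 a →
        mono (ind A (insert a V2)) φ2 p q ∨ mono (con A a V2) φ1 (pr a V2 p) (pr a V2 q) := by
      intro p q hpq hp
      have hw := hE.wf _ hpq.1
      by_cases hb : pr a V2 p = pr a V2 q
      · left
        have hh : p ∉ V1 ∧ q ∉ V1 := by
          simp only at hw
          constructor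
          · intro hp1
            rw [pr_out (h.n12 hp1)] at hb
            by_cases hq2 : q ∈ V2
            · rw [pr_in hq2] at hb; exact h.a1 (hb ▸ hp1)
            · rw [pr_out hq2] at hb; exact hw.2.2 hb
          · intro hq1
            rw [pr_out (h.n12 hq1)] at hb
            by_cases hp2 : p ∈ V2
            · rw [pr_in hp2] at hb; exact h.a1 (hb.symm ▸ hq1)
            · rw [pr_out hp2] at hb; exact hw.2.2 hb
        refine ⟨mem_ind.2 ⟨hpq.1, ?_, ?_⟩, ?_⟩
        · have := h.memV.1 hw.1; rw [Finset.mem_insert]; simp only at this ⊢; tauto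
        · have := h.memV.1 hw.2.1; rw [Finset.mem_insert]; simp only at this ⊢; tauto
        · rw [← e2 p hh.1, ← e2 q hh.2]; exact hpq.2
      · right
        refine ⟨mem_con.2 ⟨⟨_, hpq.1, rfl⟩, hb⟩, ?_⟩
        rw [epr p hp hw.1, epr q (hpq.2 ▸ hp) hw.2.1]
    have key : ∀ y, TransGen (mono A φ) x y → φ y = φ1 a ∧
        ((TransGen (mono (ind A (insert a V2)) φ2) x y ∧ pr a V2 x = a ∧ pr a V2 y = a) ∨
          TransGen (mono (con A a V2) φ1) (pr a V2 x) (pr a V2 y)) := by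
      have prZ : ∀ v, v ∈ insert a V2 → pr a V2 v = a := by
        intro v hv
        rcases Finset.mem_insert.1 hv with rfl | hv
        · rw [pr_out h.a2]
        · exact pr_in hv
      intro y hy
      induction hy with
      | single hr =>
        refine ⟨hr.2 ▸ hxc, ?_⟩
        rcases step _ _ hr hxc with hs | hs
        · have := mem_ind.1 hs.1
          exact Or.inl ⟨TransGen.single hs, prZ _ this.2.1, prZ _ this.2.2⟩
        · exact Or.inr (TransGen.single hs)
      | tail _ hr ih =>
        refine ⟨hr.2 ▸ ih.1, ?_⟩
        rcases step _ _ hr ih.1 with hs | hs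
        · have hm := mem_ind.1 hs.1
          rcases ih.2 with h' | h'
          · exact Or.inl ⟨h'.1.tail hs, h'.2.1, prZ _ hm.2.2⟩
          · right; exact ((prZ _ hm.2.1).trans (prZ _ hm.2.2).symm) ▸ h'
        · rcases ih.2 with h' | h'
          · right
            have e := h'.2.1.trans h'.2.2.symm
            rw [e]; exact TransGen.single hs
          · exact Or.inr (h'.tail hs)
    rcases (key x hx).2 with h' | h'
    · exact hφ2 _ h'.1
    · exact hφ1 _ h'
  · have hc : ∀ y, TransGen (mono A φ) x y → φ x = φ y ∧ TransGen (fun p q => mono A φ p q ∧ φ p = φ x) x y := by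
      intro y hy
      induction hy with
      | single hr => exact ⟨hr.2, TransGen.single ⟨hr, rfl⟩⟩
      | tail _ hr ih => exact ⟨ih.1.trans hr.2, ih.2.tail ⟨hr, ih.1.symm⟩⟩
    refine acyc_of_nocross (r := fun p q => mono A φ p q ∧ φ p = φ x) (fun v => v ∈ V1) ?_ ?_ ?_ x (hc x hx).2
    · intro p q hpq hp
      by_contra hq
      have hw := hE.wf _ hpq.1.1
      have hq2 : q ∈ V2 := by
        rcases h.memV.1 hw.2.1 with h' | h' | h'
        · simp only at h'
          exfalso; apply hxc
          rw [← hpq.2, hpq.1.2, h', ea]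
        · exact absurd h' hq
        · exact h'
      refine h2c _ hpq.1.1 hp hq2 ?_ ?_
      · simp only; rw [← e1 p hp, hpq.2]; exact hxc
      · simp only; rw [← e1 p hp, ← e2 q hq]; exact hpq.1.2.symm
    · refine acyc_mono ?_ hφ1
      rintro p q ⟨hpq, hp, hq⟩
      refine ⟨mem_con.2 ⟨⟨_, hpq.1.1, ?_⟩, (hE.wf _ hpq.1.1).2.2⟩, ?_⟩
      · simp only; rw [pr_out (h.n12 hp), pr_out (h.n12 hq)]
      · rw [← e1 p hp, ← e1 q hq]; exact hpq.1.2
    · refine acyc_mono ?_ hφ2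
      rintro p q ⟨hpq, hp, hq⟩
      have hw := hE.wf _ hpq.1.1
      refine ⟨mem_ind.2 ⟨hpq.1.1, ?_, ?_⟩, ?_⟩
      · have := h.memV.1 hw.1; rw [Finset.mem_insert]; simp only at this ⊢; tauto
      · have := h.memV.1 hw.2.1; rw [Finset.mem_insert]; simp only at this ⊢; tauto
      · rw [← e2 p hp, ← e2 q hq]; exact hpq.1.2

theorem con_ext (hk : 3 ≤ k) (hE : Ext k V A) (h : SepAt V A a V1 V2) (hc : Conn A V1) :
    Ext k (insert a V1) (con A a V2) := by
  have insV : ∀ {x}, x ∈ insert a V1 → x ∈ V := by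
    intro x hx; rcases Finset.mem_insert.1 hx with h1 | h1
    · exact h.memV.2 (Or.inl h1)
    · exact h.memV.2 (Or.inr (Or.inl h1))
  -- saturation
  have sat : ∀ X ⊆ insert a V1, ∃ Y ⊆ V, (∀ z ∈ V2, z ∈ Y ↔ a ∈ Y) ∧ Y \ V2 = X := by
    intro X hX
    have V2V : V2 ⊆ V := fun x hx => h.memV.2 (Or.inr (Or.inr hx))
    by_cases ha : a ∈ X
    · refine ⟨X ∪ V2, Finset.union_subset (fun x hx => insV (hX hx)) V2V, fun z hz => by simp [hz, ha], ?_⟩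
      ext v; simp only [Finset.mem_sdiff, Finset.mem_union]
      constructor
      · tauto
      · intro hv; exact ⟨Or.inl hv, h.nIns (hX hv)⟩
    · refine ⟨X, fun x hx => insV (hX hx), fun z hz => ?_, ?_⟩
      · constructor
        · intro hzX; exact absurd hz (h.nIns (hX hzX))
        · intro h'; exact absurd h' ha
      · ext v; simp only [Finset.mem_sdiff]
        constructor
        · tauto
        · intro hv; exact ⟨hv, h.nIns (hX hv)⟩
  refine ⟨?_, ?_, ?_, h.con_ncol hk hE, ?_⟩
  · intro f hf
    obtain ⟨⟨e, he, rfl⟩, hne⟩ := mem_con.1 hf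
    have hw := hE.wf e he
    exact ⟨h.prV hw.1, h.prV hw.2.1, hne⟩
  · intro X hX hne hXV
    obtain ⟨Y, hY, hs, rfl⟩ := sat X hX
    rw [h.cut_con hs]
    refine Finset.Nonempty.image (hE.strong Y hY (hne.mono Finset.sdiff_subset) ?_) _
    rintro rfl
    apply hXV
    apply Finset.Subset.antisymm hX
    intro x hx
    exact Finset.mem_sdiff.2 ⟨insV hx, h.nIns hx⟩
  · intro s hs C hC hne hCV
    have hCm : ∀ v ∈ C, v ≠ s ∧ v ∈ insert a V1 := fun v hv => Finset.mem_erase.1 (hC hv)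
    by_cases hsa : s = a
    · subst hsa
      have heq : (insert s V1).erase s = V1 := Finset.erase_insert h.a1
      rw [heq] at hC hCV ⊢
      obtain ⟨e, he, hh⟩ := hc C hC hne hCV
      have : e.1 ∈ V1 ∧ e.2 ∈ V1 := by
        rcases hh with ⟨h1, h2⟩ | ⟨h1, h2⟩
        · exact ⟨hC h1, (Finset.mem_sdiff.1 h2).1⟩
        · exact ⟨(Finset.mem_sdiff.1 h2).1, hC h1⟩
      refine ⟨e, mem_con.2 ⟨⟨e, he, ?_⟩, hE.loop e he⟩, hh⟩
      rw [pr_out (h.n12 this.1), pr_out (h.n12 this.2)]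
    · obtain ⟨Y, hY, hsat, rfl⟩ := sat C (fun v hv => (hCm v hv).2)
      have hsV2 := h.nIns hs
      have hsY : s ∉ Y := fun h' => (hCm s (Finset.mem_sdiff.2 ⟨h', hsV2⟩)).1 rfl
      obtain ⟨e, he, hh⟩ := hE.bic s (insV hs) Y
        (fun v hv => Finset.mem_erase.2 ⟨fun h' => hsY (h' ▸ hv), hY hv⟩)
        (hne.mono Finset.sdiff_subset) (by
          intro h'
          apply hCV
          apply Finset.Subset.antisymm hC
          intro v hv
          rw [Finset.mem_erase] at hv
          rw [Finset.mem_sdiff, h', Finset.mem_erase]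
          exact ⟨⟨hv.1, insV hv.2⟩, h.nIns hv.2⟩)
      have prs : ∀ v, v ∈ V → v ≠ s → pr a V2 v ∈ (insert a V1).erase s := by
        intro v hv hvs
        rw [Finset.mem_erase]
        refine ⟨?_, h.prV hv⟩
        by_cases h2 : v ∈ V2
        · rw [pr_in h2]; exact fun h' => hsa h'.symm
        · rw [pr_out h2]; exact hvs
      have pn : ∀ v, v ∈ V → pr a V2 v ∉ V2 := fun v hv => h.nIns (h.prV hv)
      have pC : ∀ v ∈ Y, pr a V2 v ∈ Y \ V2 := fun v hv =>
        Finset.mem_sdiff.2 ⟨(pr_sat hsat v).2 hv, pn v (hY hv)⟩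
      have pD : ∀ v ∈ V.erase s \ Y, pr a V2 v ∈ (insert a V1).erase s \ (Y \ V2) := by
        intro v hv
        rw [Finset.mem_sdiff, Finset.mem_erase] at hv
        rw [Finset.mem_sdiff]
        exact ⟨prs v hv.1.2 hv.1.1, fun h' => hv.2 ((pr_sat hsat v).1 (Finset.mem_sdiff.1 h').1)⟩
      have cc : (pr a V2 e.1 ∈ Y \ V2 ∧ pr a V2 e.2 ∈ (insert a V1).erase s \ (Y \ V2)) ∨
          (pr a V2 e.2 ∈ Y \ V2 ∧ pr a V2 e.1 ∈ (insert a V1).erase s \ (Y \ V2)) := by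
        rcases hh with ⟨h1, h2⟩ | ⟨h1, h2⟩
        · exact Or.inl ⟨pC _ h1, pD _ h2⟩
        · exact Or.inr ⟨pC _ h1, pD _ h2⟩
      refine ⟨(pr a V2 e.1, pr a V2 e.2), mem_con.2 ⟨⟨e, he, rfl⟩, ?_⟩, cc⟩
      intro h'
      simp only at h'
      rcases cc with ⟨h1, h2⟩ | ⟨h1, h2⟩
      · rw [← h'] at h2; exact (Finset.mem_sdiff.1 h2).2 h1
      · rw [h'] at h2; exact (Finset.mem_sdiff.1 h2).2 h1
  · intro u hu v hv huv
    obtain ⟨Y, hY, huY, hvY, hcard, hs⟩ := h.satsep (by omega) hE hu hv huv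
    refine ⟨Y \ V2, ?_, Finset.mem_sdiff.2 ⟨huY, h.nIns hu⟩, fun h' => hvY (Finset.mem_sdiff.1 h').1, ?_⟩
    · intro x hx
      rw [Finset.mem_sdiff] at hx
      rw [Finset.mem_insert]
      have := h.memV.1 (hY hx.1); tauto
    · rw [h.cut_con hs]; exact Finset.card_image_le.trans hcard

theorem con_inj (hk : 3 ≤ k) (hE : Ext k V A) (h : SepAt V A a V1 V2) (hc : Conn A V1) {Y : Finset ℕ}
    (hs : ∀ z ∈ V2, z ∈ Y ↔ a ∈ Y) (hY : Y ⊆ V) {u v : ℕ} (hu : u ∈ Y) (hu' : u ∈ insert a V1) (hv : v ∉ Y)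
    (hv' : v ∈ insert a V1)
    (hcard : (cut A Y).card ≤ k) {e f : ℕ × ℕ} (he : e ∈ cut A Y) (hf : f ∈ cut A Y)
    (hef : (pr a V2 e.1, pr a V2 e.2) = (pr a V2 f.1, pr a V2 f.2)) : e = f := by
  have h1 := (h.con_ext hk hE hc).cut_ge (by omega) (X := Y \ V2) (by
      intro x hx
      rw [Finset.mem_sdiff] at hx
      rw [Finset.mem_insert]
      have := h.memV.1 (hY hx.1); tauto) ⟨u, Finset.mem_sdiff.2 ⟨hu, h.nIns hu'⟩⟩
      (fun h' => by rw [← h'] at hv'; exact hv (Finset.mem_sdiff.1 hv').1)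
  rw [h.cut_con hs] at h1
  have h2 := Finset.card_image_iff.1 (le_antisymm (Finset.card_image_le (s := cut A Y)
    (f := fun e => (pr a V2 e.1, pr a V2 e.2))) (by omega))
  exact h2 he hf hef

theorem fresh1 (hk : 3 ≤ k) (hE : Ext k V A) (h : SepAt V A a V1 V2) (hc : Conn A V1) {t u : ℕ}
    (ht : t ∈ V1) (hu : u ∈ V2) (htu : (t, u) ∈ A) : (t, a) ∉ A := by
  intro hta
  have hne : t ≠ a := fun h' => h.a1 (h' ▸ ht)
  obtain ⟨Y, hY, h1, h2, hcard, hs⟩ := h.satsep (by omega) hE (u := t) (v := a)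
    (Finset.mem_insert_of_mem ht) (Finset.mem_insert_self _ _) hne
  have huY : u ∉ Y := fun h' => h2 ((hs u hu).1 h')
  have := h.con_inj hk hE hc hs hY h1 (Finset.mem_insert_of_mem ht) h2 (Finset.mem_insert_self _ _) hcard
    (e := (t, u)) (f := (t, a)) (mem_cut.2 ⟨htu, h1, huY⟩) (mem_cut.2 ⟨hta, h1, h2⟩)
    (by simp only; rw [pr_in hu, pr_out h.a2])
  exact h.a2 ((Prod.mk.inj this).2 ▸ hu)

theorem fresh2 (hk : 3 ≤ k) (hE : Ext k V A) (h : SepAt V A a V1 V2) (hc : Conn A V1) {v w : ℕ}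
    (hv : v ∈ V2) (hw : w ∈ V1) (hvw : (v, w) ∈ A) : (a, w) ∉ A := by
  intro haw
  have hne : a ≠ w := fun h' => h.a1 (h' ▸ hw)
  obtain ⟨Y, hY, h1, h2, hcard, hs⟩ := h.satsep (by omega) hE (u := a) (v := w)
    (Finset.mem_insert_self _ _) (Finset.mem_insert_of_mem hw) hne
  have hvY : v ∈ Y := (hs v hv).2 h1
  have := h.con_inj hk hE hc hs hY h1 (Finset.mem_insert_self _ _) h2 (Finset.mem_insert_of_mem hw) hcard
    (e := (v, w)) (f := (a, w)) (mem_cut.2 ⟨hvw, hvY, h2⟩) (mem_cut.2 ⟨haw, h1, h2⟩)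
    (by simp only; rw [pr_in hv, pr_out h.a2])
  exact h.a2 ((Prod.mk.inj this).1 ▸ hv)

theorem con_mem (hE : Ext k V A) (h : SepAt V A a V1 V2) {f : ℕ × ℕ} : f ∈ con A a V2 ↔
    f ∈ ind A (insert a V1) ∨ (f.1 ∈ V1 ∧ f.2 = a ∧ ∃ u ∈ V2, (f.1, u) ∈ A) ∨
    (f.1 = a ∧ f.2 ∈ V1 ∧ ∃ v ∈ V2, (v, f.2) ∈ A) := by
  constructor
  · intro hf
    obtain ⟨⟨e, he, rfl⟩, hne⟩ := mem_con.1 hf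
    have hw := hE.wf e he
    have m1 := h.memV.1 hw.1
    have m2 := h.memV.1 hw.2.1
    by_cases h1 : e.1 ∈ V2 <;> by_cases h2 : e.2 ∈ V2
    · rw [pr_in h1, pr_in h2] at hne; exact absurd rfl hne
    · rw [pr_in h1, pr_out h2] at hne ⊢
      right; right
      refine ⟨rfl, ?_, e.1, h1, he⟩
      simp only at hne ⊢
      rcases m2 with h' | h' | h'
      · exact absurd h'.symm hne
      · exact h'
      · exact absurd h' h2
    · rw [pr_out h1, pr_in h2] at hne ⊢
      right; left
      refine ⟨?_, rfl, e.2, h2, he⟩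
      simp only at hne ⊢
      rcases m1 with h' | h' | h'
      · exact absurd h' hne
      · exact h'
      · exact absurd h' h1
    · rw [pr_out h1, pr_out h2]
      left
      rw [mem_ind]; simp only [Finset.mem_insert]; tauto
  · rintro (hf | ⟨h1, h2, u, hu, hA⟩ | ⟨h1, h2, v, hv, hA⟩)
    · rw [mem_ind] at hf
      refine mem_con.2 ⟨⟨f, hf.1, ?_⟩, hE.loop f hf.1⟩
      rw [pr_out (h.nIns hf.2.1), pr_out (h.nIns hf.2.2)]
    · refine mem_con.2 ⟨⟨_, hA, ?_⟩, fun h' => h.a1 (h2 ▸ h' ▸ h1)⟩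
      simp only; rw [pr_out (h.n12 h1), pr_in hu, ← h2]
    · refine mem_con.2 ⟨⟨_, hA, ?_⟩, fun h' => h.a1 (h1 ▸ h'.symm ▸ h2)⟩
      simp only; rw [pr_out (h.n12 h2), pr_in hv, ← h1]

theorem conn_single (h : SepAt V A a V1 V2) (hc : Conn A (V.erase a))
    (h1 : ∀ c ∈ V1, ∀ d ∈ V2, ∀ c' ∈ V1, ∀ d' ∈ V2, nb A c d → nb A c' d' → c = c') : Conn A V1 := by
  rw [conn_iff] at hc ⊢
  intro C hC hne hCV
  by_contra hno
  push Not at hno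
  have hV1 : V1 ⊆ V.erase a := by rw [← h.un]; exact Finset.subset_union_left
  obtain ⟨z, hz⟩ := h.n2
  have hzV : z ∈ V.erase a := by rw [← h.un]; exact Finset.mem_union_right _ hz
  have toV2 : ∀ D ⊆ V1, D.Nonempty → (∀ c ∈ D, ∀ d ∈ V1, d ∉ D → ¬ nb A c d) → ∃ c ∈ D, ∃ d ∈ V2, nb A c d := by
    intro D hD hDn hDno
    obtain ⟨c, hc', d, hd, hdD, hcd⟩ := hc D (hD.trans hV1) hDn
      (fun h' => h.n21 hz (hD (h'.symm ▸ hzV)))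
    rw [← h.un, Finset.mem_union] at hd
    rcases hd with hd | hd
    · exact absurd hcd (hDno c hc' d hd hdD)
    · exact ⟨c, hc', d, hd, hcd⟩
  obtain ⟨c, hcC, d, hd, hcd⟩ := toV2 C hC hne hno
  obtain ⟨c', hcC', d', hd', hcd'⟩ := toV2 (V1 \ C) Finset.sdiff_subset (by
    rw [Finset.nonempty_iff_ne_empty]; intro h0
    exact hCV (Finset.Subset.antisymm hC (Finset.sdiff_eq_empty_iff_subset.1 h0))) (by
    intro x hx y hy hyn hxy
    rw [Finset.mem_sdiff] at hx hyn
    have : y ∈ C := by by_contra h'; exact hyn ⟨hy, h'⟩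
    exact hno y this x hx.1 hx.2 hxy.symm)
  rw [Finset.mem_sdiff] at hcC'
  have := h1 c (hC hcC) d hd c' hcC'.1 d' hd' hcd hcd'
  exact hcC'.2 (this ▸ hcC)

end SepAt
end Ex

set_option linter.all false
namespace Ex
open Relation

theorem sep_fix {V : Finset ℕ} {A : Finset (ℕ × ℕ)} {a : ℕ} {V1 V2 : Finset ℕ} (h : SepAt V A a V1 V2)
    (hc : Conn A (V.erase a)) (hn : ¬ Conn A V1) :
    ∃ V1' V2', SepAt V A a V1' V2' ∧ Conn A V1' ∧ Conn A V2' := by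
  have hc' := conn_iff.1 hc
  rw [conn_iff] at hn
  push Not at hn
  obtain ⟨C, hC, hne, hCV, hno⟩ := hn
  have hsub : V1 ⊆ V.erase a := by rw [← h.un]; exact Finset.subset_union_left
  have memE : ∀ {v}, v ∈ V.erase a → v ∈ V1 ∨ v ∈ V2 := by
    intro v hv; rw [← h.un] at hv; exact Finset.mem_union.1 hv
  have neE : ∀ X ⊆ V1, X ≠ V.erase a := by
    intro X hX he
    obtain ⟨z, hz⟩ := h.n2
    have : z ∈ V.erase a := by rw [← h.un]; exact Finset.mem_union_right _ hz
    rw [← he] at this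
    exact h.n21 hz (hX this)
  have hne' : (V1 \ C).Nonempty := by
    by_contra h'
    rw [Finset.not_nonempty_iff_eq_empty, Finset.sdiff_eq_empty_iff_subset] at h'
    exact hCV (Finset.Subset.antisymm hC h')
  obtain ⟨c, hcC, d, hdE, hdC, hcd⟩ := hc' C (hC.trans hsub) hne (neE C hC)
  obtain ⟨c', hcC', d', hdE', hdC', hcd'⟩ := hc' (V1 \ C) (Finset.sdiff_subset.trans hsub) hne'
    (neE _ Finset.sdiff_subset)
  have hd : d ∈ V2 := by
    rcases memE hdE with h' | h'
    · exact absurd hcd (hno c hcC d h' hdC)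
    · exact h'
  have hcc' := Finset.mem_sdiff.1 hcC'
  have hd' : d' ∈ V2 := by
    rcases memE hdE' with h' | h'
    · have : d' ∈ C := by
        by_contra hh; exact hdC' (Finset.mem_sdiff.2 ⟨h', hh⟩)
      exact absurd hcd'.symm (hno d' this c' hcc'.1 hcc'.2)
    · exact h'
  have hcV := hC hcC
  have uniq : ∀ c1 ∈ C, ∀ d1 ∈ V2, nb A c1 d1 → c1 = c ∧ d1 = d := by
    intro c1 hc1 d1 hd1 h1
    have hc1V := hC hc1
    have nc1 : c1 ≠ c' := fun h => hcc'.2 (h ▸ hc1)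
    have nc : c ≠ c' := fun h => hcc'.2 (h ▸ hcC)
    have U := h.u12
    have W := h.u21
    rcases hcd with hcd | hcd <;> rcases hcd' with hcd' | hcd' <;> rcases h1 with h1 | h1
    · exact absurd (Prod.mk.inj (U _ hcd _ hcd' hcV hd hcc'.1 hd')).1 nc
    · exact absurd (Prod.mk.inj (U _ hcd _ hcd' hcV hd hcc'.1 hd')).1 nc
    · exact Prod.mk.inj (U _ h1 _ hcd hc1V hd1 hcV hd)
    · exact absurd (Prod.mk.inj (W _ h1 _ hcd' hd1 hc1V hd' hcc'.1)).2 nc1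
    · exact absurd (Prod.mk.inj (U _ h1 _ hcd' hc1V hd1 hcc'.1 hd')).1 nc1
    · exact (Prod.mk.inj (W _ h1 _ hcd hd1 hc1V hd hcV)).symm
    · exact absurd (Prod.mk.inj (W _ hcd _ hcd' hd hcV hd' hcc'.1)).2 nc
    · exact absurd (Prod.mk.inj (W _ hcd _ hcd' hd hcV hd' hcc'.1)).2 nc
  have cross : ∀ x ∈ C, ∀ y ∈ (V1 \ C) ∪ V2, nb A x y → y ∈ V2 := by
    intro x hx y hy hxy
    rcases Finset.mem_union.1 hy with hy | hy
    · have := Finset.mem_sdiff.1 hy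
      exact absurd hxy (hno x hx y this.1 this.2)
    · exact hy
  have hS : SepAt V A a C ((V1 \ C) ∪ V2) := by
    refine ⟨h.ha, hne, h.n2.mono Finset.subset_union_right, ?_, ?_, ?_, ?_⟩
    · rw [Finset.disjoint_left]
      intro x hx hx'
      rcases Finset.mem_union.1 hx' with hx' | hx'
      · exact (Finset.mem_sdiff.1 hx').2 hx
      · exact h.n12 (hC hx) hx'
    · rw [← h.un, ← Finset.union_assoc, Finset.union_sdiff_of_subset hC]
    · intro e he e' he' h1 h2 h3 h4
      exact h.u12 e he e' he' (hC h1) (cross _ h1 _ h2 (Or.inl he)) (hC h3) (cross _ h3 _ h4 (Or.inl he'))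
    · intro e he e' he' h1 h2 h3 h4
      exact h.u21 e he e' he' (cross _ h2 _ h1 (Or.inr he)) (hC h2) (cross _ h4 _ h3 (Or.inr he')) (hC h4)
  refine ⟨_, _, hS, hS.conn_single hc ?_, hS.symm.conn_single hc ?_⟩
  · intro c1 h1 d1 h2 c2 h3 d2 h4 h5 h6
    rw [(uniq c1 h1 d1 (cross _ h1 _ h2 h5) h5).1, (uniq c2 h3 d2 (cross _ h3 _ h4 h6) h6).1]
  · intro d1 h2 c1 h1 d2 h4 c2 h3 h5 h6
    rw [(uniq c1 h1 d1 (cross _ h1 _ h2 h5.symm) h5.symm).2, (uniq c2 h3 d2 (cross _ h3 _ h4 h6.symm) h6.symm).2]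

theorem sep_conn {k : ℕ} {V : Finset ℕ} {A : Finset (ℕ × ℕ)} (hE : Ext k V A) (h : Sep V A) :
    ∃ a V1 V2, SepAt V A a V1 V2 ∧ Conn A V1 ∧ Conn A V2 ∧ ∃ t ∈ V1, ∃ u ∈ V2, (t, u) ∈ A := by
  obtain ⟨a, V1, V2, h⟩ := h
  have hc : Conn A (V.erase a) := hE.bic a h.ha
  have : ∃ V1' V2', SepAt V A a V1' V2' ∧ Conn A V1' ∧ Conn A V2' := by
    by_cases h1 : Conn A V1
    · by_cases h2 : Conn A V2
      · exact ⟨_, _, h, h1, h2⟩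
      · obtain ⟨X, Y, h1, h2, h3⟩ := sep_fix h.symm hc h2
        exact ⟨Y, X, h1.symm, h3, h2⟩
    · exact sep_fix h hc h1
  obtain ⟨X, Y, hS, hX, hY⟩ := this
  have hsub : X ⊆ V.erase a := by rw [← hS.un]; exact Finset.subset_union_left
  have hne : X ≠ V.erase a := by
    intro he
    obtain ⟨z, hz⟩ := hS.n2
    have : z ∈ V.erase a := by rw [← hS.un]; exact Finset.mem_union_right _ hz
    rw [← he] at this
    exact hS.n21 hz this
  obtain ⟨c, hcC, d, hdE, hdC, hcd⟩ := conn_iff.1 hc X hsub hS.n1 hne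
  have hd : d ∈ Y := by
    rw [← hS.un] at hdE
    exact (Finset.mem_union.1 hdE).resolve_left hdC
  rcases hcd with hcd | hcd
  · exact ⟨a, X, Y, hS, hX, hY, c, hcC, d, hd, hcd⟩
  · exact ⟨a, Y, X, hS.symm, hY, hX, d, hd, c, hcC, hcd⟩

/-! transport along a permutation -/
def mapA (σ : Equiv.Perm ℕ) (A : Finset (ℕ × ℕ)) : Finset (ℕ × ℕ) := A.image fun e => (σ e.1, σ e.2)
def mapV (σ : Equiv.Perm ℕ) (V : Finset ℕ) : Finset ℕ := V.image σ

theorem mem_mapA {σ : Equiv.Perm ℕ} {A : Finset (ℕ × ℕ)} {e : ℕ × ℕ} :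
    e ∈ mapA σ A ↔ (σ.symm e.1, σ.symm e.2) ∈ A := by
  unfold mapA
  rw [Finset.mem_image]
  constructor
  · rintro ⟨f, hf, rfl⟩; simpa using hf
  · intro h; exact ⟨_, h, by simp⟩

theorem mem_mapV {σ : Equiv.Perm ℕ} {V : Finset ℕ} {v : ℕ} : v ∈ mapV σ V ↔ σ.symm v ∈ V := by
  unfold mapV
  rw [Finset.mem_image]
  constructor
  · rintro ⟨f, hf, rfl⟩; simpa using hf
  · intro h; exact ⟨_, h, by simp⟩

theorem cut_map {σ : Equiv.Perm ℕ} {A : Finset (ℕ × ℕ)} {X : Finset ℕ} :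
    cut (mapA σ A) (mapV σ X) = mapA σ (cut A X) := by
  ext e
  rw [mem_cut, mem_mapA, mem_mapV, mem_mapV, mem_mapA, mem_cut]

theorem card_mapA {σ : Equiv.Perm ℕ} {A : Finset (ℕ × ℕ)} : (mapA σ A).card = A.card := by
  apply Finset.card_image_of_injective
  intro e f h
  have := Prod.mk.inj h
  exact Prod.ext (σ.injective this.1) (σ.injective this.2)

theorem mapV_inv {σ : Equiv.Perm ℕ} {X : Finset ℕ} : mapV σ (mapV σ.symm X) = X := by
  ext v; rw [mem_mapV, mem_mapV]; simp

theorem Ext.map {k : ℕ} {V : Finset ℕ} {A : Finset (ℕ × ℕ)} (h : Ext k V A) (σ : Equiv.Perm ℕ) :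
    Ext k (mapV σ V) (mapA σ A) := by
  refine ⟨?_, ?_, ?_, ?_, ?_⟩
  · intro e he
    have := h.wf _ (mem_mapA.1 he)
    refine ⟨mem_mapV.2 this.1, mem_mapV.2 this.2.1, fun h' => this.2.2 ?_⟩
    simp only; rw [h']
  · intro X hX hne hXV
    have := h.strong (mapV σ.symm X) ?_ ?_ ?_
    · obtain ⟨e, he⟩ := this
      refine ⟨(σ e.1, σ e.2), ?_⟩
      have := mem_cut.1 he
      rw [mem_mapV, mem_mapV] at this
      rw [mem_cut, mem_mapA]
      simpa using this
    · intro v hv; rw [mem_mapV] at hv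
      have := mem_mapV.1 (hX hv); simpa using this
    · exact hne.image _
    · intro he; apply hXV; rw [← he, mapV_inv]
  · intro s hs C hC hne hCV
    have mE : ∀ v, v ∈ (mapV σ V).erase s ↔ σ.symm v ∈ V.erase (σ.symm s) := by
      intro v; rw [Finset.mem_erase, Finset.mem_erase, mem_mapV]; simp
    have := h.bic (σ.symm s) (mem_mapV.1 hs) (mapV σ.symm C) ?_ ?_ ?_
    · obtain ⟨e, he, h'⟩ := this
      refine ⟨(σ e.1, σ e.2), mem_mapA.2 (by simpa using he), ?_⟩
      simp only [Finset.mem_sdiff, mem_mapV] at h'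
      simp only [Finset.mem_sdiff, mE]
      simpa using h'
    · intro v hv; rw [mem_mapV] at hv
      have := (mE _).1 (hC hv); simpa using this
    · exact hne.image _
    · intro he; apply hCV
      ext v; rw [mE, ← he, mem_mapV]; simp
  · rintro ⟨φ, hφ⟩
    apply h.ncol
    refine ⟨fun v => φ (σ v), fun x hx => hφ (σ x) ?_⟩
    have : ∀ y, TransGen (mono A fun v => φ (σ v)) x y → TransGen (mono (mapA σ A) φ) (σ x) (σ y) := by
      intro y hy
      induction hy with
      | single hr => exact TransGen.single ⟨mem_mapA.2 (by simpa using hr.1), hr.2⟩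
      | tail _ hr ih => exact ih.tail ⟨mem_mapA.2 (by simpa using hr.1), hr.2⟩
    exact this x hx
  · intro u hu v hv huv
    obtain ⟨Y, hY, h1, h2, h3⟩ := h.sep _ (mem_mapV.1 hu) _ (mem_mapV.1 hv)
      (fun h => huv (σ.symm.injective h))
    refine ⟨mapV σ Y, ?_, mem_mapV.2 h1, fun h => h2 (mem_mapV.1 h), ?_⟩
    · intro x hx; exact mem_mapV.2 (hY (mem_mapV.1 hx))
    · rw [cut_map, card_mapA]; exact h3

end Ex

set_option linter.all false
namespace Ex
open Relation

structure DP (R : ℕ → ℕ → Prop) (p : List ℕ) (u v : ℕ) : Prop where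
  nd : p.Nodup
  hd : p.head? = some u
  ls : p.getLast? = some v
  ch : p.IsChain R

theorem DP.form {R p u v} (h : DP R p u v) : ∃ l, p = u :: l := by
  cases p with
  | nil => exact absurd h.hd (by simp)
  | cons x l => exact ⟨l, by have := h.hd; simp at this; rw [this]⟩

theorem dp_of_rtg {R : ℕ → ℕ → Prop} {u v : ℕ} (h : ReflTransGen R u v) : ∃ p, DP R p u v := by
  induction h using ReflTransGen.head_induction_on with
  | refl => exact ⟨[v], ⟨by simp, by simp, by simp, by simp⟩⟩
  | head hr hrest ih =>
    rename_i a c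
    obtain ⟨p, hp⟩ := ih
    by_cases ha : a ∈ p
    · obtain ⟨s, t, rfl⟩ := List.append_of_mem ha
      refine ⟨a :: t, ⟨?_, by simp, ?_, ?_⟩⟩
      · exact (List.nodup_append.1 hp.nd).2.1
      · have := hp.ls; rwa [List.getLast?_append_cons] at this
      · exact hp.ch.right_of_append
    · obtain ⟨l, rfl⟩ := hp.form
      refine ⟨a :: c :: l, ⟨?_, by simp, ?_, ?_⟩⟩
      · exact List.nodup_cons.2 ⟨ha, hp.nd⟩
      · have := hp.ls; rw [List.getLast?_cons_cons]; exact this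
      · exact List.isChain_cons_cons.2 ⟨hr, hp.ch⟩

theorem rtg_of_dp {R : ℕ → ℕ → Prop} : ∀ (l : List ℕ) {u v : ℕ}, (u :: l).getLast? = some v →
    (u :: l).IsChain R → ReflTransGen R u v := by
  intro l
  induction l with
  | nil => intro u v h1 _; simp at h1; rw [h1]
  | cons w l ih =>
    intro u v h1 h2
    rw [List.getLast?_cons_cons] at h1
    have := List.isChain_cons_cons.1 h2
    exact ReflTransGen.head this.1 (ih h1 this.2)

theorem DP.rtg {R p u v} (h : DP R p u v) : ReflTransGen R u v := by
  obtain ⟨l, rfl⟩ := h.form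
  exact rtg_of_dp l h.ls h.ch

def aof (p : List ℕ) : Finset (ℕ × ℕ) := (p.zip p.tail).toFinset

theorem aof_cons (u w : ℕ) (l : List ℕ) : aof (u :: w :: l) = insert (u, w) (aof (w :: l)) := by
  simp [aof]
theorem aof_single (u : ℕ) : aof [u] = ∅ := by simp [aof]

theorem aof_mem {l : List ℕ} {e : ℕ × ℕ} : e ∈ aof l → e.1 ∈ l ∧ e.2 ∈ l := by
  intro h
  simp only [aof, List.mem_toFinset] at h
  have h' : (e.1, e.2) ∈ l.zip l.tail := h
  exact ⟨(List.of_mem_zip h').1, List.mem_of_mem_tail (List.of_mem_zip h').2⟩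

theorem aof_sub {A : Finset (ℕ × ℕ)} : ∀ (l : List ℕ), l.IsChain (fun a b => (a, b) ∈ A) → aof l ⊆ A := by
  intro l
  induction l with
  | nil => intro _; simp [aof]
  | cons u l ih =>
    intro h
    cases l with
    | nil => rw [aof_single]; exact Finset.empty_subset _
    | cons w l =>
      have := List.isChain_cons_cons.1 h
      rw [aof_cons, Finset.insert_subset_iff]
      exact ⟨this.1, ih this.2⟩

theorem dp_all {A : Finset (ℕ × ℕ)} {V : Finset ℕ} (wf : ∀ e ∈ A, e.2 ∈ V) : ∀ (l : List ℕ) {u : ℕ}, u ∈ V →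
    (u :: l).IsChain (fun a b => (a, b) ∈ A) → ∀ x ∈ u :: l, x ∈ V := by
  intro l
  induction l with
  | nil => intro u hu _ x hx; simp at hx; rw [hx]; exact hu
  | cons w l ih =>
    intro u hu h x hx
    have := List.isChain_cons_cons.1 h
    rcases List.mem_cons.1 hx with rfl | hx
    · exact hu
    · exact ih (wf _ this.1) this.2 x hx

theorem DP.cross {Y : Finset ℕ} : ∀ (l : List ℕ) {u v : ℕ}, u ∈ Y → v ∉ Y →
    (u :: l).getLast? = some v → ∃ e ∈ aof (u :: l), e.1 ∈ Y ∧ e.2 ∉ Y := by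
  intro l
  induction l with
  | nil => intro u v h1 h2 h3; simp at h3; exact absurd (h3 ▸ h1) h2
  | cons w l ih =>
    intro u v h1 h2 h3
    rw [List.getLast?_cons_cons] at h3
    rw [aof_cons]
    by_cases hw : w ∈ Y
    · obtain ⟨e, he, h⟩ := ih hw h2 h3
      exact ⟨e, Finset.mem_insert_of_mem he, h⟩
    · exact ⟨(u, w), Finset.mem_insert_self _ _, h1, hw⟩

/-- number of disjoint paths at most the cut -/
theorem menger_le {A : Finset (ℕ × ℕ)} {Y : Finset ℕ} {u v n : ℕ} (hu : u ∈ Y) (hv : v ∉ Y) (P : Fin n → List ℕ)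
    (hP : ∀ i, DP (fun a b => (a, b) ∈ A) (P i) u v)
    (hd : Pairwise fun i j => Disjoint (aof (P i)) (aof (P j))) : n ≤ (cut A Y).card := by
  have : ∀ i, ∃ e, e ∈ aof (P i) ∧ e ∈ cut A Y := by
    intro i
    obtain ⟨l, hl⟩ := (hP i).form
    obtain ⟨e, he, h⟩ := DP.cross (Y := Y) l hu hv (hl ▸ (hP i).ls)
    rw [← hl] at he
    exact ⟨e, he, mem_cut.2 ⟨aof_sub _ (hP i).ch he, h⟩⟩
  choose f hf hf' using this
  have hinj : Function.Injective f := by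
    intro i j hij
    by_contra hne
    exact Finset.disjoint_left.1 (hd hne) (hf i) (hij ▸ hf j)
  calc n = (Finset.univ : Finset (Fin n)).card := by simp
    _ = (Finset.univ.image f).card := (Finset.card_image_of_injective _ hinj).symm
    _ ≤ _ := Finset.card_le_card (by intro e he; obtain ⟨i, _, rfl⟩ := Finset.mem_image.1 he; exact hf' i)

theorem rtg_of_cut {A : Finset (ℕ × ℕ)} {s t : ℕ} (h : ∀ Y : Finset ℕ, s ∈ Y → t ∉ Y → (cut A Y).Nonempty) :
    ReflTransGen (fun a b => (a, b) ∈ A) s t := by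
  classical
  by_contra hn
  obtain ⟨e, he⟩ := h ((insert s (vs A)).filter fun v => ReflTransGen (fun a b => (a, b) ∈ A) s v)
    (by simp [ReflTransGen.refl]) (by simp [hn])
  rw [mem_cut] at he
  simp only [Finset.mem_filter] at he
  apply he.2.2
  exact ⟨Finset.mem_insert_of_mem (mem_vs.2 ⟨e, he.1, Or.inr rfl⟩), he.2.1.2.tail he.1⟩

/-! flows -/
theorem odeg_insert {A : Finset (ℕ × ℕ)} {e : ℕ × ℕ} (h : e ∉ A) (x : ℕ) :
    odeg (insert e A) x = odeg A x + if x = e.1 then 1 else 0 := by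
  unfold odeg
  rw [Finset.filter_insert]
  by_cases hx : e.1 = x
  · rw [if_pos hx, if_pos hx.symm, Finset.card_insert_of_notMem]
    intro h'; exact h (Finset.mem_filter.1 h').1
  · rw [if_neg hx, if_neg (Ne.symm hx)]; simp
theorem ideg_insert {A : Finset (ℕ × ℕ)} {e : ℕ × ℕ} (h : e ∉ A) (x : ℕ) :
    ideg (insert e A) x = ideg A x + if x = e.2 then 1 else 0 := by
  unfold ideg
  rw [Finset.filter_insert]
  by_cases hx : e.2 = x
  · rw [if_pos hx, if_pos hx.symm, Finset.card_insert_of_notMem]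
    intro h'; exact h (Finset.mem_filter.1 h').1
  · rw [if_neg hx, if_neg (Ne.symm hx)]; simp

theorem path_bal : ∀ (l : List ℕ) {u v : ℕ}, (u :: l).Nodup → (u :: l).getLast? = some v → ∀ x,
    odeg (aof (u :: l)) x + (if x = v then 1 else 0) = ideg (aof (u :: l)) x + (if x = u then 1 else 0) := by
  intro l
  induction l with
  | nil =>
    intro u v _ h x
    simp at h
    rw [aof_single, h]
    simp [odeg, ideg]
  | cons w l ih =>
    intro u v hn h x
    rw [List.getLast?_cons_cons] at h
    have hn' := List.nodup_cons.1 hn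
    have hni : (u, w) ∉ aof (w :: l) := fun h' => hn'.1 (aof_mem h').1
    rw [aof_cons, odeg_insert hni, ideg_insert hni]
    have := ih hn'.2 h x
    simp only
    omega

theorem odeg_sdiff {A B : Finset (ℕ × ℕ)} (h : B ⊆ A) (x : ℕ) : odeg (A \ B) x + odeg B x = odeg A x := by
  unfold odeg
  rw [← Finset.card_union_of_disjoint, ← Finset.filter_union, Finset.sdiff_union_of_subset h]
  exact Finset.disjoint_filter_filter Finset.sdiff_disjoint
theorem ideg_sdiff {A B : Finset (ℕ × ℕ)} (h : B ⊆ A) (x : ℕ) : ideg (A \ B) x + ideg B x = ideg A x := by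
  unfold ideg
  rw [← Finset.card_union_of_disjoint, ← Finset.filter_union, Finset.sdiff_union_of_subset h]
  exact Finset.disjoint_filter_filter Finset.sdiff_disjoint

theorem flow_paths {s t : ℕ} (hst : s ≠ t) : ∀ (m : ℕ) (A : Finset (ℕ × ℕ)),
    (∀ x, x ≠ s → x ≠ t → odeg A x = ideg A x) → odeg A s = ideg A s + m →
    ∃ P : Fin m → List ℕ, (∀ i, DP (fun a b => (a, b) ∈ A) (P i) s t) ∧
      Pairwise fun i j => Disjoint (aof (P i)) (aof (P j)) := by
  intro m
  induction m with
  | zero => intro A _ _; exact ⟨fun i => i.elim0, fun i => i.elim0, fun i => i.elim0⟩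
  | succ m ih =>
    intro A hb hs
    have hr : ReflTransGen (fun a b => (a, b) ∈ A) s t := by
      apply rtg_of_cut
      intro Y hsY htY
      have h1 := sum_odeg A Y
      have h2 := sum_ideg (A := A) (V := vs A) (fun e he => ⟨mem_vs.2 ⟨e, he, Or.inl rfl⟩, mem_vs.2 ⟨e, he, Or.inr rfl⟩⟩) Y
      rw [← Finset.add_sum_erase _ _ hsY] at h1 h2
      have h3 : ∑ x ∈ Y.erase s, odeg A x = ∑ x ∈ Y.erase s, ideg A x := by
        apply Finset.sum_congr rfl
        intro x hx
        have := Finset.mem_erase.1 hx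
        exact hb x this.1 (fun h => htY (h ▸ this.2))
      rw [← Finset.card_pos]
      omega
    obtain ⟨p, hp⟩ := dp_of_rtg hr
    obtain ⟨l, rfl⟩ := hp.form
    have hsub := aof_sub _ hp.ch
    have hbal := path_bal l hp.nd hp.ls
    obtain ⟨P, hP, hPd⟩ := ih (A \ aof (s :: l)) (by
      intro x hx hx'
      have h1 := odeg_sdiff hsub x
      have h2 := ideg_sdiff hsub x
      have h3 := hbal x
      have h4 := hb x hx hx'
      rw [if_neg hx, if_neg hx'] at h3
      omega) (by
      have h1 := odeg_sdiff hsub s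
      have h2 := ideg_sdiff hsub s
      have h3 := hbal s
      rw [if_pos rfl, if_neg hst] at h3
      omega)
    refine ⟨Fin.cons (s :: l) P, ?_, ?_⟩
    · intro i
      refine Fin.cases ?_ ?_ i
      · exact hp
      · intro j
        simp only [Fin.cons_succ]
        exact ⟨(hP j).nd, (hP j).hd, (hP j).ls, (hP j).ch.imp fun a b h => (Finset.mem_sdiff.1 h).1⟩
    · have key : ∀ j, Disjoint (aof (s :: l)) (aof (P j)) := by
        intro j
        have := aof_sub _ (hP j).ch
        rw [Finset.disjoint_right]
        intro e he
        exact (Finset.mem_sdiff.1 (this he)).2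
      intro i j
      refine Fin.cases ?_ ?_ i
      · refine Fin.cases ?_ ?_ j
        · intro h; exact absurd rfl h
        · intro j' _; simp only [Fin.cons_succ, Fin.cons_zero]; exact key j'
      · intro i'
        refine Fin.cases ?_ ?_ j
        · intro _; simp only [Fin.cons_succ, Fin.cons_zero]; exact (key i').symm
        · intro j' h; simp only [Fin.cons_succ]
          exact hPd (fun h' => h (by rw [h']))

theorem exists_min_cut {s t m : ℕ} : ∀ (n : ℕ) (A : Finset (ℕ × ℕ)), A.card = n →
    (∀ Y : Finset ℕ, s ∈ Y → t ∉ Y → m ≤ (cut A Y).card) →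
    ∃ B ⊆ A, (∀ Y : Finset ℕ, s ∈ Y → t ∉ Y → m ≤ (cut B Y).card) ∧
      ∀ e ∈ B, ∃ Y : Finset ℕ, s ∈ Y ∧ t ∉ Y ∧ (cut B Y).card ≤ m ∧ e.1 ∈ Y ∧ e.2 ∉ Y := by
  intro n
  induction n with
  | zero =>
    intro A hA h
    rw [Finset.card_eq_zero] at hA
    exact ⟨A, Finset.Subset.refl _, h, by rw [hA]; simp⟩
  | succ n ih =>
    intro A hA h
    by_cases hx : ∃ e ∈ A, ∀ Y : Finset ℕ, s ∈ Y → t ∉ Y → m ≤ (cut (A.erase e) Y).card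
    · obtain ⟨e, he, h'⟩ := hx
      obtain ⟨B, hB, h1⟩ := ih (A.erase e) (by rw [Finset.card_erase_of_mem he]; omega) h'
      exact ⟨B, hB.trans (Finset.erase_subset _ _), h1⟩
    · push Not at hx
      refine ⟨A, Finset.Subset.refl _, h, ?_⟩
      intro e he
      obtain ⟨Y, h1, h2, h3⟩ := hx e he
      have h4 : cut (A.erase e) Y = (cut A Y).erase e := by
        ext f; rw [mem_cut, Finset.mem_erase, Finset.mem_erase, mem_cut]; tauto
      rw [h4] at h3
      have h5 := h Y h1 h2
      by_cases h6 : e ∈ cut A Y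
      · rw [Finset.card_erase_of_mem h6] at h3
        have := mem_cut.1 h6
        exact ⟨Y, h1, h2, by omega, this.2⟩
      · rw [Finset.erase_eq_of_notMem h6] at h3; omega

theorem menger_ge {A : Finset (ℕ × ℕ)} {s t m : ℕ} (hst : s ≠ t)
    (h : ∀ Y : Finset ℕ, s ∈ Y → t ∉ Y → m ≤ (cut A Y).card) :
    ∃ P : Fin m → List ℕ, (∀ i, DP (fun a b => (a, b) ∈ A) (P i) s t) ∧
      Pairwise fun i j => Disjoint (aof (P i)) (aof (P j)) := by
  obtain ⟨B, hBA, hB, ht⟩ := exists_min_cut _ A rfl h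
  have hs0 : ideg B s = 0 := by
    unfold ideg
    rw [Finset.card_eq_zero, Finset.filter_eq_empty_iff]
    intro e he hes
    obtain ⟨Y, h1, _, _, _, h5⟩ := ht e he
    exact h5 (hes ▸ h1)
  have hsm : m ≤ odeg B s := by
    refine (hB {s} (by simp) (by simpa using hst.symm)).trans ?_
    apply Finset.card_le_card
    intro e he
    have := mem_cut.1 he
    exact Finset.mem_filter.2 ⟨this.1, by simpa using this.2.1⟩
  have hbal : ∀ x, x ≠ s → x ≠ t → odeg B x = ideg B x := by
    intro x hxs hxt
    apply le_antisymm
    · -- intersections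
      have hI : ∀ F : Finset (ℕ × ℕ), F ⊆ B.filter (fun e => e.1 = x) → F = ∅ ∨
          ∃ Y : Finset ℕ, s ∈ Y ∧ t ∉ Y ∧ (cut B Y).card ≤ m ∧ x ∈ Y ∧ ∀ e ∈ F, e.2 ∉ Y := by
        intro F
        induction F using Finset.induction_on with
        | empty => intro _; exact Or.inl rfl
        | insert e F _ ih =>
          intro hF
          right
          have he := Finset.mem_filter.1 (hF (Finset.mem_insert_self _ _))
          obtain ⟨Y, h1, h2, h3, h4, h5⟩ := ht e he.1
          rw [he.2] at h4
          rcases ih ((Finset.subset_insert _ _).trans hF) with rfl | ⟨Z, g1, g2, g3, g4, g5⟩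
          · exact ⟨Y, h1, h2, h3, h4, by simpa using h5⟩
          · refine ⟨Y ∩ Z, by simp [h1, g1], by simp [h2], ?_, by simp [h4, g4], ?_⟩
            · have := submod B Y Z
              have := hB (Y ∪ Z) (by simp [h1]) (by simp [h2, g2])
              omega
            · intro f hf
              rcases Finset.mem_insert.1 hf with rfl | hf
              · simp [h5]
              · have := g5 f hf; simp [this]
      rcases hI _ (Finset.Subset.refl _) with h0 | ⟨Y, h1, h2, h3, h4, h5⟩
      · unfold odeg; rw [h0]; simp
      · have h6 := hB (Y.erase x) (Finset.mem_erase.2 ⟨hxs.symm, h1⟩) (fun h => h2 (Finset.mem_of_mem_erase h))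
        have h7 : cut B (Y.erase x) ⊆ (cut B Y \ B.filter (fun e => e.1 = x)) ∪ B.filter (fun e => e.2 = x) := by
          intro e he
          simp only [mem_cut, Finset.mem_union, Finset.mem_sdiff, Finset.mem_filter, Finset.mem_erase] at he ⊢
          tauto
        have h8 : B.filter (fun e => e.1 = x) ⊆ cut B Y := by
          intro e he
          have := Finset.mem_filter.1 he
          exact mem_cut.2 ⟨this.1, this.2 ▸ h4, h5 e he⟩
        have h9 := (Finset.card_le_card h7).trans (Finset.card_union_le _ _)
        rw [Finset.card_sdiff_of_subset h8] at h9
        have h10 := Finset.card_le_card h8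
        unfold odeg ideg
        omega
    · have hI : ∀ F : Finset (ℕ × ℕ), F ⊆ B.filter (fun e => e.2 = x) → F = ∅ ∨
          ∃ Y : Finset ℕ, s ∈ Y ∧ t ∉ Y ∧ (cut B Y).card ≤ m ∧ x ∉ Y ∧ ∀ e ∈ F, e.1 ∈ Y := by
        intro F
        induction F using Finset.induction_on with
        | empty => intro _; exact Or.inl rfl
        | insert e F _ ih =>
          intro hF
          right
          have he := Finset.mem_filter.1 (hF (Finset.mem_insert_self _ _))
          obtain ⟨Y, h1, h2, h3, h4, h5⟩ := ht e he.1
          rw [he.2] at h5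
          rcases ih ((Finset.subset_insert _ _).trans hF) with rfl | ⟨Z, g1, g2, g3, g4, g5⟩
          · exact ⟨Y, h1, h2, h3, h5, by simpa using h4⟩
          · refine ⟨Y ∪ Z, by simp [h1, g1], by simp [h2, g2], ?_, by simp [h5, g4], ?_⟩
            · have := submod B Y Z
              have := hB (Y ∩ Z) (by simp [h1, g1]) (by simp [h2, g2])
              omega
            · intro f hf
              rcases Finset.mem_insert.1 hf with rfl | hf
              · simp [h4]
              · have := g5 f hf; simp [this]
      rcases hI _ (Finset.Subset.refl _) with h0 | ⟨Y, h1, h2, h3, h4, h5⟩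
      · unfold ideg; rw [h0]; simp
      · have h6 := hB (insert x Y) (Finset.mem_insert_of_mem h1)
          (fun h => by rcases Finset.mem_insert.1 h with h | h; exacts [hxt h.symm, h2 h])
        have h7 : cut B (insert x Y) ⊆ (cut B Y \ B.filter (fun e => e.2 = x)) ∪ B.filter (fun e => e.1 = x) := by
          intro e he
          simp only [mem_cut, Finset.mem_union, Finset.mem_sdiff, Finset.mem_filter, Finset.mem_insert] at he ⊢
          tauto
        have h8 : B.filter (fun e => e.2 = x) ⊆ cut B Y := by
          intro e he
          have := Finset.mem_filter.1 he
          exact mem_cut.2 ⟨this.1, h5 e he, this.2 ▸ h4⟩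
        have h9 := (Finset.card_le_card h7).trans (Finset.card_union_le _ _)
        rw [Finset.card_sdiff_of_subset h8] at h9
        have h10 := Finset.card_le_card h8
        unfold odeg ideg
        omega
  obtain ⟨P, hP, hPd⟩ := flow_paths hst (odeg B s) B hbal (by omega)
  refine ⟨fun i => P (Fin.castLE hsm i), fun i => ?_, ?_⟩
  · have := hP (Fin.castLE hsm i)
    exact ⟨this.nd, this.hd, this.ls, this.ch.imp fun a b h => hBA h⟩
  · intro i j hij
    exact hPd (fun h => hij (Fin.castLE_injective hsm h))

end Ex

set_option linter.all false
namespace Ex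
open Relation

theorem chain_color {C : Type} {A : Finset (ℕ × ℕ)} {φ : ℕ → C} : ∀ (l : List ℕ) {u : ℕ},
    (u :: l).IsChain (mono A φ) → ∀ x ∈ u :: l, φ x = φ u := by
  intro l
  induction l with
  | nil => intro u _ x hx; simp at hx; rw [hx]
  | cons w l ih =>
    intro u h x hx
    have := List.isChain_cons_cons.1 h
    rcases List.mem_cons.1 hx with rfl | hx
    · rfl
    · rw [ih this.2 x hx]; exact this.1.2.symm

theorem isDi_col {D : Dgraph} (hW : D.WF) {k : ℕ} {φ : ℕ → Fin k} : D.IsDicolouring k φ ↔ Col D.arcs φ := by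
  constructor
  · intro h x hx
    obtain ⟨y, hxy, hyx⟩ := TransGen.head'_iff.1 hx
    obtain ⟨p, hp⟩ := dp_of_rtg hyx
    obtain ⟨l, rfl⟩ := hp.form
    have hc := chain_color l hp.ch
    have hw := hW _ hxy.1
    have hch : (y :: l).IsChain (fun a b => (a, b) ∈ D.arcs) := hp.ch.imp fun a b h => h.1
    refine h (y :: l) ⟨?_, hp.nd, ?_, hch, ?_⟩ ⟨φ y, hc⟩
    · cases l with
      | nil =>
        have := hp.ls
        simp at this
        exact absurd this.symm hw.2.2
      | cons w l => simp
    · exact dp_all (fun e he => (hW e he).2.1) l hw.2.1 hch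
    · intro a b ha hb
      rw [hp.ls] at ha; rw [hp.hd] at hb
      cases ha; cases hb
      exact hxy.1
  · rintro h p ⟨h1, h2, h3, h4, h5⟩ ⟨c, hc⟩
    cases p with
    | nil => simp at h1
    | cons u l =>
      obtain ⟨v, hv⟩ : ∃ v, (u :: l).getLast? = some v := by
        rw [List.getLast?_cons]; exact ⟨_, rfl⟩
      have hlast : v ∈ u :: l := List.mem_of_getLast? hv
      have hch : (u :: l).IsChain (mono D.arcs φ) := by
        have : ∀ l : List ℕ, (∀ x ∈ l, φ x = c) → l.IsChain (fun a b => (a, b) ∈ D.arcs) → l.IsChain (mono D.arcs φ) := by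
          intro l
          induction l with
          | nil => intro _ _; simp
          | cons a l ih =>
            intro hc h
            cases l with
            | nil => simp
            | cons b l =>
              have := List.isChain_cons_cons.1 h
              refine List.isChain_cons_cons.2 ⟨⟨this.1, ?_⟩, ih (fun x hx => hc x (List.mem_cons_of_mem _ hx)) this.2⟩
              rw [hc a (by simp), hc b (by simp)]
        exact this _ hc h4
      have hr := rtg_of_dp l hv hch
      refine h v (TransGen.head' ⟨h5 v u hv (by simp), ?_⟩ hr)
      rw [hc v hlast, hc u (by simp)]

theorem cut_inter {V : Finset ℕ} {A : Finset (ℕ × ℕ)} (wf : ∀ e ∈ A, e.1 ∈ V ∧ e.2 ∈ V) (Y : Finset ℕ) :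
    cut A (Y ∩ V) = cut A Y := by
  ext e
  simp only [mem_cut, Finset.mem_inter]
  constructor
  · rintro ⟨h1, h2, h3⟩; exact ⟨h1, h2.1, fun h => h3 ⟨h, (wf e h1).2⟩⟩
  · rintro ⟨h1, h2, h3⟩; exact ⟨h1, ⟨h2, (wf e h1).1⟩, fun h => h3 h.1⟩

theorem dp_isDipath {D : Dgraph} (hW : D.WF) {p : List ℕ} {u v : ℕ} (hu : u ∈ D.verts) :
    D.IsDipath p u v ↔ DP (fun a b => (a, b) ∈ D.arcs) p u v := by
  constructor
  · rintro ⟨h1, h2, h3, h4, h5⟩; exact ⟨h1, h2, h3, h5⟩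
  · intro h
    refine ⟨h.nd, h.hd, h.ls, ?_, h.ch⟩
    obtain ⟨l, rfl⟩ := h.form
    exact dp_all (fun e he => (hW e he).2.1) l hu h.ch

theorem loc_bdd {D : Dgraph} {u v : ℕ} (huv : u ≠ v) (Y : Finset ℕ) (hu : u ∈ Y) (hv : v ∉ Y) :
    (cut D.arcs Y).card ∈ upperBounds {n | ∃ P : Fin n → List ℕ, (∀ i, D.IsDipath (P i) u v) ∧
    Pairwise fun i j => Disjoint (Dgraph.arcsOf (P i)) (Dgraph.arcsOf (P j))} := by
  rintro n ⟨P, hP, hd⟩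
  exact menger_le hu hv P (fun i => ⟨(hP i).1, (hP i).2.1, (hP i).2.2.1, (hP i).2.2.2.2⟩) hd

theorem loc_le {D : Dgraph} {u v : ℕ} (huv : u ≠ v) (Y : Finset ℕ) (hu : u ∈ Y) (hv : v ∉ Y) :
    D.locLam u v ≤ (cut D.arcs Y).card := by
  apply csSup_le
  · exact ⟨0, fun i => i.elim0, fun i => i.elim0, fun i => i.elim0⟩
  · exact loc_bdd huv Y hu hv

theorem loc_ge {D : Dgraph} (hW : D.WF) {u v m : ℕ} (huV : u ∈ D.verts) (hvV : v ∈ D.verts) (huv : u ≠ v)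
    (h : ∀ Y ⊆ D.verts, u ∈ Y → v ∉ Y → m ≤ (cut D.arcs Y).card) : m ≤ D.locLam u v := by
  obtain ⟨P, hP, hd⟩ := menger_ge (A := D.arcs) huv (m := m) (by
    intro Y h1 h2
    rw [← cut_inter (fun e he => ⟨(hW e he).1, (hW e he).2.1⟩) Y]
    exact h _ Finset.inter_subset_right (Finset.mem_inter.2 ⟨h1, huV⟩) (fun h => h2 (Finset.mem_inter.1 h).1))
  exact le_csSup ⟨_, loc_bdd huv {u} (by simp) (by simpa using huv.symm)⟩
    ⟨P, fun i => (dp_isDipath hW huV).2 (hP i), hd⟩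

theorem ureach_cross {R : ℕ → ℕ → Prop} {u v : ℕ} (h : ReflTransGen R u v) {C : Finset ℕ} (hu : u ∈ C)
    (hv : v ∉ C) : ∃ x y, R x y ∧ x ∈ C ∧ y ∉ C := by
  induction h with
  | refl => exact absurd hu hv
  | tail _ hr ih =>
    rename_i b c _
    by_cases hb : b ∈ C
    · exact ⟨b, c, hr, hb, hv⟩
    · exact ih hb

theorem ext_of_extremal {k : ℕ} {D : Dgraph} (hW : D.WF) (h : Dgraph.Extremal k D) : Ext k D.verts D.arcs := by
  obtain ⟨⟨hcon, hcv⟩, hst, hchi, hlam⟩ := h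
  refine ⟨hW, ?_, ?_, ?_, ?_⟩
  · intro X hX ⟨u, hu⟩ hne
    obtain ⟨v, hv, hvX⟩ : ∃ v ∈ D.verts, v ∉ X := by
      by_contra hc; push Not at hc
      exact hne (Finset.Subset.antisymm hX hc)
    obtain ⟨p, hp⟩ := hst u (hX hu) v hv (fun h => hvX (h ▸ hu))
    obtain ⟨x, y, hxy, hx, hy⟩ := ureach_cross ((dp_isDipath hW (hX hu)).1 hp).rtg hu hvX
    exact ⟨(x, y), mem_cut.2 ⟨hxy, hx, hy⟩⟩
  · intro s hs C hC ⟨u, hu⟩ hne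
    obtain ⟨v, hv, hvC⟩ : ∃ v ∈ D.verts.erase s, v ∉ C := by
      by_contra hc; push Not at hc
      exact hne (Finset.Subset.antisymm hC hc)
    have hU : (D.delVert s).UConnected := by
      by_contra h; exact hcv s ⟨hs, h⟩
    have mV : ∀ {x}, x ∈ D.verts.erase s → x ∈ (D.delVert s).verts := fun hx =>
      Finset.mem_inter.2 ⟨Finset.mem_of_mem_erase hx, hx⟩
    have := hU.2 u (mV (hC hu)) v (mV hv)
    obtain ⟨x, y, hxy, hx, hy⟩ := ureach_cross this hu hvC
    rcases hxy with hxy | hxy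
    · have := Finset.mem_filter.1 hxy
      exact ⟨(x, y), this.1, Or.inl ⟨hx, Finset.mem_sdiff.2 ⟨this.2.2, hy⟩⟩⟩
    · have := Finset.mem_filter.1 hxy
      exact ⟨(y, x), this.1, Or.inr ⟨hx, Finset.mem_sdiff.2 ⟨this.2.1, hy⟩⟩⟩
  · rintro ⟨φ, hφ⟩
    have : D.dichi ≤ k := Nat.sInf_le ⟨φ, (isDi_col hW).2 hφ⟩
    omega
  · intro u hu v hv huv
    by_contra hc
    push Not at hc
    have h1 : k + 1 ≤ D.locLam u v := loc_ge hW hu hv huv fun Y hY h1 h2 => hc Y hY h1 h2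
    have h2 : D.locLam u v ≤ D.lam := by
      apply le_csSup
      · refine ⟨D.arcs.card, ?_⟩
        rintro n ⟨a, ha, b, hb, hab, rfl⟩
        refine (loc_le hab {a} (by simp) (by simpa using hab.symm)).trans ?_
        exact Finset.card_le_card (Finset.filter_subset _ _)
      · exact ⟨u, hu, v, hv, huv, rfl⟩
    omega

theorem ureach_of_conn {A : Finset (ℕ × ℕ)} {X : Finset ℕ} (h : Conn A X) {u v : ℕ} (hu : u ∈ X) (hv : v ∈ X)
    {R : ℕ → ℕ → Prop} (hR : ∀ x ∈ X, ∀ y ∈ X, nb A x y → R x y) : ReflTransGen R u v := by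
  classical
  by_contra hn
  obtain ⟨c, hc, d, hd, hdn, hcd⟩ := conn_iff.1 h (X.filter fun v => ReflTransGen R u v)
    (Finset.filter_subset _ _) ⟨u, by simp [hu, ReflTransGen.refl]⟩ (by
      intro he
      rw [← he] at hv
      exact hn (Finset.mem_filter.1 hv).2)
  have hc := Finset.mem_filter.1 hc
  exact hdn (Finset.mem_filter.2 ⟨hd, hc.2.tail (hR c hc.1 d hd hcd)⟩)

theorem extremal_of_ext {k : ℕ} (hk : 1 ≤ k) {D : Dgraph} (h : Ext k D.verts D.arcs) : Dgraph.Extremal k D := by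
  have hW : D.WF := h.wf
  have hreach : ∀ u ∈ D.verts, ∀ v ∈ D.verts, ReflTransGen (fun a b => (a, b) ∈ D.arcs) u v := by
    intro u hu v hv
    apply rtg_of_cut
    intro Y h1 h2
    rw [← cut_inter (fun e he => ⟨(hW e he).1, (hW e he).2.1⟩) Y]
    refine h.strong _ Finset.inter_subset_right ⟨u, Finset.mem_inter.2 ⟨h1, hu⟩⟩ ?_
    intro he
    rw [← he] at hv
    exact h2 (Finset.mem_inter.1 hv).1
  obtain ⟨hcrit, hvs⟩ := h.crit (by omega)
  obtain ⟨e, he⟩ := hcrit.nonempty (by omega)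
  have hwe := hW e he
  refine ⟨⟨⟨⟨e.1, hwe.1⟩, ?_⟩, ?_⟩, ?_, ?_, ?_⟩
  · intro u hu v hv
    exact ReflTransGen.mono (fun a b h => Or.inl h) _ _ (hreach u hu v hv)
  · rintro s ⟨hs, hn⟩
    apply hn
    refine ⟨?_, ?_⟩
    · by_cases h1 : e.1 = s
      · have : e.2 ≠ s := fun h => hwe.2.2 (h1.trans h.symm)
        exact ⟨e.2, Finset.mem_inter.2 ⟨hwe.2.1, Finset.mem_erase.2 ⟨this, hwe.2.1⟩⟩⟩
      · exact ⟨e.1, Finset.mem_inter.2 ⟨hwe.1, Finset.mem_erase.2 ⟨h1, hwe.1⟩⟩⟩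
    · intro u hu v hv
      refine ureach_of_conn (A := D.arcs) (X := D.verts.erase s) (h.bic s hs) (Finset.mem_inter.1 hu).2
        (Finset.mem_inter.1 hv).2 ?_
      intro x hx y hy hxy
      rcases hxy with hxy | hxy
      · exact Or.inl (Finset.mem_filter.2 ⟨hxy, hx, hy⟩)
      · exact Or.inr (Finset.mem_filter.2 ⟨hxy, hy, hx⟩)
  · intro u hu v hv huv
    obtain ⟨p, hp⟩ := dp_of_rtg (hreach u hu v hv)
    exact ⟨p, (dp_isDipath hW hu).2 hp⟩
  · apply le_antisymm
    · apply Nat.sInf_le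
      have : Colb (k + 1) D.arcs := by
        by_contra hn
        obtain ⟨Q, hQ, hcQ⟩ := exists_crit hn
        obtain ⟨f, hf⟩ := hcQ.nonempty (by omega)
        have hwf := hW f (hQ hf)
        obtain ⟨Y, hY, h1, h2, h3⟩ := h.sep _ hwf.1 _ hwf.2.1 hwf.2.2
        have h4 := crit_cut (by omega) hcQ (X := Y) ⟨f.1, mem_vs.2 ⟨f, hf, Or.inl rfl⟩, h1⟩
          ⟨f.2, mem_vs.2 ⟨f, hf, Or.inr rfl⟩, h2⟩
        have h5 : (cut Q Y).card ≤ (cut D.arcs Y).card :=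
          Finset.card_le_card (Finset.filter_subset_filter _ hQ)
        omega
      obtain ⟨φ, hφ⟩ := this
      exact ⟨φ, (isDi_col hW).2 hφ⟩
    · by_contra hlt
      push Not at hlt
      have hne : {k | ∃ φ : ℕ → Fin k, D.IsDicolouring k φ}.Nonempty := by
        by_contra hem
        rw [Set.not_nonempty_iff_eq_empty] at hem
        refine absurd hem (Set.Nonempty.ne_empty ?_)
        -- an injective colouring on vertices
        refine ⟨D.verts.sup id + 1, fun v => ⟨min v (D.verts.sup id), by omega⟩, ?_⟩
        rintro p ⟨h1, h2, h3, h4, h5⟩ ⟨c, hc⟩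
        match p, h1 with
        | a :: b :: l, _ =>
          have ha : a ≤ D.verts.sup id := Finset.le_sup (f := id) (h3 a (by simp))
          have hb : b ≤ D.verts.sup id := Finset.le_sup (f := id) (h3 b (by simp))
          have e1 := congrArg Fin.val (hc a (by simp))
          have e2 := congrArg Fin.val (hc b (by simp))
          simp only at e1 e2
          have : a = b := by omega
          have := List.nodup_cons.1 h2
          simp_all
      obtain ⟨φ, hφ⟩ := Nat.sInf_mem hne
      have hle : D.dichi ≤ k := by omega
      apply h.ncol
      refine ⟨fun v => Fin.castLE hle (φ v), ?_⟩
      have := (isDi_col hW).1 hφ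
      exact this.comp_inj (Fin.castLE hle) (Fin.castLE_injective hle)
  · have hloc : ∀ u ∈ D.verts, ∀ v ∈ D.verts, u ≠ v → D.locLam u v = k := by
      intro u hu v hv huv
      apply le_antisymm
      · obtain ⟨Y, hY, h1, h2, h3⟩ := h.sep u hu v hv huv
        exact (loc_le huv Y h1 h2).trans h3
      · apply loc_ge hW hu hv huv
        intro Y hY h1 h2
        exact h.cut_ge (by omega) hY ⟨u, h1⟩ (fun he => h2 (he ▸ hv))
    have : {n | ∃ u ∈ D.verts, ∃ v ∈ D.verts, u ≠ v ∧ n = D.locLam u v} = {k} := by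
      ext n
      simp only [Set.mem_setOf_eq, Set.mem_singleton_iff]
      constructor
      · rintro ⟨u, hu, v, hv, huv, rfl⟩; exact hloc u hu v hv huv
      · rintro rfl; exact ⟨e.1, hwe.1, e.2, hwe.2.1, hwe.2.2, (hloc _ hwe.1 _ hwe.2.1 hwe.2.2).symm⟩
    unfold Dgraph.lam
    rw [this]
    simp

end Ex

set_option linter.all false
namespace Ex
open Relation

theorem mapA_sdiff {σ : Equiv.Perm ℕ} {A B : Finset (ℕ × ℕ)} : mapA σ A \ mapA σ B = mapA σ (A \ B) := by
  ext e; simp only [Finset.mem_sdiff, mem_mapA]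

theorem con_sdiff {k : ℕ} {V : Finset ℕ} {A : Finset (ℕ × ℕ)} {a : ℕ} {V1 V2 : Finset ℕ} (hk : 3 ≤ k)
    (hE : Ext k V A) (h : SepAt V A a V1 V2) (hc : Conn A V1) {S : Finset (ℕ × ℕ)}
    (h1 : ∀ t ∈ V1, ∀ u ∈ V2, (t, u) ∈ A → (t, a) ∈ S) (h2 : ∀ v ∈ V2, ∀ w ∈ V1, (v, w) ∈ A → (a, w) ∈ S)
    (h3 : ∀ e ∈ S, (e.2 = a ∧ e.1 ∈ V1 ∧ ∃ u ∈ V2, (e.1, u) ∈ A) ∨ (e.1 = a ∧ e.2 ∈ V1 ∧ ∃ v ∈ V2, (v, e.2) ∈ A)) :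
    con A a V2 \ S = ind A (insert a V1) := by
  ext ⟨x, y⟩
  rw [Finset.mem_sdiff, h.con_mem hE]
  constructor
  · rintro ⟨h' | ⟨g1, g2, u, hu, g3⟩ | ⟨g1, g2, v, hv, g3⟩, hn⟩
    · exact h'
    · simp only at g1 g2 g3; subst g2; exact absurd (h1 _ g1 u hu g3) hn
    · simp only at g1 g2 g3; subst g1; exact absurd (h2 v hv _ g2 g3) hn
  · intro h'
    refine ⟨Or.inl h', fun hs => ?_⟩
    have hA := (mem_ind.1 h').1
    rcases h3 _ hs with ⟨g1, g2, u, hu, g3⟩ | ⟨g1, g2, v, hv, g3⟩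
    · simp only at g1 g2 g3; subst g1; exact h.fresh1 hk hE hc g2 hu g3 hA
    · simp only at g1 g2 g3; subst g1; exact h.fresh2 hk hE hc hv g2 g3 hA

set_option maxHeartbeats 1000000 in
theorem join_case {k : ℕ} {D : Dgraph} {a : ℕ} {V1 V2 : Finset ℕ} (hk : 3 ≤ k)
    (hE : Ext k D.verts D.arcs) (h : SepAt D.verts D.arcs a V1 V2) (hc1 : Conn D.arcs V1) (hc2 : Conn D.arcs V2)
    {t u : ℕ} (ht : t ∈ V1) (hu : u ∈ V2) (htu : (t, u) ∈ D.arcs) :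
    (∃ D1 D2, Dgraph.IsDirHajosJoin D D1 D2 ∧ Dgraph.Extremal k D1 ∧ Dgraph.Extremal k D2) ∨
    (∃ D1 D2, Dgraph.IsHajosBijoin D D1 D2 ∧ Dgraph.Extremal k D1 ∧ Dgraph.Extremal k D2) := by
  obtain ⟨b, hb⟩ : ∃ b, b ∉ D.verts := Infinite.exists_notMem_finset _
  have sub1 : ∀ {x}, x ∈ V1 → x ∈ D.verts := fun hx => h.memV.2 (Or.inr (Or.inl hx))
  have sub2 : ∀ {x}, x ∈ V2 → x ∈ D.verts := fun hx => h.memV.2 (Or.inr (Or.inr hx))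
  have hab : a ≠ b := fun h' => hb (h' ▸ h.ha)
  set σ : Equiv.Perm ℕ := Equiv.swap a b with hσ
  have σa : σ a = b := Equiv.swap_apply_left _ _
  have σb : σ b = a := Equiv.swap_apply_right _ _
  have σz : ∀ {z}, z ≠ a → z ≠ b → σ z = z := fun h1 h2 => Equiv.swap_apply_of_ne_of_ne h1 h2
  have σs : σ.symm = σ := Equiv.symm_swap _ _
  have n1a : ∀ {x}, x ∈ V1 → x ≠ a := fun hx h' => h.a1 (h' ▸ hx)
  have n2a : ∀ {x}, x ∈ V2 → x ≠ a := fun hx h' => h.a2 (h' ▸ hx)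
  have n1b : ∀ {x}, x ∈ V1 → x ≠ b := fun hx h' => hb (h' ▸ sub1 hx)
  have n2b : ∀ {x}, x ∈ V2 → x ≠ b := fun hx h' => hb (h' ▸ sub2 hx)
  have hE1 := h.con_ext hk hE hc1
  have hE2 := (h.symm.con_ext hk hE hc2).map σ
  have V2eq : mapV σ (insert a V2) = insert b V2 := by
    ext z
    rw [mem_mapV, σs, Finset.mem_insert, Finset.mem_insert]
    by_cases z1 : z = a
    · subst z1
      rw [σa]
      constructor
      · rintro (h' | h')
        · exact absurd h'.symm hab
        · exact absurd rfl (n2b h')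
      · rintro (h' | h')
        · exact absurd h' hab
        · exact absurd h' h.a2
    · by_cases z2 : z = b
      · subst z2; rw [σb]; simp
      · rw [σz z1 z2]; tauto
  have e1V : (insert a V1).erase a = V1 := Finset.erase_insert h.a1
  have e2V : (mapV σ (insert a V2)).erase b = V2 := by
    rw [V2eq]; exact Finset.erase_insert (fun h' => n2b h' rfl)
  have hdis : Disjoint (insert a V1) (mapV σ (insert a V2)) := by
    rw [V2eq, Finset.disjoint_left]
    intro z hz hz'
    rcases Finset.mem_insert.1 hz with rfl | hz <;> rcases Finset.mem_insert.1 hz' with h2 | hz'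
    · exact hab h2
    · exact h.a2 hz'
    · exact n1b hz h2
    · exact h.n12 hz hz'
  have hverts : D.verts = insert a (V1 ∪ V2) := by
    rw [h.un, Finset.insert_erase h.ha]
  have hna : a ∉ V1 ∪ V2 := by
    rw [Finset.mem_union]; rintro (h' | h'); exacts [h.a1 h', h.a2 h']
  -- renaming
  have rz : ∀ {z}, z ≠ b → Dgraph.ren b a (Dgraph.ren a a z) = z := by
    intro z hz; unfold Dgraph.ren; split_ifs <;> simp_all
  have rσ : ∀ {z}, z ≠ b → Dgraph.ren b a (Dgraph.ren a a (σ z)) = z := by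
    intro z hz
    by_cases h1 : z = a
    · subst h1; rw [σa]; unfold Dgraph.ren; split_ifs <;> simp_all
    · rw [σz h1 hz]; exact rz hz
  have himg : (ind D.arcs (insert a V1) ∪ mapA σ (ind D.arcs (insert a V2))).image
      (fun x => Dgraph.renArc b a (Dgraph.renArc a a x)) = ind D.arcs (insert a V1) ∪ ind D.arcs (insert a V2) := by
    have hI : ∀ {X f}, f ∈ ind D.arcs X → f.1 ≠ b ∧ f.2 ≠ b := by
      intro X f hf
      have := hE.wf _ (mem_ind.1 hf).1
      exact ⟨fun h => hb (h ▸ this.1), fun h => hb (h ▸ this.2.1)⟩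
    rw [Finset.image_union]
    congr 1
    · conv_rhs => rw [← Finset.image_id (s := ind D.arcs (insert a V1))]
      apply Finset.image_congr
      intro f hf
      have := hI hf
      simp only [Dgraph.renArc, rz this.1, rz this.2, id]
    · unfold mapA
      rw [Finset.image_image]
      conv_rhs => rw [← Finset.image_id (s := ind D.arcs (insert a V2))]
      apply Finset.image_congr
      intro f hf
      have := hI hf
      simp only [Dgraph.renArc, Function.comp, rσ this.1, rσ this.2, id]
  have hW1 : (⟨insert a V1, con D.arcs a V2⟩ : Dgraph).WF := hE1.wf
  have hW2 : (⟨mapV σ (insert a V2), mapA σ (con D.arcs a V1)⟩ : Dgraph).WF := hE2.wf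
  have X1 := extremal_of_ext (D := ⟨insert a V1, con D.arcs a V2⟩) (by omega) hE1
  have X2 := extremal_of_ext (D := ⟨mapV σ (insert a V2), mapA σ (con D.arcs a V1)⟩) (by omega) hE2
  have u12 : ∀ x ∈ V1, ∀ y ∈ V2, (x, y) ∈ D.arcs → x = t ∧ y = u := fun x hx y hy hxy =>
    Prod.mk.inj (h.u12 _ hxy _ htu hx hy ht hu)
  have mta : (t, a) ∈ con D.arcs a V2 := (h.con_mem hE).2 (Or.inr (Or.inl ⟨ht, rfl, u, hu, htu⟩))
  have mau : (a, u) ∈ con D.arcs a V1 := (h.symm.con_mem hE).2 (Or.inr (Or.inr ⟨rfl, hu, t, ht, htu⟩))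
  have mbu : (b, u) ∈ mapA σ (con D.arcs a V1) := by
    rw [mem_mapA, σs]; simp only; rw [σb, σz (n2a hu) (n2b hu)]; exact mau
  have inV : ∀ x y, (x, y) ∈ D.arcs → (x ∈ V1 ∧ y ∈ V2) ∨ (x ∈ V2 ∧ y ∈ V1) ∨
      (x, y) ∈ ind D.arcs (insert a V1) ∪ ind D.arcs (insert a V2) := by
    intro x y hxy
    have hw := hE.wf _ hxy
    have g1 := h.memV.1 hw.1
    have g2 := h.memV.1 hw.2.1
    simp only [Finset.mem_union, mem_ind, Finset.mem_insert, hxy, true_and]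
    simp only at g1 g2
    clear himg hW1 hW2 X1 X2 hE1 hE2 u12 mta mau mbu
    rcases g1 with g1 | g1 | g1 <;> rcases g2 with g2 | g2 | g2 <;> simp only [g1, g2, true_or, or_true, true_and, and_true]
  have outV : ∀ {x y}, (x, y) ∈ ind D.arcs (insert a V1) ∪ ind D.arcs (insert a V2) → (x, y) ∈ D.arcs := by
    intro x y hxy
    rcases Finset.mem_union.1 hxy with h' | h' <;> exact (mem_ind.1 h').1
  by_cases hvw : ∃ v ∈ V2, ∃ w ∈ V1, (v, w) ∈ D.arcs
  · obtain ⟨v, hv, w, hw, hvw⟩ := hvw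
    have u21 : ∀ x ∈ V2, ∀ y ∈ V1, (x, y) ∈ D.arcs → x = v ∧ y = w := fun x hx y hy hxy =>
      Prod.mk.inj (h.u21 _ hxy _ hvw hx hy hv hw)
    right
    refine ⟨_, _, ⟨t, a, w, v, b, u, a, hW1, hW2, hdis, mta, ?_, ?_, mbu, ?_, ?_, ?_, ?_, ?_⟩, X1, X2⟩
    · exact (h.con_mem hE).2 (Or.inr (Or.inr ⟨rfl, hw, v, hv, hvw⟩))
    · show (v, b) ∈ mapA σ (con D.arcs a V1)
      rw [mem_mapA, σs]; simp only; rw [σb, σz (n2a hv) (n2b hv)]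
      exact (h.symm.con_mem hE).2 (Or.inr (Or.inl ⟨hv, rfl, w, hw, hvw⟩))
    · refine ureach_of_conn hc1 ht hw ?_
      have key : ∀ x ∈ V1, ∀ y ∈ V1, (x, y) ∈ D.arcs →
          (x, y) ∈ ((⟨insert a V1, con D.arcs a V2⟩ : Dgraph).delVert a).arcs := by
        intro x hx y hy hxy
        refine Finset.mem_filter.2 ⟨(h.con_mem hE).2 (Or.inl (mem_ind.2 ⟨hxy, ?_, ?_⟩)), ?_⟩
        · exact Finset.mem_insert_of_mem hx
        · exact Finset.mem_insert_of_mem hy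
        · simp only; rw [e1V]; exact ⟨hx, hy⟩
      intro x hx y hy hxy
      exact hxy.imp (key x hx y hy) (key y hy x hx)
    · refine ureach_of_conn hc2 hu hv ?_
      have key : ∀ x ∈ V2, ∀ y ∈ V2, (x, y) ∈ D.arcs →
          (x, y) ∈ ((⟨mapV σ (insert a V2), mapA σ (con D.arcs a V1)⟩ : Dgraph).delVert b).arcs := by
        intro x hx y hy hxy
        refine Finset.mem_filter.2 ⟨?_, ?_⟩
        · show (x, y) ∈ mapA σ (con D.arcs a V1)
          rw [mem_mapA, σs]; simp only; rw [σz (n2a hx) (n2b hx), σz (n2a hy) (n2b hy)]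
          exact (h.symm.con_mem hE).2 (Or.inl (mem_ind.2 ⟨hxy, Finset.mem_insert_of_mem hx, Finset.mem_insert_of_mem hy⟩))
        · simp only; rw [e2V]; exact ⟨hx, hy⟩
      intro x hx y hy hxy
      exact hxy.imp (key x hx y hy) (key y hy x hx)
    · simp only; rw [e1V, e2V]; exact hna
    · simp only; rw [e1V, e2V]; exact hverts
    · have q1 : con D.arcs a V2 \ {(t, a), (a, w)} = ind D.arcs (insert a V1) := by
        apply con_sdiff hk hE h hc1
        · intro x hx y hy hxy; rw [(u12 x hx y hy hxy).1]; simp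
        · intro x hx y hy hxy; rw [(u21 x hx y hy hxy).2]; simp
        · intro e he
          rcases Finset.mem_insert.1 he with rfl | he
          · exact Or.inl ⟨rfl, ht, u, hu, htu⟩
          · rw [Finset.mem_singleton] at he; subst he
            exact Or.inr ⟨rfl, hw, v, hv, hvw⟩
      have q2 : con D.arcs a V1 \ {(v, a), (a, u)} = ind D.arcs (insert a V2) := by
        apply con_sdiff hk hE h.symm hc2
        · intro x hx y hy hxy; rw [(u21 x hx y hy hxy).1]; simp
        · intro x hx y hy hxy; rw [(u12 x hx y hy hxy).2]; simp
        · intro e he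
          rcases Finset.mem_insert.1 he with rfl | he
          · exact Or.inl ⟨rfl, hv, w, hw, hvw⟩
          · rw [Finset.mem_singleton] at he; subst he
            exact Or.inr ⟨rfl, hu, t, ht, htu⟩
      have q3 : mapA σ (con D.arcs a V1) \ {(v, b), (b, u)} = mapA σ (ind D.arcs (insert a V2)) := by
        rw [← q2, ← mapA_sdiff]
        congr 1
        simp [mapA, σa, σz (n2a hv) (n2b hv), σz (n2a hu) (n2b hu)]
      simp only
      rw [q1, q3, himg]
      ext ⟨x, y⟩
      rw [Finset.mem_insert, Finset.mem_insert]
      constructor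
      · intro hxy
        rcases inV x y hxy with ⟨g1, g2⟩ | ⟨g1, g2⟩ | g
        · left; obtain ⟨rfl, rfl⟩ := u12 x g1 y g2 hxy; rfl
        · right; left; obtain ⟨rfl, rfl⟩ := u21 x g1 y g2 hxy; rfl
        · exact Or.inr (Or.inr g)
      · rintro (g | g | g)
        · rw [g]; exact htu
        · rw [g]; exact hvw
        · exact outV g
  · left
    push Not at hvw
    refine ⟨_, _, ⟨t, a, b, u, a, hW1, hW2, hdis, mta, mbu, ?_, ?_, ?_⟩, X1, X2⟩
    · simp only; rw [e1V, e2V]; exact hna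
    · simp only; rw [e1V, e2V]; exact hverts
    · have q1 : (con D.arcs a V2).erase (t, a) = ind D.arcs (insert a V1) := by
        rw [← Finset.sdiff_singleton_eq_erase]
        apply con_sdiff hk hE h hc1
        · intro x hx y hy hxy; rw [(u12 x hx y hy hxy).1]; simp
        · intro x hx y hy hxy; exact absurd hxy (hvw x hx y hy)
        · intro e he
          rw [Finset.mem_singleton] at he; subst he
          exact Or.inl ⟨rfl, ht, u, hu, htu⟩
      have q2 : (con D.arcs a V1).erase (a, u) = ind D.arcs (insert a V2) := by
        rw [← Finset.sdiff_singleton_eq_erase]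
        apply con_sdiff hk hE h.symm hc2
        · intro x hx y hy hxy; exact absurd hxy (hvw x hx y hy)
        · intro x hx y hy hxy; rw [(u12 x hx y hy hxy).2]; simp
        · intro e he
          rw [Finset.mem_singleton] at he; subst he
          exact Or.inr ⟨rfl, hu, t, ht, htu⟩
      have q3 : (mapA σ (con D.arcs a V1)).erase (b, u) = mapA σ (ind D.arcs (insert a V2)) := by
        rw [← q2, ← Finset.sdiff_singleton_eq_erase, ← Finset.sdiff_singleton_eq_erase, ← mapA_sdiff]
        congr 1
        simp [mapA, σa, σz (n2a hu) (n2b hu)]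
      simp only
      rw [q1, q3, himg]
      ext ⟨x, y⟩
      rw [Finset.mem_insert]
      constructor
      · intro hxy
        rcases inV x y hxy with ⟨g1, g2⟩ | ⟨g1, g2⟩ | g
        · left; obtain ⟨rfl, rfl⟩ := u12 x g1 y g2 hxy; rfl
        · exact absurd hxy (hvw x g1 y g2)
        · exact Or.inr g
      · rintro (g | g)
        · rw [g]; exact htu
        · exact outV g

end Ex

set_option linter.all false
namespace Ex
open Relation

theorem cyc_mem {n : ℕ} (f : ℕ → ℕ) {e : ℕ × ℕ} :
    e ∈ Dgraph.cycArcs ((List.range n).map f) ↔ ∃ i < n, e = (f i, f ((i + 1) % n)) := by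
  unfold Dgraph.cycArcs
  rw [List.mem_toFinset, List.mem_iff_getElem]
  constructor
  · rintro ⟨i, hi, rfl⟩
    have hi' : i < n := by simpa using hi
    refine ⟨i, hi', ?_⟩
    simp [List.getElem_zip, List.getElem_rotate]
  · rintro ⟨i, hi, rfl⟩
    refine ⟨i, by simpa using hi, ?_⟩
    simp [List.getElem_zip, List.getElem_rotate]

theorem cyc_build {W : Finset ℕ} {H : Finset (ℕ × ℕ)} (hne : W.Nonempty)
    (wf : ∀ a b, (a, b) ∈ H → a ∈ W ∧ b ∈ W ∧ a ≠ b) (sym : ∀ a b, (a, b) ∈ H → (b, a) ∈ H)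
    (two : ∀ y ∈ W, ∃ c d, c ≠ d ∧ ∀ v, (y, v) ∈ H ↔ v = c ∨ v = d) (hc : Conn H W) :
    ∃ (n : ℕ) (f : ℕ → ℕ), 3 ≤ n ∧ (∀ i < n, ∀ j < n, f i = f j → i = j) ∧ (∀ v, v ∈ W ↔ ∃ i < n, v = f i) ∧
      ∀ a b, (a, b) ∈ H ↔ ∃ i < n, (a = f i ∧ b = f ((i + 1) % n)) ∨ (b = f i ∧ a = f ((i + 1) % n)) := by
  classical
  let P : ℕ → Prop := fun n => ∃ f : ℕ → ℕ, (∀ i < n, ∀ j < n, f i = f j → i = j) ∧ (∀ i < n, f i ∈ W) ∧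
    ∀ i, i + 1 < n → (f i, f (i + 1)) ∈ H
  obtain ⟨w0, hw0⟩ := hne
  have P1 : P 1 := ⟨fun _ => w0, fun i hi j hj _ => by omega, fun _ _ => hw0, fun i hi => by omega⟩
  have Pb : ∀ n, P n → n ≤ W.card := by
    rintro n ⟨f, h1, h2, _⟩
    calc n = (Finset.range n).card := by simp
      _ = ((Finset.range n).image f).card := by
          rw [Finset.card_image_of_injOn]
          intro i hi j hj hij
          exact h1 i (by simpa using hi) j (by simpa using hj) hij
      _ ≤ _ := Finset.card_le_card (by
          intro v hv
          obtain ⟨i, hi, rfl⟩ := Finset.mem_image.1 hv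
          exact h2 i (by simpa using hi))
  obtain ⟨n, hPn, hmax, hn1⟩ : ∃ n, P n ∧ ¬ P (n + 1) ∧ 1 ≤ n := by
    have hsp := Nat.findGreatest_spec (P := P) (Pb 1 P1) P1
    refine ⟨Nat.findGreatest P W.card, hsp, fun h' => ?_, Nat.le_findGreatest (Pb 1 P1) P1⟩
    have := Nat.le_findGreatest (Pb _ h') h'
    omega
  obtain ⟨f, inj, fW, fH⟩ := hPn
  have nbr2 : ∀ {y c d v}, (y, c) ∈ H → (y, d) ∈ H → c ≠ d → (y, v) ∈ H → v = c ∨ v = d := by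
    intro y c d v h1 h2 hcd h3
    obtain ⟨p, q, hpq, hh⟩ := two y (wf _ _ h1).1
    rw [hh] at h1 h2 h3
    omega
  -- neighbours of the last vertex are on the path
  have hlast : ∀ v, (f (n - 1), v) ∈ H → ∃ j < n, v = f j := by
    intro v hv
    by_contra hno
    push Not at hno
    apply hmax
    refine ⟨fun i => if i < n then f i else v, ?_, ?_, ?_⟩
    · intro i hi j hj hij
      by_cases h1 : i < n <;> by_cases h2 : j < n
      · simp only [h1, h2, if_true] at hij; exact inj i h1 j h2 hij
      · simp only [h1, h2, if_true, if_false] at hij; exact absurd hij.symm (hno i h1)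
      · simp only [h1, h2, if_true, if_false] at hij; exact absurd hij (hno j h2)
      · omega
    · intro i hi
      by_cases h1 : i < n
      · simp only [h1, if_true]; exact fW i h1
      · simp only [h1, if_false]; exact (wf _ _ hv).2.1
    · intro i hi
      by_cases h2 : i + 1 < n
      · have h1 : i < n := by omega
        simp only [h1, h2, if_true]; exact fH i h2
      · have h1 : i < n := by omega
        simp only [h1, h2, if_true, if_false]
        have : i = n - 1 := by omega
        rw [this]; exact hv
  have hn3 : 3 ≤ n := by
    obtain ⟨c, d, hcd, hh⟩ := two _ (fW (n - 1) (by omega))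
    have h1 := (hh c).2 (Or.inl rfl)
    have h2 := (hh d).2 (Or.inr rfl)
    obtain ⟨i, hi, rfl⟩ := hlast c h1
    obtain ⟨j, hj, rfl⟩ := hlast d h2
    have g1 := (wf _ _ h1).2.2
    have g2 := (wf _ _ h2).2.2
    have : i ≠ n - 1 := fun h => g1 (by rw [h])
    have : j ≠ n - 1 := fun h => g2 (by rw [h])
    have : i ≠ j := fun h => hcd (by rw [h])
    omega
  have hinner : ∀ i, 0 < i → i + 1 < n → ∀ v, (f i, v) ∈ H → v = f (i - 1) ∨ v = f (i + 1) := by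
    intro i h0 h1 v hv
    have g1 : (f i, f (i - 1)) ∈ H := by
      apply sym
      have := fH (i - 1) (by omega)
      rwa [show i - 1 + 1 = i by omega] at this
    refine nbr2 g1 (fH i h1) ?_ hv
    intro h
    have := inj _ (by omega) _ h1 h
    omega
  have hpen : (f (n - 1), f (n - 2)) ∈ H := by
    apply sym
    have := fH (n - 2) (by omega)
    rwa [show n - 2 + 1 = n - 1 by omega] at this
  have hclose : (f (n - 1), f 0) ∈ H := by
    obtain ⟨v, hv, hvn⟩ : ∃ v, (f (n - 1), v) ∈ H ∧ v ≠ f (n - 2) := by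
      obtain ⟨c, d, hcd, hh⟩ := two _ (fW (n - 1) (by omega))
      by_cases h : c = f (n - 2)
      · exact ⟨d, (hh d).2 (Or.inr rfl), fun h' => hcd (h.trans h'.symm)⟩
      · exact ⟨c, (hh c).2 (Or.inl rfl), h⟩
    obtain ⟨j, hj, rfl⟩ := hlast v hv
    have h1 : j ≠ n - 2 := fun h => hvn (by rw [h])
    have h2 : j ≠ n - 1 := fun h => (wf _ _ hv).2.2 (by rw [h])
    by_cases h0 : j = 0
    · rw [h0] at hv; exact hv
    · exfalso
      rcases hinner j (by omega) (by omega) _ (sym _ _ hv) with h | h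
      · have := inj _ (by omega) _ (by omega) h; omega
      · have := inj _ (by omega) _ (by omega) h; omega
  have hstep : ∀ i < n, (f i, f ((i + 1) % n)) ∈ H := by
    intro i hi
    by_cases h : i + 1 < n
    · rw [Nat.mod_eq_of_lt h]; exact fH i h
    · have : i + 1 = n := by omega
      rw [this, Nat.mod_self, show i = n - 1 by omega]; exact hclose
  have hall : ∀ i < n, ∀ v, (f i, v) ∈ H → v = f ((i + 1) % n) ∨ ∃ j < n, v = f j ∧ i = (j + 1) % n := by
    intro i hi v hv
    by_cases h0 : i = 0
    · subst h0
      have h1 : (f 0, f (n - 1)) ∈ H := sym _ _ hclose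
      have h2 := fH 0 (by omega)
      rcases nbr2 h1 h2 (fun h => by have := inj _ (by omega) _ (by omega) h; omega) hv with h | h
      · right; refine ⟨n - 1, by omega, h, ?_⟩
        rw [show n - 1 + 1 = n by omega, Nat.mod_self]
      · left; rw [h, Nat.mod_eq_of_lt (by omega)]
    · by_cases h1 : i + 1 < n
      · rcases hinner i (by omega) h1 v hv with h | h
        · right; refine ⟨i - 1, by omega, h, ?_⟩
          rw [show i - 1 + 1 = i by omega, Nat.mod_eq_of_lt hi]
        · left; rw [h, Nat.mod_eq_of_lt h1]
      · have hin : i = n - 1 := by omega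
        subst hin
        rcases nbr2 hpen hclose (fun h => by have := inj _ (by omega) _ (by omega) h; omega) hv with h | h
        · right; refine ⟨n - 2, by omega, h, ?_⟩
          rw [show n - 2 + 1 = n - 1 by omega, Nat.mod_eq_of_lt (by omega)]
        · left; rw [h, show n - 1 + 1 = n by omega, Nat.mod_self]
  have hW : ∀ v, v ∈ W ↔ ∃ i < n, v = f i := by
    have hsub : (Finset.range n).image f ⊆ W := by
      intro v hv
      obtain ⟨i, hi, rfl⟩ := Finset.mem_image.1 hv
      exact fW i (by simpa using hi)
    have heq : (Finset.range n).image f = W := by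
      by_contra hne
      obtain ⟨c, hcC, d, hdW, hdC, hcd⟩ := conn_iff.1 hc _ hsub
        ⟨f 0, Finset.mem_image.2 ⟨0, by simp; omega, rfl⟩⟩ hne
      obtain ⟨i, hi, rfl⟩ := Finset.mem_image.1 hcC
      rw [Finset.mem_range] at hi
      have hh : (f i, d) ∈ H := by
        rcases hcd with h | h
        · exact h
        · exact sym _ _ h
      apply hdC
      rcases hall i hi d hh with h | ⟨j, hj, h, _⟩
      · exact Finset.mem_image.2 ⟨(i + 1) % n, Finset.mem_range.2 (Nat.mod_lt _ (by omega)), h.symm⟩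
      · exact Finset.mem_image.2 ⟨j, Finset.mem_range.2 hj, h.symm⟩
    intro v
    rw [← heq, Finset.mem_image]
    constructor
    · rintro ⟨i, hi, rfl⟩; exact ⟨i, by simpa using hi, rfl⟩
    · rintro ⟨i, hi, rfl⟩; exact ⟨i, by simpa using hi, rfl⟩
  refine ⟨n, f, hn3, inj, hW, ?_⟩
  intro a b
  constructor
  · intro hab
    obtain ⟨i, hi, rfl⟩ := (hW a).1 (wf _ _ hab).1
    rcases hall i hi b hab with h | ⟨j, hj, h, h'⟩
    · exact ⟨i, hi, Or.inl ⟨rfl, h⟩⟩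
    · exact ⟨j, hj, Or.inr ⟨h, by rw [← h']⟩⟩
  · rintro ⟨i, hi, ⟨rfl, rfl⟩ | ⟨rfl, rfl⟩⟩
    · exact hstep i hi
    · exact sym _ _ (hstep i hi)

theorem wheel_case {D : Dgraph} (hE : Ext 3 D.verts D.arcs) (h : AWheel D.verts D.arcs) : Dgraph.IsSymOddWheel D := by
  classical
  obtain ⟨x, hx, hfull, hsym, hdeg⟩ := h
  set V := D.verts with hV
  set A := D.arcs with hA
  set H := ind A (V.erase x) with hH
  have memH : ∀ a b, (a, b) ∈ H ↔ (a, b) ∈ A ∧ a ≠ x ∧ b ≠ x := by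
    intro a b
    rw [hH, mem_ind, Finset.mem_erase, Finset.mem_erase]
    constructor
    · rintro ⟨h1, h2, h3⟩; exact ⟨h1, h2.1, h3.1⟩
    · rintro ⟨h1, h2, h3⟩
      have := hE.wf _ h1
      exact ⟨h1, ⟨h2, this.1⟩, h3, this.2.1⟩
  have wfH : ∀ a b, (a, b) ∈ H → a ∈ V.erase x ∧ b ∈ V.erase x ∧ a ≠ b := by
    intro a b hab
    have := (memH a b).1 hab
    have hw := hE.wf _ this.1
    exact ⟨Finset.mem_erase.2 ⟨this.2.1, hw.1⟩, Finset.mem_erase.2 ⟨this.2.2, hw.2.1⟩, hw.2.2⟩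
  have symH : ∀ a b, (a, b) ∈ H → (b, a) ∈ H := by
    intro a b hab
    have := (memH a b).1 hab
    exact (memH b a).2 ⟨hsym _ _ this.1, this.2.2, this.2.1⟩
  have hne : (V.erase x).Nonempty := by
    obtain ⟨hcrit, hvs⟩ := hE.crit (by omega)
    obtain ⟨e, he⟩ := hcrit.nonempty (by omega)
    have hw := hE.wf e he
    by_cases h1 : e.1 = x
    · exact ⟨e.2, Finset.mem_erase.2 ⟨fun h => hw.2.2 (h1.trans h.symm), hw.2.1⟩⟩
    · exact ⟨e.1, Finset.mem_erase.2 ⟨h1, hw.1⟩⟩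
  have two : ∀ y ∈ V.erase x, ∃ c d, c ≠ d ∧ ∀ v, (y, v) ∈ H ↔ v = c ∨ v = d := by
    intro y hy
    have hy' := Finset.mem_erase.1 hy
    apply out_two
    have h3 := hdeg y hy'.2 hy'.1
    unfold odeg at h3 ⊢
    have : H.filter (fun e => e.1 = y) = (A.filter (fun e => e.1 = y)).erase (y, x) := by
      ext ⟨p, q⟩
      rw [Finset.mem_erase, Finset.mem_filter, Finset.mem_filter, memH]
      simp only [ne_eq, Prod.mk.injEq]
      constructor
      · rintro ⟨⟨h1, h2, h3⟩, h4⟩; exact ⟨fun h => h3 h.2, h1, h4⟩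
      · rintro ⟨h1, h2, h3⟩
        exact ⟨⟨h2, fun h => hy'.1 (h3 ▸ h), fun h => h1 ⟨h3, h⟩⟩, h3⟩
    rw [this, Finset.card_erase_of_mem, h3]
    exact Finset.mem_filter.2 ⟨(hfull y hy'.2 hy'.1).2, rfl⟩
  have hc : Conn H (V.erase x) := by
    have hc0 : Conn A (V.erase x) := hE.bic x hx
    rw [conn_iff] at hc0 ⊢
    intro C hC h1 h2
    obtain ⟨c, hc, d, hd, hdC, hcd⟩ := hc0 C hC h1 h2
    refine ⟨c, hc, d, hd, hdC, ?_⟩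
    have g1 := (Finset.mem_erase.1 (hC hc)).1
    have g2 := (Finset.mem_erase.1 hd).1
    exact hcd.imp (fun h => (memH _ _).2 ⟨h, g1, g2⟩) (fun h => (memH _ _).2 ⟨h, g2, g1⟩)
  obtain ⟨n, f, hn, inj, hW, hcyc⟩ := cyc_build hne wfH symH two hc
  have hxf : ∀ i < n, f i ≠ x := fun i hi => (Finset.mem_erase.1 ((hW (f i)).2 ⟨i, hi, rfl⟩)).1
  have hfV : ∀ i < n, f i ∈ V := fun i hi => (Finset.mem_erase.1 ((hW (f i)).2 ⟨i, hi, rfl⟩)).2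
  have memp : ∀ v, v ∈ (List.range n).map f ↔ ∃ i < n, v = f i := by
    intro v
    rw [List.mem_map]
    constructor
    · rintro ⟨i, hi, rfl⟩; exact ⟨i, by simpa using hi, rfl⟩
    · rintro ⟨i, hi, rfl⟩; exact ⟨i, by simpa using hi, rfl⟩
  refine ⟨(List.range n).map f, x, by simpa using hn, ?_, ?_, ?_, ?_, ?_⟩
  · rw [List.length_map, List.length_range]
    by_contra hodd
    rw [Nat.not_odd_iff_even] at hodd
    apply hE.ncol
    obtain ⟨m, hm⟩ := hodd
    let φ : ℕ → Fin 3 := fun v => if v = x then 2 else if ∃ i < n, v = f i ∧ i % 2 = 0 then 0 else 1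
    have φf : ∀ i < n, φ (f i) = if i % 2 = 0 then 0 else 1 := by
      intro i hi
      simp only [φ, hxf i hi, if_false]
      congr 1
      rw [eq_iff_iff]
      constructor
      · rintro ⟨j, hj, h1, h2⟩; rw [inj i hi j hj h1]; exact h2
      · intro h; exact ⟨i, hi, rfl, h⟩
    have φx : φ x = 2 := by simp [φ]
    have φn : ∀ v, v ≠ x → φ v ≠ 2 := by
      intro v hv
      simp only [φ, hv, if_false]
      split_ifs <;> decide
    have φs : ∀ i < n, φ (f i) ≠ φ (f ((i + 1) % n)) := by
      intro i hi
      rw [φf i hi, φf _ (Nat.mod_lt _ (by omega))]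
      have : ((i + 1) % n) % 2 = (i + 1) % 2 := Nat.mod_mod_of_dvd _ ⟨m, by omega⟩
      rw [this]
      rcases Nat.mod_two_eq_zero_or_one i with h | h
      · rw [if_pos h, if_neg (by omega)]; decide
      · rw [if_neg (by omega), if_pos (by omega)]; decide
    refine ⟨φ, ?_⟩
    have hno : ∀ a b, ¬ mono A φ a b := by
      rintro a b ⟨hab, hφ⟩
      have hw := hE.wf _ hab
      by_cases h1 : a = x
      · subst h1; rw [φx] at hφ; exact φn b (fun h => hw.2.2 h.symm) hφ.symm
      by_cases h2 : b = x
      · subst h2; rw [φx] at hφ; exact φn a h1 hφ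
      obtain ⟨i, hi, ⟨rfl, rfl⟩ | ⟨rfl, rfl⟩⟩ := (hcyc a b).1 ((memH a b).2 ⟨hab, h1, h2⟩)
      · exact φs i hi hφ
      · exact φs i hi hφ.symm
    intro y hy
    obtain ⟨z, hz, _⟩ := TransGen.head'_iff.1 hy
    exact hno _ _ hz
  · apply List.Nodup.map_on _ List.nodup_range
    intro i hi j hj hij
    exact inj i (by simpa using hi) j (by simpa using hj) hij
  · intro h
    obtain ⟨i, hi, h⟩ := (memp x).1 h
    exact hxf i hi h.symm
  · ext v
    rw [Finset.mem_insert, List.mem_toFinset, memp, ← hW, Finset.mem_erase]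
    constructor
    · intro h; by_cases h' : v = x
      · exact Or.inl h'
      · exact Or.inr ⟨h', h⟩
    · rintro (h | h)
      · rw [h]; exact hx
      · exact h.2
  · ext ⟨a, b⟩
    rw [Finset.mem_union, Finset.mem_union, Dgraph.symmCyc, Finset.mem_union, cyc_mem, Finset.mem_image,
      Finset.mem_image, Finset.mem_image]
    constructor
    · intro hab
      have hw := hE.wf _ hab
      by_cases h1 : a = x
      · refine Or.inl (Or.inr ⟨b, ?_, by rw [h1]⟩)
        rw [List.mem_toFinset, memp, ← hW]
        exact Finset.mem_erase.2 ⟨fun h => hw.2.2 (h1.trans h.symm), hw.2.1⟩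
      by_cases h2 : b = x
      · refine Or.inr ⟨a, ?_, by rw [h2]⟩
        rw [List.mem_toFinset, memp, ← hW]
        exact Finset.mem_erase.2 ⟨h1, hw.1⟩
      refine Or.inl (Or.inl ?_)
      obtain ⟨i, hi, ⟨h1, h2⟩ | ⟨h1, h2⟩⟩ := (hcyc a b).1 ((memH a b).2 ⟨hab, h1, h2⟩)
      · exact Or.inl ⟨i, hi, by rw [h1, h2]⟩
      · refine Or.inr ⟨(b, a), (cyc_mem f).2 ⟨i, hi, by rw [h1, h2]⟩, rfl⟩
    · rintro (((⟨i, hi, he⟩ | ⟨e, he, he'⟩) | ⟨y, hy, he⟩) | ⟨y, hy, he⟩)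
      · have := Prod.mk.inj he
        exact ((memH a b).1 ((hcyc a b).2 ⟨i, hi, Or.inl this⟩)).1
      · obtain ⟨i, hi, rfl⟩ := (cyc_mem f).1 he
        have := Prod.mk.inj he'
        simp only at this
        exact ((memH a b).1 ((hcyc a b).2 ⟨i, hi, Or.inr ⟨this.2.symm, this.1.symm⟩⟩)).1
      · obtain ⟨i, hi, rfl⟩ := (memp y).1 (List.mem_toFinset.1 hy)
        rw [← he]; exact (hfull (f i) (hfV i hi) (hxf i hi)).1
      · obtain ⟨i, hi, rfl⟩ := (memp y).1 (List.mem_toFinset.1 hy)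
        rw [← he]; exact (hfull (f i) (hfV i hi) (hxf i hi)).2

end Ex


/-- Theorem 5.1: a k-extremal digraph (k ≥ 3) is ↔K_{k+1},
or a symmetric odd wheel (only for k = 3), or a directed Hajós join of two
k-extremal digraphs, or a Hajós bijoin of two k-extremal digraphs. -/
theorem statement_14 (k : ℕ) (hk : 3 ≤ k) (D : Dgraph) (hWF : D.WF)
    (hext : Extremal k D) :
    IsBiComplete D (k + 1) ∨
    (k = 3 ∧ IsSymOddWheel D) ∨
    (∃ D1 D2, IsDirHajosJoin D D1 D2 ∧ Extremal k D1 ∧ Extremal k D2) ∨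
    (∃ D1 D2, IsHajosBijoin D D1 D2 ∧ Extremal k D1 ∧ Extremal k D2) := by
  have hE := Ex.ext_of_extremal hWF hext
  rcases Ex.main_out (D.verts.card + 1) k D.verts D.arcs hk (by omega) hE with ⟨h1, h2⟩ | ⟨h1, h2⟩ | h
  · left
    refine ⟨h1, ?_⟩
    ext ⟨a, b⟩
    rw [Finset.mem_filter, Finset.mem_product]
    constructor
    · intro hab
      have := hE.wf _ hab
      exact ⟨⟨this.1, this.2.1⟩, this.2.2⟩
    · rintro ⟨⟨ha, hb⟩, hn⟩
      exact h2 a ha b hb hn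
  · right; left
    subst h1
    exact ⟨rfl, Ex.wheel_case hE h2⟩
  · obtain ⟨a, V1, V2, hS, hc1, hc2, t, ht, u, hu, htu⟩ := Ex.sep_conn hE h
    exact Or.inr (Or.inr (Ex.join_case hk hE hS hc1 hc2 ht hu htu))
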